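/- Let g ≥ 2 be an integer. If integers k ≥ 1, digits 1 ≤ d₁, d₂, d₃, d₄ ≤ g − 1 and exponents 1 ≤ ℓ ≤ m ≤ n ≤ t satisfy N_k = d₁(gˡ−1)/(g−1) · d₂(gᵐ−1)/(g−1) · d₃(gⁿ−1)/(g−1) · d₄(gᵗ−1)/(g−1), then t < 2.11·10⁶⁷ (log g)¹² and k < 2.54·10⁶⁸ (log g)¹³. In particular, for each fixed g this equation has only finitely many solutions. -/

import Mathlib

/-- The Narayana sequence: N₀ = 0, N₁ = N₂ = 1, Nₙ = Nₙ₋₁ + Nₙ₋₃. -/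
def narayana : ℕ → ℕ
  | 0 => 0
  | 1 => 1
  | 2 => 1
  | n + 3 => narayana (n + 2) + narayana n

/-- `N_k = d₁(gˡ−1)/(g−1) · d₂(gᵐ−1)/(g−1) · d₃(gⁿ−1)/(g−1) · d₄(gᵗ−1)/(g−1)`,
with the common denominator `(g−1)⁴` cleared. -/
def IsSolution (g k d₁ d₂ d₃ d₄ ℓ m n t : ℕ) : Prop :=
  1 ≤ k ∧ 1 ≤ d₁ ∧ d₁ ≤ g - 1 ∧ 1 ≤ d₂ ∧ d₂ ≤ g - 1 ∧ 1 ≤ d₃ ∧ d₃ ≤ g - 1 ∧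
  1 ≤ d₄ ∧ d₄ ≤ g - 1 ∧ 1 ≤ ℓ ∧ ℓ ≤ m ∧ m ≤ n ∧ n ≤ t ∧
  narayana k * (g - 1) ^ 4 =
    d₁ * d₂ * d₃ * d₄ * (g ^ ℓ - 1) * (g ^ m - 1) * (g ^ n - 1) * (g ^ t - 1)


namespace ZE
open Module

structure IsFilt (F : Type*) {A : Type*} [Field F] [CommRing A] [Algebra F A]
    (V : ℕ → Submodule F A) : Prop where
  fin : ∀ j, FiniteDimensional F (V j)
  mono : Monotone V
  mul : ∀ i j a b, a ∈ V i → b ∈ V j → a * b ∈ V (i + j)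
  exh : ∀ a, ∃ j, a ∈ V j

variable {F A : Type*} [Field F] [CommRing A] [Algebra F A]

noncomputable def hf (V : ℕ → Submodule F A) (I : Ideal A) (j : ℕ) : ℕ :=
  finrank F ((V j).map (Ideal.Quotient.mkₐ F I).toLinearMap)

theorem rank_aux {M M' M'' : Type*} [AddCommGroup M] [Module F M] [AddCommGroup M'] [Module F M']
    [AddCommGroup M''] [Module F M''] (f : M →ₗ[F] M') (g : M →ₗ[F] M'')
    (hfg : LinearMap.ker f ≤ LinearMap.ker g) (U V : Submodule F M) [FiniteDimensional F V]
    (hUV : U ≤ V) (hU : U ≤ LinearMap.ker g) :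
    finrank F (V.map g) + finrank F (U.map f) ≤ finrank F (V.map f) := by
  have hU' : FiniteDimensional F U := Submodule.finiteDimensional_of_le hUV
  let f' : V →ₗ[F] M' := f.comp V.subtype
  let g' : V →ₗ[F] M'' := g.comp V.subtype
  have e1 : LinearMap.range f' = V.map f := by
    rw [LinearMap.range_comp, Submodule.range_subtype]
  have e2 : LinearMap.range g' = V.map g := by
    rw [LinearMap.range_comp, Submodule.range_subtype]
  have r1 := LinearMap.finrank_range_add_finrank_ker f'
  have r2 := LinearMap.finrank_range_add_finrank_ker g'
  rw [e1] at r1; rw [e2] at r2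
  let f'' : (LinearMap.ker g') →ₗ[F] M' := f'.comp (LinearMap.ker g').subtype
  have r3 := LinearMap.finrank_range_add_finrank_ker f''
  have h4 : finrank F (U.map f) ≤ finrank F (LinearMap.range f'') := by
    apply Submodule.finrank_mono
    rintro _ ⟨u, hu, rfl⟩
    refine ⟨⟨⟨u, hUV hu⟩, ?_⟩, rfl⟩
    exact hU hu
  have h5 : finrank F (LinearMap.ker f'') = finrank F (LinearMap.ker f') := by
    have : LinearMap.ker f' ≤ LinearMap.ker g' := by
      intro x hx
      exact hfg hx
    have e : LinearMap.ker f'' = (LinearMap.ker f').comap (LinearMap.ker g').subtype := by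
      ext x; rfl
    rw [e]
    exact (Submodule.comapSubtypeEquivOfLe this).finrank_eq
  omega

theorem mkker_le {I J : Ideal A} (h : I ≤ J) :
    LinearMap.ker (Ideal.Quotient.mkₐ F I).toLinearMap ≤
    LinearMap.ker (Ideal.Quotient.mkₐ F J).toLinearMap := by
  intro x hx
  have : (Ideal.Quotient.mk I) x = 0 := hx
  show (Ideal.Quotient.mk J) x = 0
  rw [Ideal.Quotient.eq_zero_iff_mem] at *
  exact h this

variable {V : ℕ → Submodule F A}

theorem hf_mono (hV : IsFilt F V) (I : Ideal A) : Monotone (hf V I) := by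
  intro i j hij
  have := hV.fin j
  apply Submodule.finrank_mono
  exact Submodule.map_mono (hV.mono hij)

theorem hf_anti (hV : IsFilt F V) {I J : Ideal A} (h : I ≤ J) (j : ℕ) : hf V J j ≤ hf V I j := by
  have := hV.fin j
  have := rank_aux (Ideal.Quotient.mkₐ F I).toLinearMap (Ideal.Quotient.mkₐ F J).toLinearMap
    (mkker_le h) ⊥ (V j) bot_le bot_le
  unfold hf; omega

theorem B1 (hV : IsFilt F V) {p J : Ideal A} [hp : p.IsPrime] (hJ : p ≤ J) {Q : A} (hQ1 : Q ∈ V 1)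
    (hQp : Q ∉ p) (hQJ : Q ∈ J) (j : ℕ) : hf V J (j + 1) + hf V p j ≤ hf V p (j + 1) := by
  have i1 := hV.fin (j+1)
  have i0 := hV.fin j
  have := rank_aux (Ideal.Quotient.mkₐ F p).toLinearMap (Ideal.Quotient.mkₐ F J).toLinearMap
    (mkker_le hJ) ((V j).map (LinearMap.mulLeft F Q)) (V (j+1)) ?_ ?_
  · refine le_trans ?_ this
    apply Nat.add_le_add_left
    unfold hf
    have e : ((V j).map (LinearMap.mulLeft F Q)).map (Ideal.Quotient.mkₐ F p).toLinearMap
      = ((V j).map (Ideal.Quotient.mkₐ F p).toLinearMap).map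
        (LinearMap.mulLeft F (Ideal.Quotient.mk p Q)) := by
      rw [← Submodule.map_comp, ← Submodule.map_comp]
      congr 1
    rw [e]
    apply le_of_eq
    symm
    apply LinearEquiv.finrank_eq
    symm
    apply Submodule.equivMapOfInjective
    intro a b hab
    simp only [LinearMap.mulLeft_apply] at hab
    apply mul_left_cancel₀ _ hab
    rwa [Ne, Ideal.Quotient.eq_zero_iff_mem]
  · rintro _ ⟨v, hv, rfl⟩
    rw [add_comm]
    exact hV.mul 1 j _ _ hQ1 hv
  · rintro _ ⟨v, hv, rfl⟩
    show (Ideal.Quotient.mk J) (Q * v) = 0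
    rw [Ideal.Quotient.eq_zero_iff_mem]
    exact J.mul_mem_right _ hQJ

theorem exists_sep (S : Finset (Ideal A)) (hS : ∀ p ∈ S, p.IsPrime)
    (hinc : ∀ p ∈ S, ∀ q ∈ S, p ≤ q → p = q) (p : Ideal A) (hp : p ∈ S) :
    ∃ e : A, e ∉ p ∧ ∀ q ∈ S, q ≠ p → e ∈ q := by
  classical
  have hpp := hS p hp
  have : ¬ ((S.erase p).inf id ≤ p) := by
    intro h
    rw [Ideal.IsPrime.inf_le' hpp] at h
    obtain ⟨q, hq, hqp⟩ := h
    rw [Finset.mem_erase] at hq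
    exact hq.1 (hinc q hq.2 p hp hqp)
  obtain ⟨e, he, hep⟩ := SetLike.not_le_iff_exists.mp this
  refine ⟨e, hep, fun q hq hqp => ?_⟩
  have : (S.erase p).inf id ≤ id q := Finset.inf_le (Finset.mem_erase.mpr ⟨hqp, hq⟩)
  exact this he

theorem B0 (hV : IsFilt F V) (I : Ideal A) (S : Finset (Ideal A)) (hS : ∀ p ∈ S, p.IsPrime)
    (hinc : ∀ p ∈ S, ∀ q ∈ S, p ≤ q → p = q) (hI : ∀ p ∈ S, I ≤ p) :
    ∃ d, ∀ j, ∑ p ∈ S, hf V p j ≤ hf V I (j + d) := by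
  classical
  have hsep := exists_sep S hS hinc
  choose! e he1 he2 using hsep
  choose dd hdd using fun a => hV.exh a
  refine ⟨S.sup (fun p => dd (e p)), fun j => ?_⟩
  set d := S.sup (fun p => dd (e p))
  have hed : ∀ p ∈ S, e p ∈ V d := fun p hp =>
    hV.mono (Finset.le_sup (f := fun p => dd (e p)) hp) (hdd (e p))
  have i1 := hV.fin (j+d)
  have i0 := hV.fin j
  let φ : A →ₗ[F] ((p : S) → A ⧸ (p : Ideal A)) :=
    LinearMap.pi (fun p => (Ideal.Quotient.mkₐ F (p : Ideal A)).toLinearMap)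
  have hφ : LinearMap.ker (Ideal.Quotient.mkₐ F I).toLinearMap ≤ LinearMap.ker φ := by
    intro x hx
    rw [LinearMap.mem_ker]
    ext p
    exact mkker_le (hI p p.2) hx
  have h1 := rank_aux _ φ hφ ⊥ (V (j+d)) bot_le bot_le
  let W : (p : S) → Submodule F (A ⧸ (p : Ideal A)) :=
    fun p => (V j).map (Ideal.Quotient.mkₐ F (p : Ideal A)).toLinearMap
  have hWf : ∀ p, FiniteDimensional F (W p) := fun p => inferInstance
  let ψ : ((p : S) → W p) →ₗ[F] ((p : S) → A ⧸ (p : Ideal A)) :=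
    LinearMap.pi (fun p => (LinearMap.mulLeft F (Ideal.Quotient.mk (p : Ideal A) (e p))).comp
      ((W p).subtype.comp (LinearMap.proj p)))
  have hψi : Function.Injective ψ := by
    intro a b hab
    ext p
    have h := congrFun hab p
    have hpp := hS p p.2
    have h' : Ideal.Quotient.mk (p : Ideal A) (e p) * (a p : A ⧸ (p : Ideal A))
      = Ideal.Quotient.mk (p : Ideal A) (e p) * (b p : A ⧸ (p : Ideal A)) := h
    apply mul_left_cancel₀ _ h'
    rw [Ne, Ideal.Quotient.eq_zero_iff_mem]
    exact he1 p p.2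
  have hψr : LinearMap.range ψ ≤ (V (j+d)).map φ := by
    rintro _ ⟨a, rfl⟩
    have : ∀ p : S, ∃ v ∈ V j, Ideal.Quotient.mk (p : Ideal A) v = (a p : A ⧸ (p : Ideal A)) := by
      intro p
      obtain ⟨v, hv, h⟩ := (a p).2
      exact ⟨v, hv, h⟩
    choose v hv hva using this
    refine ⟨∑ p : S, e p * v p, ?_, ?_⟩
    · apply Submodule.sum_mem
      intro p _
      rw [add_comm]
      exact hV.mul _ _ _ _ (hed p p.2) (hv p)
    · ext p
      show Ideal.Quotient.mk (p : Ideal A) (∑ p : S, e p * v p) =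
        Ideal.Quotient.mk (p : Ideal A) (e p) * (a p : A ⧸ (p : Ideal A))
      rw [map_sum, Finset.sum_eq_single p]
      · rw [map_mul, hva]
      · intro q _ hq
        rw [Ideal.Quotient.eq_zero_iff_mem]
        apply Ideal.mul_mem_right
        exact he2 q q.2 p p.2 (fun h => hq (Subtype.ext h.symm))
      · simp
  have h2 := Submodule.finrank_mono hψr
  rw [LinearMap.finrank_range_of_inj hψi, Module.finrank_pi_fintype] at h2
  have h3 : ∑ p ∈ S, hf V p j = ∑ p : S, finrank F (W p) := by
    rw [← Finset.sum_coe_sort]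
    rfl
  rw [h3]
  unfold hf
  omega

theorem hf_bot [IsDomain A] (j : ℕ) : hf V (⊥ : Ideal A) j = finrank F (V j) := by
  unfold hf
  apply LinearEquiv.finrank_eq
  symm
  apply Submodule.equivMapOfInjective
  intro a b hab
  have : (Ideal.Quotient.mk (⊥ : Ideal A)) a = (Ideal.Quotient.mk (⊥ : Ideal A)) b := hab
  rw [Ideal.Quotient.eq] at this
  simpa [sub_eq_zero] using this

theorem hP_le [IsDomain A] (hV : IsFilt F V) {N : ℕ} (hN : ∀ j, finrank F (V j) = N * j ^ 3)
    {P : A} (hP : P ∈ V 1) (hP0 : P ≠ 0) (j : ℕ) :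
    hf V (Ideal.span {P}) j ≤ 3 * N * j ^ 2 := by
  cases j with
  | zero =>
    refine (hf_anti hV bot_le 0).trans ?_
    rw [hf_bot, hN]; simp
  | succ j =>
    have := B1 hV (p := ⊥) (J := Ideal.span {P}) bot_le hP (by simpa using hP0)
      (Ideal.mem_span_singleton_self P) j
    rw [hf_bot, hf_bot, hN, hN] at this
    have h2 : N * (j+1)^3 + N * (3*j+2) = N * j^3 + 3 * N * (j+1)^2 := by ring
    have := Nat.zero_le (N * (3*j+2))
    omega

theorem hf_sum_le [IsDomain A] (hV : IsFilt F V) {N : ℕ} (hN : ∀ j, finrank F (V j) = N * j ^ 3)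
    {P : A} (hP : P ∈ V 1) (hP0 : P ≠ 0)
    (S : Finset (Ideal A)) (hS : ∀ p ∈ S, p.IsPrime)
    (hinc : ∀ p ∈ S, ∀ q ∈ S, p ≤ q → p = q) (hPS : ∀ p ∈ S, P ∈ p) :
    ∃ d, ∀ j, ∑ p ∈ S, hf V p j ≤ 3 * N * (j + d) ^ 2 := by
  obtain ⟨d, hd⟩ := B0 hV (Ideal.span {P}) S hS hinc
    (fun p hp => (Ideal.span_singleton_le_iff_mem p).mpr (hPS p hp))
  exact ⟨d, fun j => (hd j).trans (hP_le hV hN hP hP0 _)⟩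

theorem asymp {W N d : ℕ} (h : ∀ j, W * (j * j) ≤ 2 * (3 * N * (j + d) ^ 2) + W * j) : W ≤ 6 * N := by
  by_contra hc
  push Not at hc
  have := h (12 * N * d + 6 * N * d * d + W + 1)
  set j := 12 * N * d + 6 * N * d * d + W + 1 with hj
  obtain ⟨w, hw⟩ := Nat.exists_eq_add_of_lt hc
  have h1 : (6 * N) * (j*j) + j * j ≤ W * (j * j) := by rw [hw]; nlinarith [Nat.zero_le (w * (j*j))]
  have h2 : 2 * (3 * N * (j + d) ^ 2) = (6 * N) * (j*j) + 12 * N * d * j + 6 * N * d * d := by ring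
  have h3 : j * j = 12 * N * d * j + 6 * N * d * d * j + W * j + j := by
    conv_lhs => enter [1]; rw [hj]
    ring
  have h4 : 6 * N * d * d ≤ 6 * N * d * d * j := Nat.le_mul_of_pos_right _ (by omega)
  have h5 : 0 < j := by omega
  omega

theorem propC [IsDomain A] (hV : IsFilt F V) {N : ℕ} (hN : ∀ j, finrank F (V j) = N * j ^ 3)
    {P : A} (hP : P ∈ V 1) (hP0 : P ≠ 0)
    (S : Finset (Ideal A)) (hS : ∀ p ∈ S, p.IsPrime)
    (hinc : ∀ p ∈ S, ∀ q ∈ S, p ≤ q → p = q) (hPS : ∀ p ∈ S, P ∈ p)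
    (Q : Ideal A → A) (hQ : ∀ p ∈ S, Q p ∈ V 1) (hQ' : ∀ p ∈ S, Q p ∉ p)
    (G : Ideal A → Finset (Ideal A)) (hG : ∀ p ∈ S, ∀ q ∈ G p, q.IsPrime)
    (hGinc : ∀ p ∈ S, ∀ q ∈ G p, ∀ q' ∈ G p, q ≤ q' → q = q')
    (hGle : ∀ p ∈ S, ∀ q ∈ G p, p ≤ q ∧ Q p ∈ q)
    (w : Ideal A → ℕ) (hw : ∀ p ∈ S, ∀ q ∈ G p, ∃ d, ∀ j, w q * j ≤ hf V q (j + d)) :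
    ∑ p ∈ S, ∑ q ∈ G p, w q ≤ 6 * N := by
  classical
  obtain ⟨d, hd⟩ := hf_sum_le hV hN hP hP0 S hS hinc hPS
  have key : ∀ p ∈ S, ∃ d', ∀ j, (∑ q ∈ G p, w q) * j + hf V p (j + d') ≤ hf V p (j + d' + 1) := by
    intro p hp
    have hpp := hS p hp
    obtain ⟨d1, h1⟩ := B0 hV (p ⊔ Ideal.span {Q p}) (G p) (hG p hp) (hGinc p hp)
      (fun q hq => sup_le (hGle p hp q hq).1
        ((Ideal.span_singleton_le_iff_mem q).mpr (hGle p hp q hq).2))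
    choose! d2 h2 using hw p hp
    let d3 := (G p).sup d2
    refine ⟨d3 + d1, fun j => ?_⟩
    have h3 := B1 hV (J := p ⊔ Ideal.span {Q p}) le_sup_left (hQ p hp) (hQ' p hp)
      (Ideal.mem_sup_right (Ideal.mem_span_singleton_self _)) (j + (d3 + d1))
    have h4 : (∑ q ∈ G p, w q) * j ≤ ∑ q ∈ G p, hf V q (j + d3) := by
      rw [Finset.sum_mul]
      apply Finset.sum_le_sum
      intro q hq
      exact (h2 q hq j).trans (hf_mono hV q (Nat.add_le_add_left (Finset.le_sup hq) j))
    have h5 := h1 (j + d3)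
    have h6 := hf_mono hV (p ⊔ Ideal.span {Q p}) (show j + d3 + d1 ≤ j + (d3 + d1) + 1 by omega)
    omega
  choose! D hD using key
  let E := S.sup D
  set W := ∑ p ∈ S, ∑ q ∈ G p, w q
  have key2 : ∀ p ∈ S, ∀ j, (∑ q ∈ G p, w q) * j + hf V p (j + E) ≤ hf V p (j + E + 1) := by
    intro p hp j
    have hle : D p ≤ E := Finset.le_sup (f := D) hp
    have h := hD p hp (j + (E - D p))
    have e : j + (E - D p) + D p = j + E := by omega
    rw [e] at h
    nlinarith [Nat.zero_le ((∑ q ∈ G p, w q) * (E - D p))]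
  have key3 : ∀ j, W * j + ∑ p ∈ S, hf V p (j + E) ≤ ∑ p ∈ S, hf V p (j + E + 1) := by
    intro j
    rw [Finset.sum_mul, ← Finset.sum_add_distrib]
    exact Finset.sum_le_sum (fun p hp => key2 p hp j)
  have key4 : ∀ j, W * (j * j) ≤ 2 * ∑ p ∈ S, hf V p (j + E) + W * j := by
    intro j
    induction j with
    | zero => simp
    | succ j ih =>
      have := key3 j
      have e : j + 1 + E = j + E + 1 := by ring
      rw [e]
      nlinarith
  apply asymp (d := E + d)
  intro j
  have := hd (j + E)
  have h := key4 j
  rw [← add_assoc j]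
  omega

end ZE


namespace ZE
open Module MvPolynomial

abbrev A3 := MvPolynomial (Fin 3) ℝ

def expSet (K1 K2 L j : ℕ) : Set (Fin 3 →₀ ℕ) := {e | e 0 < j * K1 ∧ e 1 < j * K2 ∧ e 2 < j * L}

noncomputable def VV (K1 K2 L : ℕ) (j : ℕ) : Submodule ℝ A3 :=
  restrictSupport ℝ (expSet K1 K2 L j)

noncomputable def expEquiv (K1 K2 L j : ℕ) :
    expSet K1 K2 L j ≃ Fin (j * K1) × Fin (j * K2) × Fin (j * L) where
  toFun e := (⟨e.1 0, e.2.1⟩, ⟨e.1 1, e.2.2.1⟩, ⟨e.1 2, e.2.2.2⟩)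
  invFun q := ⟨Finsupp.equivFunOnFinite.symm ![q.1, q.2.1, q.2.2], by
    simp [expSet]⟩
  left_inv := by
    rintro ⟨e, he⟩
    ext i
    fin_cases i <;> simp
  right_inv := by
    rintro ⟨a, b, c⟩
    simp

theorem finite_expSet (K1 K2 L j : ℕ) : Finite (expSet K1 K2 L j) :=
  Finite.of_equiv _ (expEquiv K1 K2 L j).symm

theorem finrank_VV (K1 K2 L j : ℕ) : finrank ℝ (VV K1 K2 L j) = K1 * K2 * L * j ^ 3 := by
  have := finite_expSet K1 K2 L j
  rw [VV, finrank_eq_nat_card_basis (basisRestrictSupport ℝ _),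
    Nat.card_congr (expEquiv K1 K2 L j)]
  simp
  ring

theorem mem_VV_iff {K1 K2 L j : ℕ} {P : A3} :
    P ∈ VV K1 K2 L j ↔ ∀ e ∈ P.support, e 0 < j * K1 ∧ e 1 < j * K2 ∧ e 2 < j * L := by
  rw [VV, mem_restrictSupport_iff]; rfl

theorem mem_VV_of_degreeOf {K1 K2 L j : ℕ} {P : A3} (h0 : P.degreeOf 0 < j * K1)
    (h1 : P.degreeOf 1 < j * K2) (h2 : P.degreeOf 2 < j * L) : P ∈ VV K1 K2 L j := by
  rw [mem_VV_iff]
  intro e he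
  exact ⟨(monomial_le_degreeOf 0 he).trans_lt h0, (monomial_le_degreeOf 1 he).trans_lt h1,
    (monomial_le_degreeOf 2 he).trans_lt h2⟩

theorem isFilt_VV {K1 K2 L : ℕ} (h1 : 0 < K1) (h2 : 0 < K2) (h3 : 0 < L) :
    IsFilt ℝ (VV K1 K2 L) where
  fin j := by
    have := finite_expSet K1 K2 L j
    exact Module.Finite.of_basis (basisRestrictSupport ℝ (expSet K1 K2 L j))
  mono := by
    intro i j hij P hP
    rw [mem_VV_iff] at *
    intro e he
    obtain ⟨a, b, c⟩ := hP e he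
    exact ⟨a.trans_le (Nat.mul_le_mul_right _ hij), b.trans_le (Nat.mul_le_mul_right _ hij),
      c.trans_le (Nat.mul_le_mul_right _ hij)⟩
  mul := by
    intro i j P Q hP hQ
    rw [mem_VV_iff] at *
    intro e he
    classical
    have := support_mul P Q he
    rw [Finset.mem_add] at this
    obtain ⟨a, ha, b, hb, rfl⟩ := this
    obtain ⟨a1, a2, a3⟩ := hP a ha
    obtain ⟨b1, b2, b3⟩ := hQ b hb
    simp only [Finsupp.add_apply, add_mul]
    omega
  exh := by
    intro P
    refine ⟨P.degreeOf 0 + P.degreeOf 1 + P.degreeOf 2 + 1, mem_VV_of_degreeOf ?_ ?_ ?_⟩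
    · exact lt_of_lt_of_le (by omega) (Nat.le_mul_of_pos_right _ h1)
    · exact lt_of_lt_of_le (by omega) (Nat.le_mul_of_pos_right _ h2)
    · exact lt_of_lt_of_le (by omega) (Nat.le_mul_of_pos_right _ h3)

noncomputable def tau (x y c : ℝ) : A3 →ₐ[ℝ] A3 :=
  aeval ![X 0 + C x, X 1 + C y, C c * X 2]

@[simp] theorem tau_X0 (x y c : ℝ) : tau x y c (X 0) = X 0 + C x := by simp [tau]
@[simp] theorem tau_X1 (x y c : ℝ) : tau x y c (X 1) = X 1 + C y := by simp [tau]
@[simp] theorem tau_X2 (x y c : ℝ) : tau x y c (X 2) = C c * X 2 := by simp [tau]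
@[simp] theorem tau_C (x y c a : ℝ) : tau x y c (C a) = C a := by
  simp [tau]

theorem tau_tau (x y c x' y' c' : ℝ) (P : A3) :
    tau x y c (tau x' y' c' P) = tau (x + x') (y + y') (c * c') P := by
  rw [← AlgHom.comp_apply]
  congr 1
  apply MvPolynomial.algHom_ext
  intro i
  fin_cases i
  · simp [add_assoc]
  · simp [add_assoc]
  · simp; ring

theorem tau_id (P : A3) : tau 0 0 1 P = P := by
  have : tau 0 0 1 = AlgHom.id ℝ A3 := by
    ext i
    fin_cases i <;> simp
  rw [this]; rfl

theorem eval_tau (x y c u v w : ℝ) (P : A3) :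
    eval ![u, v, w] (tau x y c P) = eval ![u + x, v + y, c * w] P := by
  have : (aeval ![u, v, w] : A3 →ₐ[ℝ] ℝ).comp (tau x y c) = aeval ![u + x, v + y, c * w] := by
    ext i
    fin_cases i <;> simp
  exact congrArg (fun f : A3 →ₐ[ℝ] ℝ => f P) this

theorem tau_mem_VV {K1 K2 L j : ℕ} (x y c : ℝ) {P : A3} (hP : P ∈ VV K1 K2 L j) :
    tau x y c P ∈ VV K1 K2 L j := by
  rw [mem_VV_iff] at hP
  rw [P.as_sum, map_sum]
  apply Submodule.sum_mem
  intro e he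
  obtain ⟨h0, h1, h2⟩ := hP e he
  have e1 : tau x y c (monomial e (coeff e P)) =
    C (coeff e P) * ((X 0 + C x) ^ e 0 * (X 1 + C y) ^ e 1 * (C c * X 2) ^ e 2) := by
    rw [tau, aeval_monomial, Finsupp.prod_fintype _ _ (by simp), Fin.prod_univ_three]
    simp
  have d0 : ∀ i, degreeOf i (X 0 + C x : A3) ≤ if i = 0 then 1 else 0 := by
    intro i
    refine (degreeOf_add_le _ _ _).trans ?_
    simp [degreeOf_X]
  have d1 : ∀ i, degreeOf i (X 1 + C y : A3) ≤ if i = 1 then 1 else 0 := by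
    intro i
    refine (degreeOf_add_le _ _ _).trans ?_
    simp [degreeOf_X]
  have d2 : ∀ i, degreeOf i (C c * X 2 : A3) ≤ if i = 2 then 1 else 0 := by
    intro i
    refine (degreeOf_C_mul_le _ _ _).trans ?_
    simp [degreeOf_X]
  have key : ∀ i, degreeOf i (tau x y c (monomial e (coeff e P))) ≤
      e 0 * (if i = 0 then 1 else 0) + e 1 * (if i = 1 then 1 else 0)
        + e 2 * (if i = 2 then 1 else 0) := by
    intro i
    rw [e1]
    refine (degreeOf_C_mul_le _ _ _).trans ((degreeOf_mul_le _ _ _).trans ?_)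
    refine add_le_add ((degreeOf_mul_le _ _ _).trans (add_le_add ?_ ?_)) ?_
    · exact (degreeOf_pow_le _ _ _).trans (Nat.mul_le_mul_left _ (d0 i))
    · exact (degreeOf_pow_le _ _ _).trans (Nat.mul_le_mul_left _ (d1 i))
    · exact (degreeOf_pow_le _ _ _).trans (Nat.mul_le_mul_left _ (d2 i))
  apply mem_VV_of_degreeOf
  · exact (key 0).trans_lt (by simpa using h0)
  · exact (key 1).trans_lt (by simpa using h1)
  · exact (key 2).trans_lt (by simpa using h2)

noncomputable def mI (u v w : ℝ) : Ideal A3 := RingHom.ker (eval ![u, v, w])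

theorem mem_mI {u v w : ℝ} {P : A3} : P ∈ mI u v w ↔ eval ![u, v, w] P = 0 := Iff.rfl

theorem mI_max (u v w : ℝ) : (mI u v w).IsMaximal :=
  RingHom.ker_isMaximal_of_surjective _ (fun r => ⟨C r, by simp⟩)

theorem mI_inj {u v w u' v' w' : ℝ} (h : mI u v w = mI u' v' w') : u = u' ∧ v = v' ∧ w = w' := by
  have h0 : (X 0 - C u : A3) ∈ mI u' v' w' := by rw [← h, mem_mI]; simp
  have h1 : (X 1 - C v : A3) ∈ mI u' v' w' := by rw [← h, mem_mI]; simp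
  have h2 : (X 2 - C w : A3) ∈ mI u' v' w' := by rw [← h, mem_mI]; simp
  rw [mem_mI] at h0 h1 h2
  simp [sub_eq_zero] at h0 h1 h2
  exact ⟨h0.symm, h1.symm, h2.symm⟩

theorem mI_eq_of_le {u v w : ℝ} {p : Ideal A3} (hp : p ≤ mI u v w) (h0 : X 0 - C u ∈ p)
    (h1 : X 1 - C v ∈ p) (h2 : X 2 - C w ∈ p) : p = mI u v w := by
  apply le_antisymm hp
  have e : (aeval ![C u, C v, C w] : A3 →ₐ[ℝ] A3) = (Algebra.ofId ℝ A3).comp (aeval ![u,v,w]) := by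
    ext i
    fin_cases i <;> simp [Algebra.ofId_apply, algebraMap_eq]
  have key : (Ideal.Quotient.mkₐ ℝ p) = (Ideal.Quotient.mkₐ ℝ p).comp
      ((Algebra.ofId ℝ A3).comp (aeval ![u,v,w])) := by
    rw [← e]
    ext i
    fin_cases i
    · simpa using (Ideal.Quotient.eq.mpr h0)
    · simpa using (Ideal.Quotient.eq.mpr h1)
    · simpa using (Ideal.Quotient.eq.mpr h2)
  intro P hP
  rw [mem_mI] at hP
  have h := congrArg (fun f : A3 →ₐ[ℝ] _ => f P) key
  have e2 : (aeval ![u,v,w] : A3 →ₐ[ℝ] ℝ) P = 0 := hP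
  simp only [AlgHom.comp_apply, e2, map_zero] at h
  exact Ideal.Quotient.eq_zero_iff_mem.mp h

theorem hf_pos (hV : IsFilt ℝ (VV K1 K2 L)) (h1 : 0 < K1) (h2 : 0 < K2) (h3 : 0 < L)
    {p : Ideal A3} (hp : p ≠ ⊤) {j : ℕ} (hj : 0 < j) : 1 ≤ hf (VV K1 K2 L) p j := by
  have := hV.fin j
  unfold hf
  rw [Nat.one_le_iff_ne_zero, ← Nat.pos_iff_ne_zero, Module.finrank_pos_iff_exists_ne_zero]
  refine ⟨⟨Ideal.Quotient.mk p 1, 1, ?_, rfl⟩, ?_⟩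
  · apply mem_VV_of_degreeOf <;> simp <;> omega
  · intro h
    have h' : Ideal.Quotient.mk p 1 = 0 := congrArg Subtype.val h
    rw [Ideal.Quotient.eq_zero_iff_mem] at h'
    exact (Ideal.ne_top_iff_one p).mp hp h'

theorem hf_ge_card (hV : IsFilt ℝ (VV K1 K2 L)) (h1 : 0 < K1) (h2 : 0 < K2) (h3 : 0 < L)
    {p : Ideal A3} (hp : p.IsPrime) {Q : A3} (hQ : Q ∈ VV K1 K2 L 1) (hQp : Q ∉ p)
    (S : Finset (Ideal A3)) (hS : ∀ m ∈ S, m.IsMaximal) (hSp : ∀ m ∈ S, p ≤ m ∧ Q ∈ m) :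
    ∃ d, ∀ j, S.card * j ≤ hf (VV K1 K2 L) p (j + d) := by
  obtain ⟨d, hd⟩ := B0 hV (p ⊔ Ideal.span {Q}) S (fun m hm => (hS m hm).isPrime)
    (fun m hm m' hm' h => (hS m hm).eq_of_le (hS m' hm').ne_top h)
    (fun q hq => sup_le (hSp q hq).1 ((Ideal.span_singleton_le_iff_mem q).mpr (hSp q hq).2))
  refine ⟨d, fun j => ?_⟩
  induction j with
  | zero => simp
  | succ j ih =>
    have h := B1 hV (J := p ⊔ Ideal.span {Q}) le_sup_left hQ hQp
      (Ideal.mem_sup_right (Ideal.mem_span_singleton_self _)) (j + d)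
    have h4 : S.card ≤ ∑ m ∈ S, hf (VV K1 K2 L) m (j + 1) := by
      rw [Finset.card_eq_sum_ones]
      exact Finset.sum_le_sum (fun m hm => hf_pos hV h1 h2 h3 (hS m hm).ne_top (by omega))
    have h5 := hd (j + 1)
    have e : j + 1 + d = j + d + 1 := by ring
    rw [e] at h5 ⊢
    rw [mul_add, mul_one]
    omega

end ZE


namespace ZE
open Module MvPolynomial

theorem height_mI (u v w : ℝ) : (3 : ℕ∞) ≤ (mI u v w).height := by
  let φ1 : A3 →ₐ[ℝ] A3 := aeval ![C u, X 1, X 2]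
  let φ2 : A3 →ₐ[ℝ] A3 := aeval ![C u, C v, X 2]
  let q1 : Ideal A3 := RingHom.ker φ1
  let q2 : Ideal A3 := RingHom.ker φ2
  have i1 : q1.IsPrime := RingHom.ker_isPrime _
  have i2 : q2.IsPrime := RingHom.ker_isPrime _
  have i3 : (mI u v w).IsPrime := (mI_max u v w).isPrime
  have X1ne : ∀ a : ℝ, (X 1 - C a : A3) ≠ 0 := by
    intro a h
    have := congrArg (eval ![0, a + 1, 0]) h
    simp at this
  have X2ne : ∀ a : ℝ, (X 2 - C a : A3) ≠ 0 := by
    intro a h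
    have := congrArg (eval ![0, 0, a + 1]) h
    simp at this
  have X0ne : ∀ a : ℝ, (X 0 - C a : A3) ≠ 0 := by
    intro a h
    have := congrArg (eval ![a + 1, 0, 0]) h
    simp at this
  have l1 : (⊥ : Ideal A3) < q1 := by
    rw [bot_lt_iff_ne_bot]
    intro h
    have : (X 0 - C u : A3) ∈ q1 := by
      show φ1 _ = 0
      simp [φ1, algebraMap_eq]
    rw [h] at this
    exact X0ne u this
  have l2 : q1 < q2 := by
    apply lt_of_le_of_ne
    · intro P hP
      have hP' : φ1 P = 0 := hP
      show φ2 P = 0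
      have : φ2.comp φ1 = φ2 := by
        apply MvPolynomial.algHom_ext
        intro i
        fin_cases i <;> simp [φ1, φ2, algebraMap_eq]
      rw [← this, AlgHom.comp_apply, hP', map_zero]
    · intro h
      have : (X 1 - C v : A3) ∈ q2 := by
        show φ2 _ = 0
        simp [φ2, algebraMap_eq]
      rw [← h] at this
      have h' : φ1 (X 1 - C v) = 0 := this
      simp [φ1, algebraMap_eq] at h'
      exact X1ne v h'
  have l3 : q2 < mI u v w := by
    apply lt_of_le_of_ne
    · intro P hP
      have hP' : φ2 P = 0 := hP
      show (aeval ![u, v, w] : A3 →ₐ[ℝ] ℝ) P = 0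
      have : (aeval ![u, v, w] : A3 →ₐ[ℝ] ℝ).comp φ2 = aeval ![u, v, w] := by
        apply MvPolynomial.algHom_ext
        intro i
        fin_cases i <;> simp [φ2]
      rw [← this, AlgHom.comp_apply, hP', map_zero]
    · intro h
      have : (X 2 - C w : A3) ∈ mI u v w := by rw [mem_mI]; simp
      rw [← h] at this
      have h' : φ2 (X 2 - C w) = 0 := this
      simp [φ2, algebraMap_eq] at h'
      exact X2ne w h'
  have a1 := Ideal.height_add_one_le_of_lt_of_isPrime l1
  have a2 := Ideal.height_add_one_le_of_lt_of_isPrime l2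
  have a3 := Ideal.height_add_one_le_of_lt_of_isPrime l3
  have b1 : (1 : ℕ∞) ≤ q1.height := le_trans (by simp) a1
  have b2 : (2 : ℕ∞) ≤ q2.height := le_trans (by
    calc (2 : ℕ∞) = 1 + 1 := by norm_num
      _ ≤ _ := by gcongr) a2
  refine le_trans ?_ a3
  calc (3 : ℕ∞) = 2 + 1 := by norm_num
    _ ≤ _ := by gcongr

theorem minprime_ne_mI {f Q : A3} {p : Ideal A3} (hp : p ∈ (Ideal.span {f, Q}).minimalPrimes)
    (u v w : ℝ) : p ≠ mI u v w := by
  intro h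
  have h1 := Ideal.height_le_card_of_mem_minimalPrimes_span (by simp) hp
  have h2 := height_mI u v w
  rw [← h] at h2
  have h3 : (({f, Q} : Set A3).ncard : ℕ∞) ≤ 2 := by
    have h4 := Set.ncard_insert_le f {Q}
    rw [Set.ncard_singleton] at h4
    exact_mod_cast h4
  have := h2.trans (h1.trans h3)
  norm_num at this

theorem degreeOf_tau_le (x y c : ℝ) (P : A3) (i : Fin 3) :
    degreeOf i (tau x y c P) ≤ degreeOf i P := by
  have h : P ∈ VV (degreeOf 0 P + 1) (degreeOf 1 P + 1) (degreeOf 2 P + 1) 1 := by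
    apply mem_VV_of_degreeOf <;> simp
  have h2 := mem_VV_iff.mp (tau_mem_VV x y c h)
  rw [← Nat.lt_add_one_iff, degreeOf_lt_iff (by omega)]
  intro e he
  have := h2 e he
  fin_cases i
  · simpa using this.1
  · simpa using this.2.1
  · simpa using this.2.2

noncomputable def tauE (x y c : ℝ) (hc : c ≠ 0) : A3 ≃ₐ[ℝ] A3 :=
  AlgEquiv.ofAlgHom (tau x y c) (tau (-x) (-y) c⁻¹)
    (by apply AlgHom.ext; intro P
        rw [AlgHom.comp_apply, tau_tau]; simp [hc, tau_id])
    (by apply AlgHom.ext; intro P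
        rw [AlgHom.comp_apply, tau_tau]; simp [hc, tau_id])

theorem tauE_apply (x y c : ℝ) (hc : c ≠ 0) (P : A3) : tauE x y c hc P = tau x y c P := rfl

theorem prime_tau {x y c : ℝ} (hc : c ≠ 0) {f : A3} (hf : Prime f) : Prime (tau x y c f) := by
  rw [← tauE_apply x y c hc]
  exact (MulEquiv.prime_iff (tauE x y c hc)).mpr hf

theorem degreeOf_tau (x y c : ℝ) (hc : c ≠ 0) (P : A3) (i : Fin 3) :
    degreeOf i (tau x y c P) = degreeOf i P := by
  apply le_antisymm (degreeOf_tau_le _ _ _ _ _)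
  have := degreeOf_tau_le (-x) (-y) c⁻¹ (tau x y c P) i
  rw [tau_tau] at this
  simpa [hc, tau_id] using this

theorem taylor_const {y u : ℝ} (hy : y ≠ 0) {q : Polynomial ℝ} (hq : q ≠ 0)
    (h : Polynomial.taylor y q = Polynomial.C u * q) : u = 1 ∧ q.natDegree = 0 := by
  have hu : u = 1 := by
    have := congrArg Polynomial.leadingCoeff h
    rw [Polynomial.leadingCoeff_taylor, Polynomial.leadingCoeff_mul, Polynomial.leadingCoeff_C] at this
    have h2 : q.leadingCoeff ≠ 0 := by simpa using hq
    have h3 : u * q.leadingCoeff = 1 * q.leadingCoeff := by rw [← this]; ring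
    exact mul_right_cancel₀ h2 h3
  refine ⟨hu, ?_⟩
  rw [hu, map_one, one_mul] at h
  have h2 : ∀ n : ℕ, q.eval (n * y) = q.eval 0 := by
    intro n
    induction n with
    | zero => simp
    | succ n ih =>
      rw [← ih]
      conv_rhs => rw [← h]
      rw [Polynomial.taylor_eval]
      push_cast
      ring_nf
  have : q = Polynomial.C (q.eval 0) := by
    apply Polynomial.eq_of_infinite_eval_eq
    refine Set.infinite_of_injective_forall_mem (f := fun n : ℕ => (n : ℝ) * y) ?_ ?_
    · intro a b hab
      have := mul_right_cancel₀ hy hab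
      exact_mod_cast this
    · intro n
      simp [h2]
  rw [this]; simp

noncomputable def Phi : A3 →ₐ[ℝ] (Polynomial (Polynomial (Polynomial ℝ))) :=
  MvPolynomial.aeval (![Polynomial.C (Polynomial.C Polynomial.X), Polynomial.C Polynomial.X,
    Polynomial.X] : Fin 3 → Polynomial (Polynomial (Polynomial ℝ)))

theorem Phi_monomial (e : Fin 3 →₀ ℕ) (a : ℝ) : Phi (monomial e a) =
    Polynomial.C (Polynomial.C (Polynomial.C a * Polynomial.X ^ e 0) * Polynomial.X ^ e 1)
      * Polynomial.X ^ e 2 := by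
  rw [Phi, aeval_monomial, Finsupp.prod_fintype _ _ (by simp), Fin.prod_univ_three]
  simp [Polynomial.algebraMap_apply]
  ring

theorem coeff_Phi (P : A3) (e : Fin 3 →₀ ℕ) :
    (((Phi P).coeff (e 2)).coeff (e 1)).coeff (e 0) = coeff e P := by
  induction P using MvPolynomial.induction_on' with
  | monomial e' a =>
    rw [Phi_monomial, coeff_monomial]
    rw [Polynomial.coeff_C_mul_X_pow]
    by_cases h : e' = e
    · subst h; simp only [if_true, Polynomial.coeff_C_mul_X_pow]
    · rw [if_neg h]
      split_ifs with h2
      · rw [Polynomial.coeff_C_mul_X_pow]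
        split_ifs with h1
        · rw [Polynomial.coeff_C_mul_X_pow]
          split_ifs with h0
          · exfalso; apply h; ext i; fin_cases i <;> simp_all
          · rfl
        · simp
      · simp
  | add p q hp hq => simp [hp, hq]

theorem coeff_Phi_tau (x c : ℝ) (P : A3) (d b : ℕ) :
    ((Phi (tau x 0 c P)).coeff d).coeff b =
      Polynomial.C (c ^ d) * Polynomial.taylor x (((Phi P).coeff d).coeff b) := by
  induction P using MvPolynomial.induction_on' with
  | monomial e a =>
    have e1 : tau x 0 c (monomial e a) =
      C a * ((X 0 + C x) ^ e 0 * (X 1 + C 0) ^ e 1 * (C c * X 2) ^ e 2) := by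
      rw [tau, aeval_monomial, Finsupp.prod_fintype _ _ (by simp), Fin.prod_univ_three]
      simp [algebraMap_eq]
    have hC : ∀ a : ℝ, Phi (C a) = Polynomial.C (Polynomial.C (Polynomial.C a)) := by
      intro a
      rw [Phi, aeval_C]; rfl
    have e2 : Phi (tau x 0 c (monomial e a)) =
      Polynomial.C (Polynomial.C (Polynomial.C (a * c ^ e 2) * (Polynomial.X + Polynomial.C x) ^ e 0)
        * Polynomial.X ^ e 1) * Polynomial.X ^ e 2 := by
      rw [e1]
      simp only [map_mul, map_pow, map_add, hC]
      simp [Phi]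
      ring
    rw [e2, Phi_monomial, Polynomial.coeff_C_mul_X_pow, Polynomial.coeff_C_mul_X_pow]
    split_ifs with h2
    · rw [Polynomial.coeff_C_mul_X_pow, Polynomial.coeff_C_mul_X_pow]
      split_ifs with h1
      · subst h1 h2
        simp
        ring
      · simp
    · simp
  | add p q hp hq =>
    simp only [map_add, Polynomial.coeff_add, hp, hq]
    ring

theorem assoc_C {f g : A3} (h : Associated f g) : ∃ u : ℝ, g = C u * f := by
  obtain ⟨u, rfl⟩ := h
  have := u.isUnit
  rw [isUnit_iff_eq_C_of_isReduced] at this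
  obtain ⟨r, _, hr⟩ := this
  exact ⟨r, by rw [hr]; ring⟩

theorem pow_ne_of {c : ℝ} (hc : 0 < c) (hc1 : c ≠ 1) {a b : ℕ} (h : c ^ a = c ^ b) : a = b :=
  pow_right_injective₀ hc hc1 h

theorem shiftX {f : A3} (hf : Prime f) (hX2 : ¬ Associated f (X 2)) {x c : ℝ} (hx : x ≠ 0)
    (hc : 0 < c) (hc1 : c ≠ 1) (h : Associated f (tau x 0 c f)) :
    degreeOf 0 f = 0 ∧ degreeOf 2 f = 0 := by
  obtain ⟨u, hu⟩ := assoc_C h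
  have hC : ∀ a : ℝ, Phi (C a) = Polynomial.C (Polynomial.C (Polynomial.C a)) := by
    intro a
    rw [Phi, aeval_C]; rfl
  have hune : u ≠ 0 := by
    rintro rfl
    have h1 := prime_tau (x := x) (y := 0) hc.ne' hf
    rw [hu] at h1
    simp at h1
  have key : ∀ e ∈ f.support, e 0 = 0 ∧ c ^ e 2 = u := by
    intro e he
    have h1 := coeff_Phi_tau x c f (e 2) (e 1)
    rw [hu, map_mul, hC, Polynomial.coeff_C_mul, Polynomial.coeff_C_mul] at h1
    have hne : ((Phi f).coeff (e 2)).coeff (e 1) ≠ 0 := by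
      intro h0
      have := coeff_Phi f e
      rw [h0] at this
      simp at this
      exact (mem_support_iff.mp he) this.symm
    set q := ((Phi f).coeff (e 2)).coeff (e 1) with hq
    have hcd : c ^ e 2 ≠ 0 := pow_ne_zero _ hc.ne'
    have h2 : Polynomial.taylor x q = Polynomial.C ((c ^ e 2)⁻¹ * u) * q := by
      rw [Polynomial.C_mul, mul_assoc, h1, ← mul_assoc, ← Polynomial.C_mul, inv_mul_cancel₀ hcd]
      simp
    obtain ⟨h3, h4⟩ := taylor_const hx hne h2
    constructor
    · have := coeff_Phi f e
      rw [← hq] at this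
      by_contra h0
      rw [Polynomial.coeff_eq_zero_of_natDegree_lt (by omega)] at this
      exact (mem_support_iff.mp he) this.symm
    · field_simp at h3
      exact h3.symm
  have h0 : degreeOf 0 f = 0 := by
    rw [degreeOf_eq_sup, ← Nat.bot_eq_zero, Finset.sup_eq_bot_iff]
    intro e he
    exact (key e he).1
  refine ⟨h0, ?_⟩
  by_contra h2
  apply hX2
  rw [degreeOf_eq_sup, ← Nat.bot_eq_zero, Finset.sup_eq_bot_iff] at h2
  push Not at h2
  obtain ⟨e, he, hne⟩ := h2
  have hdvd : X 2 ∣ f := by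
    rw [f.as_sum]
    apply Finset.dvd_sum
    intro e' he'
    rw [X_dvd_monomial]
    right
    have : e' 2 = e 2 := pow_ne_of hc hc1 ((key e' he').2.trans (key e he).2.symm)
    rw [this]; exact hne
  exact ((hf.irreducible.dvd_iff.mp hdvd).resolve_left (MvPolynomial.X_prime (i := (2 : Fin 3)) (R := ℝ)).not_isUnit)

theorem shiftY {f : A3} (hf : Prime f) (h0 : degreeOf 0 f = 0) (h2 : degreeOf 2 f = 0)
    {x y c : ℝ} (h : Associated f (tau x y c f)) : y = 0 := by
  obtain ⟨u, hu⟩ := assoc_C h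
  by_contra hy
  let sp : A3 →ₐ[ℝ] Polynomial ℝ := aeval ![0, Polynomial.X, 0]
  set q := sp f with hq
  have hfq : f = Polynomial.aeval (X 1 : A3) q := by
    rw [hq, f.as_sum, map_sum, map_sum]
    apply Finset.sum_congr rfl
    intro e he
    have e0 : e 0 = 0 := by
      have := monomial_le_degreeOf 0 he; omega
    have e2 : e 2 = 0 := by
      have := monomial_le_degreeOf 2 he; omega
    have : sp (monomial e (coeff e f)) = Polynomial.C (coeff e f) * Polynomial.X ^ e 1 := by
      simp only [sp]
      rw [aeval_monomial, Finsupp.prod_fintype _ _ (by simp), Fin.prod_univ_three]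
      simp [e0, e2]
    rw [this]
    rw [monomial_eq, Finsupp.prod_fintype _ _ (by simp), Fin.prod_univ_three]
    simp [e0, e2, algebraMap_eq]
  have hqne : q ≠ 0 := by
    intro h; rw [h] at hfq; simp at hfq; exact hf.ne_zero hfq
  have h3 : sp (tau x y c f) = Polynomial.taylor y q := by
    have h5 : (sp.comp (tau x y c)).comp (Polynomial.aeval (X 1 : A3)) =
        Polynomial.taylorAlgHom y := by
      apply Polynomial.algHom_ext
      simp [sp, -map_add]
      simp [sp]
    rw [hfq]
    have := congrArg (fun φ : Polynomial ℝ →ₐ[ℝ] Polynomial ℝ => φ q) h5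
    simpa using this
  have h4 : Polynomial.taylor y q = Polynomial.C u * q := by
    rw [← h3, hu, map_mul, ← hq]
    congr 1
    simp [sp]
  obtain ⟨_, h6⟩ := taylor_const hy hqne h4
  rw [Polynomial.natDegree_eq_zero] at h6
  obtain ⟨a, ha⟩ := h6
  rw [← ha] at hfq
  apply hf.not_isUnit
  rw [hfq]
  have : a ≠ 0 := by
    rintro rfl; rw [← ha] at hqne; simp at hqne
  simpa [algebraMap_eq] using this

end ZE


namespace ZE
open Module

section stab
open Polynomial

theorem natDeg_lt_of_coeff {R : Type*} [Semiring R] {q : Polynomial R} {n : ℕ} (hn : 0 < n)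
    (h : ∀ m, n ≤ m → q.coeff m = 0) : q.natDegree < n := by
  have : q.natDegree ≤ n - 1 := by
    rw [Polynomial.natDegree_le_iff_coeff_eq_zero]
    intro m hm
    exact h m (by omega)
  omega

noncomputable def sc (c : ℝ) : ℝ[X] →+* ℝ[X] := Polynomial.compRingHom (C c * X)

theorem sc_coeff (c : ℝ) (A : ℝ[X]) (n : ℕ) : (sc c A).coeff n = A.coeff n * c ^ n := by
  rw [sc, Polynomial.coe_compRingHom_apply, Polynomial.comp_C_mul_X_coeff]

theorem sc_natDegree {c : ℝ} (hc : c ≠ 0) (A : ℝ[X]) : (sc c A).natDegree = A.natDegree := by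
  rw [sc, Polynomial.coe_compRingHom_apply, natDegree_comp, natDegree_C_mul_X _ hc, mul_one]

theorem sc_ne {c : ℝ} (hc : c ≠ 0) {A : ℝ[X]} (hA : A ≠ 0) : sc c A ≠ 0 := by
  intro h
  apply hA
  ext n
  have := congrArg (fun p => p.coeff n) h
  simp only [sc_coeff, coeff_zero] at this
  simpa [hc] using this

theorem tops {A B : ℝ[X]} (hA : A ≠ 0) {c x : ℝ} (hc : 0 < c) (hc1 : c ≠ 1) {n : ℕ}
    (h : sc c A * B = A * (sc c B + (n + 1) * C x * sc c A)) : x = 0 := by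
  by_contra hx
  have hA' : A.coeff A.natDegree ≠ 0 := by simpa using hA
  have h' : sc c A * B - A * sc c B = C ((n + 1) * x) * (A * sc c A) := by
    rw [h]; simp; ring
  rcases lt_or_ge A.natDegree B.natDegree with hab | hab
  · have hB : B.coeff B.natDegree ≠ 0 := by
      rw [coeff_natDegree, Ne, leadingCoeff_eq_zero]
      rintro rfl; simp at hab
    have := congrArg (fun p => p.coeff (A.natDegree + B.natDegree)) h'
    simp only [coeff_sub, coeff_C_mul] at this
    rw [coeff_mul_add_eq_of_natDegree_le (sc_natDegree hc.ne' A).le le_rfl,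
      coeff_mul_add_eq_of_natDegree_le le_rfl (sc_natDegree hc.ne' B).le,
      coeff_eq_zero_of_natDegree_lt (p := A * sc c A)] at this
    · simp only [sc_coeff, mul_zero] at this
      have h2 : A.coeff A.natDegree * B.coeff B.natDegree * (c ^ A.natDegree - c ^ B.natDegree) = 0 := by
        rw [← this]; ring
      have h3 : c ^ A.natDegree - c ^ B.natDegree = 0 := by
        rcases mul_eq_zero.mp h2 with h4 | h4
        · rcases mul_eq_zero.mp h4 with h5 | h5
          · exact absurd h5 hA'
          · exact absurd h5 hB
        · exact h4
      have := pow_ne_of hc hc1 (sub_eq_zero.mp h3)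
      omega
    · refine natDegree_mul_le.trans_lt ?_
      rw [sc_natDegree hc.ne']; omega
  · have := congrArg (fun p => p.coeff (A.natDegree + A.natDegree)) h'
    simp only [coeff_sub, coeff_C_mul] at this
    rw [coeff_mul_add_eq_of_natDegree_le (sc_natDegree hc.ne' A).le hab,
      coeff_mul_add_eq_of_natDegree_le le_rfl ((sc_natDegree hc.ne' B).le.trans hab),
      coeff_mul_add_eq_of_natDegree_le le_rfl (sc_natDegree hc.ne' A).le] at this
    simp only [sc_coeff] at this
    have h2 : ((n : ℝ) + 1) * x * (A.coeff A.natDegree * (A.coeff A.natDegree * c ^ A.natDegree)) = 0 := by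
      rw [← this]; ring
    have h3 : c ^ A.natDegree ≠ 0 := pow_ne_zero _ hc.ne'
    have h4 : (n : ℝ) + 1 ≠ 0 := by positivity
    simp [hx, h3, hA', h4] at h2
    exact hA h2

theorem taylor_next (n : ℕ) (f : ℝ[X][X]) (x : ℝ[X]) (h : f.natDegree ≤ n+1) :
    (taylor x f).coeff n = f.coeff n + (n+1) * x * f.coeff (n+1) := by
  rw [taylor_coeff, hasseDeriv_apply, sum_over_range' _ _ (n+2) (by omega),
    Finset.sum_range_succ, Finset.sum_range_succ, Finset.sum_eq_zero]
  · simp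
    ring
  · intro i hi
    rw [Finset.mem_range] at hi
    rw [Nat.choose_eq_zero_of_lt hi]; simp
  · simp

noncomputable def SS (x c : ℝ) : ℝ[X][X] →+* ℝ[X][X] :=
  (taylorAlgHom (C x) : ℝ[X][X] →ₐ[ℝ[X]] ℝ[X][X]).toRingHom.comp (mapRingHom (sc c))

theorem SS_apply (x c : ℝ) (p : ℝ[X][X]) : SS x c p = taylor (C x) (p.map (sc c)) := rfl

theorem stab0 {I : Ideal ℝ[X]} (hI : I.IsPrime) (hX : X ∉ I) {c : ℝ} (hc : 0 < c)
    (hc1 : c ≠ 1) (hs : ∀ A ∈ I, sc c A ∈ I) : I = ⊥ := by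
  by_contra hne
  have hex : ∃ n, ∃ A ∈ I, A ≠ 0 ∧ A.natDegree = n := by
    obtain ⟨A, hA, hA0⟩ := Submodule.exists_mem_ne_zero_of_ne_bot hne
    exact ⟨_, A, hA, hA0, rfl⟩
  classical
  obtain ⟨A, hA, hA0, hdeg⟩ := Nat.find_spec hex
  have hmin : ∀ B ∈ I, B.natDegree < A.natDegree → B = 0 := by
    intro B hB hlt
    by_contra hB0
    rw [hdeg] at hlt
    exact Nat.find_min hex hlt ⟨B, hB, hB0, rfl⟩
  set a := A.natDegree with ha
  have hapos : 0 < a := by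
    by_contra h
    have h0 : A.natDegree = 0 := by omega
    obtain ⟨r, hr⟩ := natDegree_eq_zero.mp h0
    apply hI.ne_top
    apply Ideal.eq_top_of_isUnit_mem _ hA
    rw [← hr, isUnit_C]
    rw [isUnit_iff_ne_zero]
    rintro rfl
    simp at hr; exact hA0 hr.symm
  have hB : C (c ^ a) * A - sc c A ∈ I := I.sub_mem (I.mul_mem_left _ hA) (hs A hA)
  have hB0 := hmin _ hB (by
    refine natDeg_lt_of_coeff hapos ?_
    intro m hm
    rw [coeff_sub, coeff_C_mul, sc_coeff]
    rcases Nat.eq_or_lt_of_le hm with h | h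
    · rw [← h]; ring
    · rw [coeff_eq_zero_of_natDegree_lt (by omega)]; ring)
  have hco : ∀ i, i ≠ a → A.coeff i = 0 := by
    intro i hi
    have := congrArg (fun p => p.coeff i) hB0
    simp only [coeff_sub, coeff_C_mul, sc_coeff, coeff_zero] at this
    have h2 : (c ^ a - c ^ i) * A.coeff i = 0 := by rw [← this]; ring
    rcases mul_eq_zero.mp h2 with h | h
    · exact absurd (pow_ne_of hc hc1 (sub_eq_zero.mp h)).symm hi
    · exact h
  have hAe : A = C (A.coeff a) * X ^ a := by
    ext i
    rw [coeff_C_mul_X_pow]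
    split_ifs with h
    · rw [h]
    · exact hco i h
  rw [hAe] at hA
  rcases hI.mem_or_mem hA with h | h
  · apply hI.ne_top
    apply Ideal.eq_top_of_isUnit_mem _ h
    rw [isUnit_C, isUnit_iff_ne_zero]
    intro h0
    rw [h0] at hAe; simp at hAe; exact hA0 hAe
  · exact hX (hI.mem_of_pow_mem _ h)

theorem stab2 {J : Ideal ℝ[X][X]} (hJ : J.IsPrime) (hX : C X ∉ J) {x c : ℝ} (hc : 0 < c)
    (hc1 : c ≠ 1) (hs : ∀ p ∈ J, SS x c p ∈ J) (hne : J ≠ ⊥) : x = 0 := by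
  have hI0 : J.comap (C : ℝ[X] →+* ℝ[X][X]) = ⊥ := by
    apply stab0 (c := c) inferInstance hX hc hc1
    intro A hA
    have := hs _ hA
    rw [SS_apply] at this
    simpa using this
  have hex : ∃ n, ∃ A ∈ J, A ≠ 0 ∧ A.natDegree = n := by
    obtain ⟨A, hA, hA0⟩ := Submodule.exists_mem_ne_zero_of_ne_bot hne
    exact ⟨_, A, hA, hA0, rfl⟩
  classical
  obtain ⟨p, hp, hp0, hdeg⟩ := Nat.find_spec hex
  have hmin : ∀ B ∈ J, B.natDegree < p.natDegree → B = 0 := by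
    intro B hB hlt
    by_contra hB0
    rw [hdeg] at hlt
    exact Nat.find_min hex hlt ⟨B, hB, hB0, rfl⟩
  rcases Nat.eq_zero_or_pos p.natDegree with h0 | hpos
  · exfalso
    obtain ⟨r, hr⟩ := natDegree_eq_zero.mp h0
    have : r ∈ J.comap (C : ℝ[X] →+* ℝ[X][X]) := by
      rw [Ideal.mem_comap, hr]; exact hp
    rw [hI0] at this
    have hr0 : r = 0 := this
    rw [hr0] at hr; simp at hr; exact hp0 hr.symm
  obtain ⟨n, hn⟩ : ∃ n, p.natDegree = n + 1 := ⟨p.natDegree - 1, by omega⟩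
  have hA0 : p.coeff (n+1) ≠ 0 := by rw [← hn]; simpa using hp0
  have hmd : (p.map (sc c)).natDegree ≤ n + 1 := hn ▸ natDegree_map_le
  have hmd' : (p.map (sc c)).natDegree = n + 1 := by
    apply le_antisymm hmd
    apply le_natDegree_of_ne_zero
    rw [coeff_map]; exact sc_ne hc.ne' hA0
  have hq : C (sc c (p.coeff (n+1))) * p - C (p.coeff (n+1)) * SS x c p ∈ J :=
    J.sub_mem (J.mul_mem_left _ hp) (J.mul_mem_left _ (hs p hp))
  have hq0 := hmin _ hq (by
    refine natDeg_lt_of_coeff hpos ?_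
    intro m hm
    rw [coeff_sub, coeff_C_mul, coeff_C_mul, SS_apply]
    rcases Nat.eq_or_lt_of_le hm with h | h
    · rw [← h, hn]
      have := coeff_taylor_natDegree (C x) (p.map (sc c))
      rw [hmd', leadingCoeff, hmd', coeff_map] at this
      rw [this]; ring
    · rw [coeff_eq_zero_of_natDegree_lt h,
        coeff_eq_zero_of_natDegree_lt (p := taylor _ _) (by rw [natDegree_taylor]; omega)]; ring)
  have h1 := congrArg (fun p => p.coeff n) hq0
  simp only [coeff_sub, coeff_C_mul, coeff_zero] at h1
  rw [SS_apply, taylor_next _ _ _ hmd, coeff_map, coeff_map, sub_eq_zero] at h1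
  exact tops hA0 hc hc1 h1

end stab

open Polynomial in
noncomputable def Psi (i : Fin 3) : ℝ[X][X] →+* A3 :=
  eval₂RingHom (Polynomial.aeval (MvPolynomial.X 2 : A3) : ℝ[X] →ₐ[ℝ] A3).toRingHom
    (MvPolynomial.X i)

theorem Psi_C (i : Fin 3) (A : Polynomial ℝ) :
    Psi i (Polynomial.C A) = Polynomial.aeval (MvPolynomial.X 2 : A3) A := by
  simp [Psi]

theorem Psi_X (i : Fin 3) : Psi i Polynomial.X = MvPolynomial.X i := by
  simp [Psi]

theorem tau_Psi (i : Fin 3) {x y c z : ℝ}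
    (h : tau x y c (MvPolynomial.X i) = MvPolynomial.X i + MvPolynomial.C z)
    (p : Polynomial (Polynomial ℝ)) :
    tau x y c (Psi i p) = Psi i (SS z c p) := by
  have : (tau x y c : A3 →ₐ[ℝ] A3).toRingHom.comp (Psi i) = (Psi i).comp (SS z c) := by
    apply Polynomial.ringHom_ext
    · intro A
      have e : (tau x y c).comp (Polynomial.aeval (MvPolynomial.X 2 : A3)) =
          (Polynomial.aeval (MvPolynomial.X 2 : A3)).comp
            (Polynomial.aeval (Polynomial.C c * Polynomial.X)) := by
        apply Polynomial.algHom_ext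
        simp [MvPolynomial.algebraMap_eq]
      have e2 := congrArg (fun φ : Polynomial ℝ →ₐ[ℝ] A3 => φ A) e
      simp only [RingHom.comp_apply, Psi_C, SS_apply, Polynomial.map_C, Polynomial.taylor_C]
      exact e2
    · simp only [RingHom.comp_apply, SS_apply, Polynomial.map_X, Polynomial.taylor_X, map_add,
        Psi_X, Psi_C, Polynomial.aeval_C]
      exact h
  exact congrArg (fun φ : Polynomial (Polynomial ℝ) →+* A3 => φ p) this

theorem Psi_monomial (i : Fin 3) (a d : ℕ) (r : ℝ) :
    Psi i (Polynomial.monomial a (Polynomial.monomial d r)) =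
      MvPolynomial.C r * MvPolynomial.X 2 ^ d * MvPolynomial.X i ^ a := by
  rw [← Polynomial.C_mul_X_pow_eq_monomial, ← Polynomial.C_mul_X_pow_eq_monomial, map_mul, map_pow,
    Psi_X, Psi_C]
  simp [MvPolynomial.algebraMap_eq]

noncomputable def mm (j : ℕ) : (Fin j → Fin j → ℝ) →ₗ[ℝ] Polynomial (Polynomial ℝ) where
  toFun c := ∑ a : Fin j, ∑ d : Fin j, Polynomial.monomial (a : ℕ) (Polynomial.monomial (d : ℕ) (c a d))
  map_add' := by
    intro c c'
    simp [Finset.sum_add_distrib]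
  map_smul' := by
    intro r c
    simp [Finset.smul_sum, Polynomial.smul_monomial]

theorem mm_apply (j : ℕ) (c : Fin j → Fin j → ℝ) : mm j c =
  ∑ a : Fin j, ∑ d : Fin j, Polynomial.monomial (a : ℕ) (Polynomial.monomial (d : ℕ) (c a d)) := rfl

theorem mm_coeff (j : ℕ) (c : Fin j → Fin j → ℝ) (a d : Fin j) :
    ((mm j c).coeff a).coeff d = c a d := by
  rw [mm_apply, Polynomial.finsetSum_coeff, Finset.sum_eq_single a]
  · rw [Polynomial.finsetSum_coeff, Polynomial.finsetSum_coeff, Finset.sum_eq_single d]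
    · simp
    · intro b _ hb
      simp [Polynomial.coeff_monomial, Fin.val_inj, hb]
    · simp
  · intro b _ hb
    rw [Polynomial.finsetSum_coeff]
    apply Finset.sum_eq_zero
    intro e _
    rw [Polynomial.coeff_monomial, if_neg (by rwa [Fin.val_inj])]
  · simp

theorem hf_ge_sq {K1 K2 L : ℕ} (h1 : 0 < K1) (h2 : 0 < K2) (h3 : 0 < L) (p : Ideal A3) (i : Fin 3)
    (hi : i ≠ 2) (hp : p.comap (Psi i) = ⊥) (j : ℕ) : j * j ≤ hf (VV K1 K2 L) p j := by
  have hV := isFilt_VV h1 h2 h3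
  have := hV.fin j
  have hlin : ∀ (r : ℝ) (q : Polynomial (Polynomial ℝ)), Psi i (r • q) = r • Psi i q := by
    intro r q
    have : r • q = Polynomial.C (Polynomial.C r) * q := by
      rw [← Polynomial.smul_eq_C_mul]
      ext a b
      simp
    rw [this, map_mul, Psi_C, Polynomial.aeval_C, Algebra.smul_def]
  let φ : (Fin j → Fin j → ℝ) →ₗ[ℝ] (A3 ⧸ p) :=
    { toFun := fun c => Ideal.Quotient.mk p (Psi i (mm j c))
      map_add' := by intro c c'; simp
      map_smul' := by
        intro r c
        rw [map_smul, hlin]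
        rfl }
  have hinj : Function.Injective φ := by
    rw [injective_iff_map_eq_zero]
    intro c hc
    have h' : Ideal.Quotient.mk p (Psi i (mm j c)) = 0 := hc
    rw [Ideal.Quotient.eq_zero_iff_mem, ← Ideal.mem_comap, hp] at h'
    have h0 : mm j c = 0 := h'
    ext a d
    rw [← mm_coeff j c, h0]; simp
  have hr : LinearMap.range φ ≤ (VV K1 K2 L j).map (Ideal.Quotient.mkₐ ℝ p).toLinearMap := by
    rintro _ ⟨c, rfl⟩
    refine ⟨Psi i (mm j c), ?_, rfl⟩
    show Psi i (mm j c) ∈ VV K1 K2 L j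
    rw [mm_apply, map_sum]
    apply Submodule.sum_mem
    intro a _
    rw [map_sum]
    apply Submodule.sum_mem
    intro d _
    rw [Psi_monomial]
    have hdeg : ∀ k : Fin 3, MvPolynomial.degreeOf k (MvPolynomial.C (c a d) * MvPolynomial.X 2 ^ (d : ℕ)
        * MvPolynomial.X i ^ (a : ℕ) : A3) ≤ (d : ℕ) * (if k = 2 then 1 else 0) + a * (if k = i then 1 else 0) := by
      intro k
      refine (MvPolynomial.degreeOf_mul_le _ _ _).trans (add_le_add
        ((MvPolynomial.degreeOf_C_mul_le _ _ _).trans ?_) ?_)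
      · refine (MvPolynomial.degreeOf_pow_le _ _ _).trans ?_
        rw [MvPolynomial.degreeOf_X]
      · refine (MvPolynomial.degreeOf_pow_le _ _ _).trans ?_
        rw [MvPolynomial.degreeOf_X]
    have ha := a.2
    have hd := d.2
    have hall : ∀ k : Fin 3, MvPolynomial.degreeOf k (MvPolynomial.C (c a d) * MvPolynomial.X 2 ^ (d : ℕ)
        * MvPolynomial.X i ^ (a : ℕ) : A3) < j := by
      intro k
      refine (hdeg k).trans_lt ?_
      by_cases h : k = 2
      · have h' : k ≠ i := fun e => hi (e.symm.trans h)
        simp only [h, if_true, mul_one]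
        rw [if_neg (fun e => hi (e.symm))]; omega
      · rw [if_neg h]
        split_ifs <;> omega
    exact mem_VV_of_degreeOf ((hall 0).trans_le (Nat.le_mul_of_pos_right _ h1))
      ((hall 1).trans_le (Nat.le_mul_of_pos_right _ h2))
      ((hall 2).trans_le (Nat.le_mul_of_pos_right _ h3))
  have h := Submodule.finrank_mono hr
  rw [LinearMap.finrank_range_of_inj hinj] at h
  rw [Module.finrank_pi_fintype] at h
  simpa [hf] using h

theorem grow {K1 K2 L : ℕ} (h1 : 0 < K1) (h2 : 0 < K2) (h3 : 0 < L) {P : A3}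
    (hP : P ∈ VV K1 K2 L 1) (hP0 : P ≠ 0) {f : A3} (hf1 : Prime f) (hfP : f ∣ P)
    {Q : A3} (hQ : Q ∈ VV K1 K2 L 1) (hQf : ¬ f ∣ Q) {p : Ideal A3} (hfp : f ∈ p) (hQp : Q ∈ p) :
    ∃ j, hf (VV K1 K2 L) p j < j * j := by
  by_contra hcon
  push Not at hcon
  have hV := isFilt_VV h1 h2 h3
  have hpr : (Ideal.span {f}).IsPrime := (Ideal.span_singleton_prime hf1.ne_zero).mpr hf1
  obtain ⟨d, hd⟩ := hf_sum_le hV (finrank_VV K1 K2 L) hP hP0 {Ideal.span {f}}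
    (by simpa using hpr) (by simp) (by simpa [Ideal.mem_span_singleton] using hfP)
  simp only [Finset.sum_singleton] at hd
  have key : ∀ m, m ^ 3 ≤ 3 * hf (VV K1 K2 L) (Ideal.span {f}) m := by
    intro m
    induction m with
    | zero => simp
    | succ m ih =>
      have := B1 hV (p := Ideal.span {f}) (J := p) ((Ideal.span_singleton_le_iff_mem p).mpr hfp) hQ
        (by rwa [Ideal.mem_span_singleton]) hQp m
      have h' := hcon (m + 1)
      nlinarith
  set N := K1 * K2 * L
  have k1 := key (36 * N + d + 1)
  have k2 := hd (36 * N + d + 1)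
  set m := 36 * N + d + 1 with hm
  have k3 : (m + d) ^ 2 ≤ 4 * m ^ 2 := by nlinarith [show d ≤ m by omega]
  have k4 : m ^ 3 ≤ 36 * N * m ^ 2 := by
    calc m ^ 3 ≤ 3 * (3 * N * (m + d)^2) := k1.trans (Nat.mul_le_mul_left _ k2)
      _ = 9 * N * (m + d)^2 := by ring
      _ ≤ 9 * N * (4 * m ^ 2) := Nat.mul_le_mul_left _ k3
      _ = _ := by ring
  have k5 : m ≤ 36 * N := by
    have hm2 : 0 < m ^ 2 := by positivity
    apply Nat.le_of_mul_le_mul_right _ hm2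
    calc m * m ^ 2 = m ^ 3 := by ring
      _ ≤ _ := k4
  omega

theorem stab_trivial {K1 K2 L : ℕ} (h1 : 0 < K1) (h2 : 0 < K2) (h3 : 0 < L) {P : A3}
    (hP : P ∈ VV K1 K2 L 1) (hP0 : P ≠ 0) {f : A3} (hf1 : Prime f) (hfP : f ∣ P)
    {Q : A3} (hQ : Q ∈ VV K1 K2 L 1) (hQf : ¬ f ∣ Q) {p : Ideal A3} (hp : p.IsPrime)
    (hfp : f ∈ p) (hQp : Q ∈ p)
    (hX2 : MvPolynomial.X 2 ∉ p) {x y c : ℝ} (hc : 0 < c) (hc1 : c ≠ 1)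
    (hs : ∀ R ∈ p, tau x y c R ∈ p) : x = 0 ∧ y = 0 := by
  obtain ⟨j, hj⟩ := grow h1 h2 h3 hP hP0 hf1 hfP hQ hQf hfp hQp
  have gen : ∀ (i : Fin 3) (z : ℝ), i ≠ 2 →
      tau x y c (MvPolynomial.X i) = MvPolynomial.X i + MvPolynomial.C z → z = 0 := by
    intro i z hi hz
    apply stab2 (J := p.comap (Psi i)) inferInstance ?_ hc hc1 ?_ ?_
    · rw [Ideal.mem_comap, Psi_C]; simpa using hX2
    · intro q hq
      rw [Ideal.mem_comap] at *
      rw [← tau_Psi i hz]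
      exact hs _ hq
    · intro h
      have := hf_ge_sq h1 h2 h3 p i hi h j
      omega
  exact ⟨gen 0 x (by decide) (by simp), gen 1 y (by decide) (by simp)⟩

end ZE

namespace ZE
open Module MvPolynomial

structure Dat (G : Type*) [AddCommGroup G] where
  x : G →+ ℝ
  y : G →+ ℝ
  χ : G → ℝ
  hmul : ∀ a b, χ (a + b) = χ a * χ b
  hpos : ∀ a, 0 < χ a
  hinj : Function.Injective χ

variable {G : Type*} [AddCommGroup G] (D : Dat G)

namespace Dat

theorem χ_zero : D.χ 0 = 1 := by
  have h := D.hmul 0 0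
  have hp := D.hpos 0
  rw [add_zero] at h
  nlinarith [mul_left_cancel₀ hp.ne' (h.symm.trans (mul_one _).symm)]

theorem χ_ne {a : G} (h : a ≠ 0) : D.χ a ≠ 1 := by
  rw [← D.χ_zero]; exact fun e => h (D.hinj e)

noncomputable def T (σ : G) : A3 →ₐ[ℝ] A3 := tau (D.x σ) (D.y σ) (D.χ σ)

theorem T_T (a b : G) (P : A3) : D.T a (D.T b P) = D.T (a + b) P := by
  unfold T
  rw [tau_tau, map_add, map_add, D.hmul]

theorem T_zero (P : A3) : D.T 0 P = P := by
  unfold T; rw [map_zero, map_zero, D.χ_zero, tau_id]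

theorem T_neg (a : G) (P : A3) : D.T (-a) (D.T a P) = P := by
  rw [D.T_T, neg_add_cancel, D.T_zero]

theorem T_neg' (a : G) (P : A3) : D.T a (D.T (-a) P) = P := by
  rw [D.T_T, add_neg_cancel, D.T_zero]

theorem T_X2 (a : G) : D.T a (X 2) = C (D.χ a) * X 2 := by simp [T]

theorem T_prime (a : G) {f : A3} (hf : Prime f) : Prime (D.T a f) := prime_tau (D.hpos a).ne' hf

noncomputable def pt (σ : G) : Ideal A3 := mI (D.x σ) (D.y σ) (D.χ σ)

theorem T_mem_pt {a b : G} {P : A3} : D.T a P ∈ D.pt b ↔ P ∈ D.pt (a + b) := by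
  unfold T pt
  rw [mem_mI, mem_mI, eval_tau, D.hmul, map_add, map_add, add_comm (D.x b), add_comm (D.y b)]

theorem X2_notMem_pt (b : G) : (X 2 : A3) ∉ D.pt b := by
  unfold pt
  rw [mem_mI]; simpa using (D.hpos b).ne'

theorem dvd_of_dvd_T {f P : A3} {σ : G} (h : f ∣ D.T σ P) : D.T (-σ) f ∣ P := by
  have := map_dvd (D.T (-σ)) h
  rwa [D.T_neg] at this

theorem assoc_T {f : A3} {σ σ' : G} (h : Associated (D.T (-σ) f) (D.T (-σ') f)) :
    Associated f (D.T (σ - σ') f) := by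
  have := h.map (D.T σ : A3 →* A3)
  simp only [MonoidHom.coe_coe] at this
  rwa [D.T_neg', D.T_T, ← sub_eq_add_neg] at this

theorem prod_dvd {f P : A3} (hf : Prime f) (b : Finset G) (h : ∀ σ ∈ b, f ∣ D.T σ P)
    (hna : ∀ σ ∈ b, ∀ σ' ∈ b, Associated f (D.T (σ - σ') f) → σ = σ') :
    ∏ σ ∈ b, D.T (-σ) f ∣ P := by
  apply Finset.prod_dvd_of_isRelPrime
  · intro σ hσ σ' hσ' hne
    show IsRelPrime _ _
    rw [(D.T_prime (-σ) hf).irreducible.isRelPrime_iff_not_dvd]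
    intro hd
    apply hne
    apply hna σ hσ σ' hσ'
    apply D.assoc_T
    exact ((D.T_prime (-σ) hf).dvd_prime_iff_associated (D.T_prime (-σ') hf)).mp hd
  · intro σ hσ
    exact D.dvd_of_dvd_T (h σ hσ)

theorem card_le_deg {f P : A3} (hf : Prime f) (hP0 : P ≠ 0) (b : Finset G) (h : ∀ σ ∈ b, f ∣ D.T σ P)
    (hna : ∀ σ ∈ b, ∀ σ' ∈ b, Associated f (D.T (σ - σ') f) → σ = σ') (i : Fin 3)
    (hi : degreeOf i f ≠ 0) : b.card ≤ degreeOf i P := by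
  obtain ⟨R, hR⟩ := D.prod_dvd hf b h hna
  have hp : ∏ σ ∈ b, D.T (-σ) f ≠ 0 := Finset.prod_ne_zero_iff.mpr
    (fun σ _ => (D.T_prime (-σ) hf).ne_zero)
  have hR0 : R ≠ 0 := by rintro rfl; exact hP0 (by simpa using hR)
  rw [hR, degreeOf_mul_eq hp hR0, degreeOf_prod_eq _ _ (fun σ _ => (D.T_prime (-σ) hf).ne_zero)]
  have : ∀ σ ∈ b, degreeOf i (D.T (-σ) f) = degreeOf i f := fun σ _ =>
    degreeOf_tau _ _ _ (D.hpos _).ne' _ _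
  rw [Finset.sum_congr rfl this, Finset.sum_const, smul_eq_mul]
  have := Nat.le_mul_of_pos_right b.card (Nat.pos_of_ne_zero hi)
  omega

theorem deg_lt_of_mem {K1 K2 L : ℕ} (h1 : 0 < K1) (h2 : 0 < K2) (h3 : 0 < L) {P : A3}
    (hP : P ∈ VV K1 K2 L 1) : degreeOf 0 P < K1 ∧ degreeOf 1 P < K2 ∧ degreeOf 2 P < L := by
  rw [mem_VV_iff] at hP
  simp only [one_mul] at hP
  refine ⟨?_, ?_, ?_⟩
  · rw [degreeOf_lt_iff h1]; exact fun e he => (hP e he).1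
  · rw [degreeOf_lt_iff h2]; exact fun e he => (hP e he).2.1
  · rw [degreeOf_lt_iff h3]; exact fun e he => (hP e he).2.2

theorem N1 {K1 K2 L : ℕ} (h1 : 0 < K1) (h2 : 0 < K2) (h3 : 0 < L) {P : A3}
    (hP : P ∈ VV K1 K2 L 1) (hP0 : P ≠ 0) {f : A3} (hf : Prime f) (hfX : ¬ Associated f (X 2))
    (b b1 b2 : Finset G) (hb1 : b1 ⊆ b) (hb2 : b2 ⊆ b) (hy1 : ∀ σ ∈ b1, D.y σ = 0)
    (hx1 : Set.InjOn D.x b1) (hc1 : K1 ≤ b1.card) (hc1' : L ≤ b1.card)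
    (hy2 : Set.InjOn D.y b2) (hc2 : K2 ≤ b2.card) : ∃ σ ∈ b, ¬ f ∣ D.T σ P := by
  by_contra hcon
  push Not at hcon
  obtain ⟨d0, d1, d2⟩ := deg_lt_of_mem h1 h2 h3 hP
  by_cases hA : degreeOf 0 f = 0 ∧ degreeOf 2 f = 0
  · have hd1 : degreeOf 1 f ≠ 0 := by
      intro hd
      have : f = C (coeff 0 f) := by
        ext e
        rw [coeff_C]
        split_ifs with he
        · rw [← he]
        · by_contra hne
          have hm : e ∈ f.support := mem_support_iff.mpr hne
          apply he
          ext k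
          have := monomial_le_degreeOf k hm
          fin_cases k
          · simp at this ⊢; omega
          · simp at this ⊢; omega
          · simp at this ⊢; omega
      apply hf.not_isUnit
      have hne : coeff 0 f ≠ 0 := by
        intro h0; rw [h0, C_0] at this; exact hf.ne_zero this
      rw [this]
      exact (isUnit_iff_ne_zero.mpr hne).map C
    have := D.card_le_deg hf hP0 b2 (fun σ h => hcon σ (hb2 h)) (fun σ h σ' h' ha => by
      have := shiftY hf hA.1 hA.2 ha
      rw [map_sub, sub_eq_zero] at this
      exact hy2 h h' this) 1 hd1
    omega
  · have hna : ∀ σ ∈ b1, ∀ σ' ∈ b1, Associated f (D.T (σ - σ') f) → σ = σ' := by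
      intro σ h σ' h' ha
      by_contra hne
      apply hA
      unfold T at ha
      have hy : D.y (σ - σ') = 0 := by rw [map_sub, hy1 σ h, hy1 σ' h', sub_zero]
      rw [hy] at ha
      refine shiftX hf hfX ?_ (D.hpos _) (D.χ_ne (sub_ne_zero.mpr hne)) ha
      rw [map_sub, sub_ne_zero]
      exact fun e => hne (hx1 h h' e)
    by_cases h0 : degreeOf 0 f = 0
    · have := D.card_le_deg hf hP0 b1 (fun σ h => hcon σ (hb1 h)) hna 2 (fun h => hA ⟨h0, h⟩)
      omega
    · have := D.card_le_deg hf hP0 b1 (fun σ h => hcon σ (hb1 h)) hna 0 h0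
      omega

theorem exists_fac {P : A3} (hP0 : P ≠ 0) : ∃ S : Finset (Ideal A3),
    (∀ p ∈ S, ∃ f, Prime f ∧ ¬ Associated f (X 2) ∧ f ∣ P ∧ p = Ideal.span {f}) ∧
    (∀ q : Ideal A3, q.IsPrime → P ∈ q → (X 2 : A3) ∉ q → ∃ p ∈ S, p ≤ q) := by
  classical
  refine ⟨((UniqueFactorizationMonoid.factors P).toFinset.filter
    (fun f => ¬ Associated f (X 2))).image (fun f => Ideal.span {f}), ?_, ?_⟩
  · intro p hp
    simp only [Finset.mem_image, Finset.mem_filter, Multiset.mem_toFinset] at hp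
    obtain ⟨f, ⟨hf, hfX⟩, rfl⟩ := hp
    exact ⟨f, UniqueFactorizationMonoid.prime_of_factor f hf, hfX,
      UniqueFactorizationMonoid.dvd_of_mem_factors hf, rfl⟩
  · intro q hq hP hX
    have h := UniqueFactorizationMonoid.factors_prod hP0
    have h2 : (UniqueFactorizationMonoid.factors P).prod ∈ q := by
      obtain ⟨u, hu⟩ := h
      rw [← hu] at hP
      exact (hq.mem_or_mem hP).resolve_right (fun hu' => hq.ne_top (Ideal.eq_top_of_isUnit_mem _ hu' u.isUnit))
    obtain ⟨f, hf, hfq⟩ := (hq.multiset_prod_mem_iff_exists_mem _).mp h2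
    refine ⟨Ideal.span {f}, ?_, (Ideal.span_singleton_le_iff_mem _).mpr hfq⟩
    simp only [Finset.mem_image, Finset.mem_filter, Multiset.mem_toFinset]
    refine ⟨f, ⟨hf, ?_⟩, rfl⟩
    rintro ⟨u, hu⟩
    exact hX (hu ▸ q.mul_mem_right _ hfq)

theorem span_inc {f g : A3} (hf : Prime f) (hg : Prime g) (h : Ideal.span {f} ≤ Ideal.span {g}) :
    Ideal.span ({f} : Set A3) = Ideal.span {g} := by
  rw [Ideal.span_singleton_le_span_singleton] at h
  rw [Ideal.span_singleton_eq_span_singleton]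
  exact ((hg.dvd_prime_iff_associated hf).mp h).symm

end Dat
end ZE

namespace ZE
open Module MvPolynomial

variable {G : Type*} [AddCommGroup G] (D : Dat G)

namespace Dat

theorem comap_pt (a b : G) : (D.pt b).comap (D.T a) = D.pt (a + b) := by
  ext R; rw [Ideal.mem_comap, D.T_mem_pt]

theorem X_sub_mem_VV {K1 K2 L : ℕ} (h1 : 2 ≤ K1) (h2 : 2 ≤ K2) (h3 : 2 ≤ L) (i : Fin 3) (u : ℝ) :
    (X i - C u : A3) ∈ VV K1 K2 L 1 := by
  have : ∀ k : Fin 3, degreeOf k (X i - C u : A3) < 2 := by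
    intro k
    refine (degreeOf_sub_le _ _ _).trans_lt ?_
    rw [degreeOf_X, degreeOf_C]
    split_ifs <;> simp
  exact mem_VV_of_degreeOf (by have := this 0; omega) (by have := this 1; omega) (by have := this 2; omega)

theorem hw_one {K1 K2 L : ℕ} (h1 : 2 ≤ K1) (h2 : 2 ≤ K2) (h3 : 2 ≤ L) {q : Ideal A3}
    (hq : q.IsPrime) {σ : G} (hle : q ≤ D.pt σ) (hne : q ≠ D.pt σ) :
    ∃ d, ∀ j, 1 * j ≤ hf (VV K1 K2 L) q (j + d) := by
  have hV := isFilt_VV (K1 := K1) (K2 := K2) (L := L) (by omega) (by omega) (by omega)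
  have : ∃ (i : Fin 3) (u : ℝ), (X i - C u : A3) ∉ q ∧ (X i - C u : A3) ∈ D.pt σ := by
    by_contra hcon
    push Not at hcon
    apply hne
    refine mI_eq_of_le hle ?_ ?_ ?_
    · by_contra h; exact hcon 0 _ h (by unfold pt; rw [mem_mI]; simp)
    · by_contra h; exact hcon 1 _ h (by unfold pt; rw [mem_mI]; simp)
    · by_contra h; exact hcon 2 _ h (by unfold pt; rw [mem_mI]; simp)
  obtain ⟨i, u, hi, hi'⟩ := this
  have := hf_ge_card hV (by omega) (by omega) (by omega) hq (X_sub_mem_VV h1 h2 h3 i u) hi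
    {D.pt σ} (by intro m hm; rw [Finset.mem_singleton.mp hm]; exact mI_max _ _ _) (by simpa using ⟨hle, hi'⟩)
  simpa using this

structure Boxes (K1 K2 L : ℕ) (A a b b1 b2 : Finset G) : Prop where
  h1 : 2 ≤ K1
  h2 : 2 ≤ K2
  h3 : 2 ≤ L
  hb1 : b1 ⊆ b
  hb2 : b2 ⊆ b
  hy1 : ∀ σ ∈ b1, D.y σ = 0
  hx1 : Set.InjOn D.x b1
  hc1 : K1 ≤ b1.card
  hc1' : L ≤ b1.card
  hy2 : Set.InjOn D.y b2
  hc2 : K2 ≤ b2.card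
  h0a : 0 ∈ a
  h0b : 0 ∈ b
  hja : ∀ σ ∈ a, ∀ σ' ∈ a, D.x σ = D.x σ' → D.y σ = D.y σ' → σ = σ'
  hjA : ∀ σ ∈ A, ∀ σ' ∈ A, D.x σ = D.x σ' → D.y σ = D.y σ' → σ = σ'
  hca : 6 * (K1 * K2 * L) < a.card
  hcA : 6 * (K1 * K2 * L) < A.card

variable {K1 K2 L : ℕ} {A a b b1 b2 : Finset G}

theorem N2 (hB : D.Boxes K1 K2 L A a b b1 b2) {P : A3} (hP : P ∈ VV K1 K2 L 1) (hP0 : P ≠ 0)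
    {f : A3} (hf : Prime f) (hfP : f ∣ P) {σb : G} (hQf : ¬ f ∣ D.T σb P)
    {p : Ideal A3} (hpm : p ∈ (Ideal.span {f, D.T σb P}).minimalPrimes) {σ₀ : G} (hle : p ≤ D.pt σ₀) :
    ∃ σ ∈ a, ∃ σ' ∈ b, D.T (σ + σ') P ∉ p := by
  classical
  by_contra hcon
  push Not at hcon
  have h1 := hB.h1
  have h2 := hB.h2
  have h3 := hB.h3
  have hV := isFilt_VV (K1 := K1) (K2 := K2) (L := L) (by omega) (by omega) (by omega)
  have hp : p.IsPrime := hpm.1.1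
  have hfp : f ∈ p := hpm.1.2 (Ideal.subset_span (by simp))
  have hQp : D.T σb P ∈ p := hpm.1.2 (Ideal.subset_span (by simp))
  have hX2 : (X 2 : A3) ∉ p := fun h => D.X2_notMem_pt σ₀ (hle h)
  have hpne : ∀ σ, p ≠ D.pt σ := fun σ => minprime_ne_mI hpm _ _ _
  set q : G → Ideal A3 := fun σ => p.comap (D.T σ) with hq
  have hqp : ∀ σ, (q σ).IsPrime := fun σ => Ideal.IsPrime.comap _
  have hqinc : ∀ σ ∈ a, ∀ σ' ∈ a, q σ ≤ q σ' → σ = σ' := by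
    intro σ hσ σ' hσ' hle'
    by_contra hne
    have hs : ∀ R ∈ p, D.T (σ' - σ) R ∈ p := by
      intro R hR
      have : D.T (-σ) R ∈ q σ := by
        rw [hq, Ideal.mem_comap, D.T_neg']; exact hR
      have := hle' this
      rw [hq, Ideal.mem_comap, D.T_T] at this
      rwa [sub_eq_add_neg]
    have := stab_trivial (by omega) (by omega) (by omega) hP hP0 hf hfP
      (tau_mem_VV _ _ _ hP) hQf hp hfp hQp hX2 (D.hpos _) (D.χ_ne (sub_ne_zero.mpr (Ne.symm hne))) hs
    rw [map_sub, map_sub, sub_eq_zero, sub_eq_zero] at this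
    exact hne (hB.hja σ hσ σ' hσ' this.1.symm this.2.symm)
  have hqX : ∀ σ, (X 2 : A3) ∉ q σ := by
    intro σ h
    rw [hq, Ideal.mem_comap, D.T_X2] at h
    rcases hp.mem_or_mem h with h | h
    · exact hp.ne_top (Ideal.eq_top_of_isUnit_mem _ h ((isUnit_iff_ne_zero.mpr (D.hpos σ).ne').map C))
    · exact hX2 h
  have hqle : ∀ σ, q σ ≤ D.pt (σ + σ₀) := by
    intro σ; rw [← D.comap_pt]; exact Ideal.comap_mono hle
  have hqne : ∀ σ, q σ ≠ D.pt (σ + σ₀) := by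
    intro σ he
    apply hpne σ₀
    ext R
    have : D.T (-σ) R ∈ q σ ↔ D.T (-σ) R ∈ D.pt (σ + σ₀) := by rw [he]
    rw [hq, Ideal.mem_comap, D.T_neg', D.T_mem_pt, neg_add_cancel_left] at this
    exact this
  obtain ⟨S, hS, hS'⟩ := exists_fac hP0
  have hQ : ∀ r ∈ S, ∃ Q, (∃ σ ∈ b, Q = D.T σ P) ∧ Q ∉ r := by
    intro r hr
    obtain ⟨f', hf', hfX, hfP', rfl⟩ := hS r hr
    obtain ⟨σ, hσ, hn⟩ := D.N1 (by omega) (by omega) (by omega) hP hP0 hf' hfX b b1 b2 hB.hb1 hB.hb2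
      hB.hy1 hB.hx1 hB.hc1 hB.hc1' hB.hy2 hB.hc2
    exact ⟨_, ⟨σ, hσ, rfl⟩, by rwa [Ideal.mem_span_singleton]⟩
  choose! Q hQ1 hQ2 using hQ
  have := propC hV (finrank_VV K1 K2 L) hP hP0 S ?_ ?_ ?_ Q ?_ hQ2
    (fun r => (a.filter (fun σ => r ≤ q σ)).image q) ?_ ?_ ?_ (fun _ => 1) ?_
  · have h5 : a.card ≤ ∑ r ∈ S, ∑ q' ∈ (a.filter (fun σ => r ≤ q σ)).image q, 1 := by
      have hc : (a.image q).card = a.card := Finset.card_image_of_injOn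
        (fun σ h σ' h' he => hqinc σ h σ' h' he.le)
      rw [← hc]
      have hsub : a.image q ⊆ S.biUnion (fun r => (a.filter (fun σ => r ≤ q σ)).image q) := by
        intro r hr
        obtain ⟨σ, hσ, rfl⟩ := Finset.mem_image.mp hr
        obtain ⟨s, hs, hle'⟩ := hS' (q σ) (hqp σ) (by
          rw [hq, Ideal.mem_comap]
          have := hcon σ hσ 0 hB.h0b
          rwa [add_zero] at this) (hqX σ)
        rw [Finset.mem_biUnion]
        exact ⟨s, hs, Finset.mem_image_of_mem _ (Finset.mem_filter.mpr ⟨hσ, hle'⟩)⟩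
      refine (Finset.card_le_card hsub).trans (Finset.card_biUnion_le.trans ?_)
      apply Finset.sum_le_sum
      intro r _
      simp
    have := hB.hca
    omega
  · intro r hr
    obtain ⟨f', hf', hfX, hfP', rfl⟩ := hS r hr
    exact (Ideal.span_singleton_prime hf'.ne_zero).mpr hf'
  · intro r hr r' hr' hle'
    obtain ⟨f', hf', hfX, hfP', rfl⟩ := hS r hr
    obtain ⟨f'', hf'', -, -, rfl⟩ := hS r' hr'
    exact span_inc hf' hf'' hle'
  · intro r hr
    obtain ⟨f', hf', hfX, hfP', rfl⟩ := hS r hr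
    rwa [Ideal.mem_span_singleton]
  · intro r hr
    obtain ⟨σ, _, h⟩ := hQ1 r hr
    rw [h]; exact tau_mem_VV _ _ _ hP
  · intro r hr q' hq'
    obtain ⟨σ, _, rfl⟩ := Finset.mem_image.mp hq'
    exact hqp σ
  · intro r hr q' hq' q'' hq'' hle'
    obtain ⟨σ, hσ, rfl⟩ := Finset.mem_image.mp hq'
    obtain ⟨σ', hσ', rfl⟩ := Finset.mem_image.mp hq''
    rw [hqinc σ (Finset.mem_filter.mp hσ).1 σ' (Finset.mem_filter.mp hσ').1 hle']
  · intro r hr q' hq'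
    obtain ⟨σ, hσ, rfl⟩ := Finset.mem_image.mp hq'
    refine ⟨(Finset.mem_filter.mp hσ).2, ?_⟩
    obtain ⟨σ', hσ', h⟩ := hQ1 r hr
    rw [h, hq, Ideal.mem_comap, D.T_T]
    exact hcon σ (Finset.mem_filter.mp hσ).1 σ' hσ'
  · intro r hr q' hq'
    obtain ⟨σ, hσ, rfl⟩ := Finset.mem_image.mp hq'
    exact D.hw_one h1 h2 h3 (hqp σ) (hqle σ) (hqne σ)

theorem zero_estimate (hB : D.Boxes K1 K2 L A a b b1 b2) {P : A3} (hP : P ∈ VV K1 K2 L 1)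
    (hv : ∀ σ ∈ A, ∀ σ' ∈ a, ∀ σ'' ∈ b, P ∈ D.pt (σ' + σ'' + σ)) : P = 0 := by
  classical
  by_contra hP0
  have h1 := hB.h1
  have h2 := hB.h2
  have h3 := hB.h3
  have hV := isFilt_VV (K1 := K1) (K2 := K2) (L := L) (by omega) (by omega) (by omega)
  obtain ⟨S, hS, hS'⟩ := exists_fac hP0
  have hQ : ∀ r ∈ S, ∃ Q f, Prime f ∧ f ∣ P ∧ r = Ideal.span {f} ∧ (∃ σ ∈ b, Q = D.T σ P) ∧ Q ∉ r := by
    intro r hr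
    obtain ⟨f', hf', hfX, hfP', rfl⟩ := hS r hr
    obtain ⟨σ, hσ, hn⟩ := D.N1 (by omega) (by omega) (by omega) hP hP0 hf' hfX b b1 b2 hB.hb1 hB.hb2
      hB.hy1 hB.hx1 hB.hc1 hB.hc1' hB.hy2 hB.hc2
    exact ⟨_, f', hf', hfP', rfl, ⟨σ, hσ, rfl⟩, by rwa [Ideal.mem_span_singleton]⟩
  choose! Q f hf hfP hr hQ1 hQ2 using hQ
  have hptinj : Set.InjOn D.pt A := by
    intro σ h σ' h' he
    obtain ⟨e1, e2, e3⟩ := mI_inj he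
    exact hB.hjA σ h σ' h' e1 e2
  have hfin : ∀ r, (Ideal.span {f r, Q r}).minimalPrimes.Finite := fun r =>
    Ideal.finite_minimalPrimes_of_isNoetherianRing _ _
  have := propC hV (finrank_VV K1 K2 L) hP hP0 S ?_ ?_ ?_ Q ?_ hQ2
    (fun r => (hfin r).toFinset.filter (fun q => ∃ σ, q ≤ D.pt σ)) ?_ ?_ ?_
    (fun q => (A.filter (fun σ => q ≤ D.pt σ)).card) ?_
  · have h5 : A.card ≤ ∑ r ∈ S, ∑ q ∈ (hfin r).toFinset.filter (fun q => ∃ σ, q ≤ D.pt σ),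
        (A.filter (fun σ => q ≤ D.pt σ)).card := by
      have hsub : A ⊆ S.biUnion (fun r =>
          ((hfin r).toFinset.filter (fun q => ∃ σ, q ≤ D.pt σ)).biUnion
            (fun q => A.filter (fun σ => q ≤ D.pt σ))) := by
        intro σ hσ
        have hvb : ∀ σ'' ∈ b, D.T σ'' P ∈ D.pt σ := by
          intro σ'' h
          rw [D.T_mem_pt]
          have := hv σ hσ 0 hB.h0a σ'' h
          rwa [zero_add] at this
        have hvP : P ∈ D.pt σ := by
          have := hvb 0 hB.h0b
          rwa [D.T_zero] at this
        obtain ⟨r, hrS, hrle⟩ := hS' (D.pt σ) (mI_max _ _ _).isPrime hvP (D.X2_notMem_pt σ)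
        have hle : Ideal.span {f r, Q r} ≤ D.pt σ := by
          rw [Ideal.span_le]
          intro z hz
          rcases hz with rfl | hz
          · have h7 : Ideal.span {f r} ≤ D.pt σ := (hr r hrS).symm.le.trans hrle
            exact h7 (Ideal.mem_span_singleton_self _)
          · rw [Set.mem_singleton_iff.mp hz]
            obtain ⟨σ'', h'', he⟩ := hQ1 r hrS
            rw [he]; exact hvb _ h''
        have : (D.pt σ).IsPrime := (mI_max _ _ _).isPrime
        obtain ⟨q, hq, hqle⟩ := Ideal.exists_minimalPrimes_le hle
        simp only [Finset.mem_biUnion, Finset.mem_filter, Set.Finite.mem_toFinset]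
        exact ⟨r, hrS, q, ⟨hq, σ, hqle⟩, hσ, hqle⟩
      refine (Finset.card_le_card hsub).trans (Finset.card_biUnion_le.trans ?_)
      exact Finset.sum_le_sum (fun r _ => Finset.card_biUnion_le)
    have := hB.hcA
    omega
  · intro r hrS
    rw [hr r hrS]
    exact (Ideal.span_singleton_prime (hf r hrS).ne_zero).mpr (hf r hrS)
  · intro r hr r' hr' hle'
    obtain ⟨f', hf', hfX, hfP', rfl⟩ := hS r hr
    obtain ⟨f'', hf'', -, -, rfl⟩ := hS r' hr'
    exact span_inc hf' hf'' hle'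
  · intro r hr
    obtain ⟨f', hf', hfX, hfP', rfl⟩ := hS r hr
    rwa [Ideal.mem_span_singleton]
  · intro r hr
    obtain ⟨σ, _, h⟩ := hQ1 r hr
    rw [h]; exact tau_mem_VV _ _ _ hP
  · intro r hr q hq
    simp only [Finset.mem_filter, Set.Finite.mem_toFinset] at hq
    exact hq.1.1.1
  · intro r hr q hq q' hq' hle
    simp only [Finset.mem_filter, Set.Finite.mem_toFinset] at hq hq'
    exact le_antisymm hle (hq'.1.2 hq.1.1 hle)
  · intro r hrS q hq
    simp only [Finset.mem_filter, Set.Finite.mem_toFinset] at hq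
    have := hq.1.1.2
    refine ⟨?_, this (Ideal.subset_span (by simp))⟩
    have h6 : f r ∈ q := this (Ideal.subset_span (by simp))
    calc r = _ := hr r hrS
      _ ≤ q := (Ideal.span_singleton_le_iff_mem _).mpr h6
  · intro r hrS q hq
    simp only [Finset.mem_filter, Set.Finite.mem_toFinset] at hq
    obtain ⟨hqm, σ₀, hle₀⟩ := hq
    obtain ⟨σb, _, he⟩ := hQ1 r hrS
    have hn := hQ2 r hrS
    rw [he] at hqm hn
    have hn' : ¬ f r ∣ D.T σb P := by
      rw [← Ideal.mem_span_singleton, ← hr r hrS]; exact hn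
    obtain ⟨σ, hσ, σ', hσ', hnq⟩ := D.N2 hB hP hP0 (hf r hrS) (hfP r hrS) hn' hqm hle₀
    have := hf_ge_card hV (by omega) (by omega) (by omega) hqm.1.1 (tau_mem_VV _ _ _ hP) hnq
      ((A.filter (fun σ => q ≤ D.pt σ)).image D.pt) (by
        intro m hm
        obtain ⟨s, _, rfl⟩ := Finset.mem_image.mp hm
        exact mI_max _ _ _) (by
        intro m hm
        obtain ⟨s, hs, rfl⟩ := Finset.mem_image.mp hm
        refine ⟨(Finset.mem_filter.mp hs).2, ?_⟩
        have h := hv s (Finset.mem_filter.mp hs).1 σ hσ σ' hσ'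
        exact D.T_mem_pt.mpr h)
    rwa [Finset.card_image_of_injOn (hptinj.mono (fun s hs => (Finset.mem_filter.mp hs).1))] at this

end Dat
end ZE

namespace ZE
open Module Finset

theorem det_abs_le {J : Type*} [Fintype J] [DecidableEq J] (A : Matrix J J ℝ) (c : J → ℝ)
    (h : ∀ i j, |A i j| ≤ c j) : |A.det| ≤ (Fintype.card J).factorial * ∏ j, c j := by
  rw [Matrix.det_apply]
  refine (Finset.abs_sum_le_sum_abs _ _).trans ?_
  have : ∀ σ ∈ (univ : Finset (Equiv.Perm J)), |Equiv.Perm.sign σ • ∏ i, A (σ i) i| ≤ ∏ j, c j := by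
    intro σ _
    rw [Units.smul_def, zsmul_eq_mul, abs_mul]
    have h1 : |((Equiv.Perm.sign σ : ℤˣ) : ℤ)| = 1 := Int.isUnit_iff_abs_eq.mp (Units.isUnit _)
    rw [← Int.cast_abs, h1, Int.cast_one, one_mul, Finset.abs_prod]
    exact Finset.prod_le_prod (fun _ _ => abs_nonneg _) (fun i _ => h _ _)
  refine (Finset.sum_le_card_nsmul _ _ _ this).trans ?_
  rw [Finset.card_univ, Fintype.card_perm, nsmul_eq_mul]

theorem det_norm_le {J : Type*} [Fintype J] [DecidableEq J] (A : Matrix J J ℂ) (c : J → ℝ)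
    (h : ∀ i j, ‖A i j‖ ≤ c j) : ‖A.det‖ ≤ (Fintype.card J).factorial * ∏ j, c j := by
  rw [Matrix.det_apply]
  refine (norm_sum_le _ _).trans ?_
  have : ∀ σ ∈ (univ : Finset (Equiv.Perm J)), ‖Equiv.Perm.sign σ • ∏ i, A (σ i) i‖ ≤ ∏ j, c j := by
    intro σ _
    rw [Units.smul_def, zsmul_eq_mul, norm_mul]
    have h1 : |((Equiv.Perm.sign σ : ℤˣ) : ℤ)| = 1 := Int.isUnit_iff_abs_eq.mp (Units.isUnit _)
    rw [Complex.norm_intCast, ← Int.cast_abs, h1, Int.cast_one, one_mul, norm_prod]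
    exact Finset.prod_le_prod (fun _ _ => norm_nonneg _) (fun i _ => h _ _)
  refine (Finset.sum_le_card_nsmul _ _ _ this).trans ?_
  rw [Finset.card_univ, Fintype.card_perm, nsmul_eq_mul]

theorem pigeon {J : Type*} [Fintype J] [DecidableEq J] {M m : ℕ} (hJ : Fintype.card J = M * m)
    (r : J → ℕ) (h : ∀ n < m, (univ.filter (fun j => r j = n)).card ≤ M) :
    M * (m * (m - 1) / 2) ≤ ∑ j, r j := by
  have h1 : ∀ j, ∑ s ∈ range m, (if s < r j then 1 else 0) ≤ r j := by
    intro j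
    rw [← Finset.sum_filter, ← Finset.card_eq_sum_ones]
    calc _ ≤ (range (r j)).card := Finset.card_le_card (by
            intro s hs; simp at hs ⊢; exact hs.2)
      _ = r j := by simp
  refine le_trans ?_ (Finset.sum_le_sum (fun j _ => h1 j))
  rw [Finset.sum_comm]
  have h2 : ∀ s ∈ range m, M * (m - 1 - s) ≤ ∑ j, (if s < r j then 1 else 0) := by
    intro s hs
    have hs := Finset.mem_range.mp hs
    rw [← Finset.sum_filter, ← Finset.card_eq_sum_ones]
    have h3 : (univ.filter (fun j => ¬ s < r j)).card ≤ M * (s + 1) := by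
      have : (univ.filter (fun j => ¬ s < r j)) ⊆ (range (s+1)).biUnion
          (fun n => univ.filter (fun j => r j = n)) := by
        intro j hj
        simp at hj ⊢; omega
      refine (Finset.card_le_card this).trans (Finset.card_biUnion_le.trans ?_)
      refine (Finset.sum_le_card_nsmul _ _ M ?_).trans ?_
      · intro n hn
        exact h n (by simp at hn; omega)
      · simp [mul_comm]
    have h4 := Finset.card_filter_add_card_filter_not (s := (univ : Finset J)) (fun j => s < r j)
    rw [Finset.card_univ, hJ] at h4
    have h5 : M * (m - 1 - s) + M * (s + 1) = M * m := by
      rw [← mul_add]; congr 1; omega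
    omega
  refine le_trans ?_ (Finset.sum_le_sum h2)
  rw [← Finset.mul_sum, Finset.sum_range_reflect (fun s => s) m, Finset.sum_range_id]

theorem det_ub {J : Type*} [Fintype J] [DecidableEq J] {M m : ℕ} (hJ : Fintype.card J = M * m)
    (v : J → ℕ → J → ℝ) (c : J → ℕ → ℝ) (hc : ∀ j n i, |v j n i| ≤ c j n)
    (U : ℕ → Submodule ℝ (J → ℝ)) (hU : ∀ n < m, finrank ℝ (U n) ≤ M)
    (hv : ∀ j, ∀ n < m, v j n ∈ U n) {E : ℝ} (hE : 1 ≤ E) :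
    |Matrix.det (Matrix.of (fun i j => ∑ n ∈ range (m + 1), v j n i))| * E ^ (M * (m * (m - 1) / 2)) ≤
      (Fintype.card J).factorial * ∏ j, ∑ n ∈ range (m + 1), E ^ n * c j n := by
  have hE0 : 0 < E := by linarith
  have e1 : Matrix.det (Matrix.of (fun i j => ∑ n ∈ range (m + 1), v j n i)) =
      Matrix.detRowAlternating (fun j => ∑ n ∈ range (m + 1), v j n) := by
    rw [← Matrix.det_transpose]
    show Matrix.det _ = Matrix.det (Matrix.of (fun j => ∑ n ∈ range (m + 1), v j n))
    congr 1
    ext j i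
    simp [Matrix.transpose]
  have e2 := (Matrix.detRowAlternating (n := J) (R := ℝ)).toMultilinearMap.map_sum_finset v
    (fun _ => range (m+1))
  simp only [AlternatingMap.coe_multilinearMap] at e2
  rw [e1, e2]
  have key : ∀ r ∈ Fintype.piFinset (fun _ : J => range (m+1)),
      |Matrix.detRowAlternating (fun j => v j (r j))| * E ^ (M * (m * (m - 1) / 2)) ≤
        (Fintype.card J).factorial * ∏ j, (E ^ (r j) * c j (r j)) := by
    intro r _
    have hcn : ∀ j n, 0 ≤ c j n := fun j n => (abs_nonneg _).trans (hc j n j)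
    by_cases h : ∀ n < m, (univ.filter (fun j => r j = n)).card ≤ M
    · have h1 := pigeon hJ r h
      have h2 : |Matrix.detRowAlternating (fun j => v j (r j))| ≤
          (Fintype.card J).factorial * ∏ j, c j (r j) := by
        have := det_abs_le (Matrix.transpose (Matrix.of (fun j => v j (r j)))) (fun j => c j (r j))
          (fun i j => hc _ _ _)
        rw [Matrix.det_transpose] at this
        exact this
      calc _ ≤ ((Fintype.card J).factorial * ∏ j, c j (r j)) * E ^ (∑ j, r j) :=
            mul_le_mul h2 (pow_le_pow_right₀ hE h1) (by positivity)
              (mul_nonneg (by positivity) (Finset.prod_nonneg (fun _ _ => hcn _ _)))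
        _ = _ := by
          rw [Finset.prod_mul_distrib, Finset.prod_pow_eq_pow_sum]; ring
    · push Not at h
      obtain ⟨n, hn, hlt⟩ := h
      rw [AlternatingMap.map_linearDependent, abs_zero, zero_mul]
      · exact mul_nonneg (by positivity) (Finset.prod_nonneg (fun _ _ => mul_nonneg (by positivity) (hcn _ _)))
      · intro hli
        have h1 : LinearIndependent ℝ (fun j : {j // r j = n} => (⟨v j.1 n, hv j.1 n hn⟩ : U n)) := by
          apply LinearIndependent.of_comp (U n).subtype
          have := hli.comp (fun j : {j // r j = n} => j.1) Subtype.val_injective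
          have e3 : ((U n).subtype ∘ fun j : {j // r j = n} => (⟨v j.1 n, hv j.1 n hn⟩ : U n)) =
              (fun j => v j (r j)) ∘ fun j : {j // r j = n} => j.1 := by
            funext ⟨j, hj⟩
            simp [hj]
          rw [e3]; exact this
        have h2 := h1.fintype_card_le_finrank
        rw [Fintype.card_subtype] at h2
        have := hU n hn
        omega
  calc _ ≤ (∑ r ∈ Fintype.piFinset (fun _ : J => range (m+1)),
        |Matrix.detRowAlternating (fun j => v j (r j))|) * E ^ (M * (m * (m - 1) / 2)) :=
        mul_le_mul_of_nonneg_right (Finset.abs_sum_le_sum_abs _ _) (by positivity)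
    _ ≤ _ := by
        rw [Finset.sum_mul, Finset.prod_univ_sum, Finset.mul_sum]
        exact Finset.sum_le_sum key

theorem exists_rows {I J : Type*} [Fintype J] [DecidableEq J] (R : I → J → ℝ)
    (h : ∀ u : J → ℝ, (∀ i, ∑ j, u j * R i j = 0) → u = 0) :
    ∃ e : J → I, Matrix.det (Matrix.of (fun i j => R (e i) j)) ≠ 0 := by
  have hs : Submodule.span ℝ (Set.range R) = ⊤ := by
    by_contra hne
    obtain ⟨f, hf0, hf⟩ := Submodule.exists_le_ker_of_lt_top _ (lt_top_iff_ne_top.mpr hne)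
    apply hf0
    have hrep : ∀ z : J → ℝ, f z = ∑ j, f (Pi.single j 1) * z j := by
      intro z
      conv_lhs => rw [← Finset.univ_sum_single z]
      rw [map_sum]
      refine Finset.sum_congr rfl (fun j _ => ?_)
      have : Pi.single j (z j) = z j • (Pi.single j 1 : J → ℝ) := by
        rw [← Pi.single_smul]; simp
      rw [this, map_smul, smul_eq_mul, mul_comm]
    have := h (fun j => f (Pi.single j 1)) (fun i => by
      rw [← hrep]
      exact hf (Submodule.subset_span ⟨i, rfl⟩))
    ext j
    simpa using congrFun this j
  obtain ⟨s, hs1, hs2, hs3⟩ := exists_linearIndependent ℝ (Set.range R)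
  rw [hs] at hs2
  let B := Basis.mk hs3 (by rw [Subtype.range_coe, hs2])
  let eq : J ≃ s := (Pi.basisFun ℝ J).indexEquiv B
  have hch : ∀ z : s, ∃ i, R i = z.1 := fun z => hs1 z.2
  choose e he using hch
  refine ⟨fun j => e (eq j), ?_⟩
  have hli : LinearIndependent ℝ (fun j : J => R (e (eq j))) := by
    have := hs3.comp eq eq.injective
    have e3 : (fun j : J => R (e (eq j))) = Subtype.val ∘ eq := by
      funext j; exact he _
    rw [e3]; exact this
  have := Matrix.linearIndependent_rows_iff_isUnit.mp (show LinearIndependent ℝ (Matrix.row (Matrix.of (fun i j => R (e (eq i)) j))) from hli)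
  rw [Matrix.isUnit_iff_isUnit_det] at this
  exact this.ne_zero

end ZE

namespace ZE
open Module Finset

noncomputable def etail (p : ℕ) (u : ℝ) : ℝ := Real.exp u - ∑ s ∈ range p, u ^ s / s.factorial

theorem etail_eq (p : ℕ) (u : ℝ) : HasSum (fun s : ℕ => u ^ (s + p) / (s + p).factorial) (etail p u) := by
  have h : HasSum (fun s : ℕ => u ^ s / s.factorial) (Real.exp u) := by
    rw [Real.exp_eq_exp_ℝ]
    exact NormedSpace.expSeries_div_hasSum_exp u
  exact (hasSum_nat_add_iff' p).mpr h

theorem etail_mono (p : ℕ) {u U : ℝ} (h0 : 0 ≤ u) (h : u ≤ U) : etail p u ≤ etail p U :=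
  hasSum_le (fun s => by gcongr) (etail_eq p u) (etail_eq p U)

theorem etail_scale (p : ℕ) {E U : ℝ} (hE : 1 ≤ E) (hU : 0 ≤ U) : E ^ p * etail p U ≤ etail p (E * U) := by
  refine hasSum_le (fun s => ?_) ((etail_eq p U).mul_left (E ^ p)) (etail_eq p (E * U))
  rw [← mul_div_assoc, mul_pow]
  gcongr
  · omega

theorem etail_abs (p : ℕ) (u : ℝ) : |Real.exp u - ∑ s ∈ range p, u ^ s / s.factorial| ≤ etail p |u| := by
  have h1 := etail_eq p u
  have h2 := etail_eq p |u|
  show |etail p u| ≤ _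
  rw [← h1.tsum_eq, ← h2.tsum_eq]
  have h3 : ∀ s : ℕ, ‖u ^ (s + p) / ((s + p).factorial : ℝ)‖ = |u| ^ (s + p) / (s + p).factorial := by
    intro s
    rw [norm_div, norm_pow, Real.norm_eq_abs, Real.norm_of_nonneg (by positivity)]
  have := norm_tsum_le_tsum_norm (f := fun s : ℕ => u ^ (s + p) / ((s + p).factorial : ℝ))
    (by simp only [h3]; exact h2.summable)
  simp only [h3] at this
  exact this

noncomputable def vv (m : ℕ) (k : ℕ) (X l w th : ℝ) (n : ℕ) : ℝ :=
  if n < m then (if k ≤ n then X * ((l * w) ^ (n - k) / (n - k).factorial) else 0)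
  else X * (Real.exp (l * (w + th)) - ∑ s ∈ range (m - k), (l * w) ^ s / s.factorial)

theorem sum_shift {m k : ℕ} (hk : k ≤ m) (F : ℕ → ℝ) :
    ∑ n ∈ range m, (if k ≤ n then F (n - k) else 0) = ∑ s ∈ range (m - k), F s := by
  obtain ⟨d, rfl⟩ := Nat.exists_eq_add_of_le hk
  rw [Finset.sum_range_add, Nat.add_sub_cancel_left]
  rw [Finset.sum_eq_zero, zero_add]
  · apply Finset.sum_congr rfl; intro s _; simp
  · intro n hn; rw [if_neg]; simp at hn; omega

theorem vv_sum {m k : ℕ} (hk : k ≤ m) (X l w th : ℝ) :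
    ∑ n ∈ range (m + 1), vv m k X l w th n = X * Real.exp (l * (w + th)) := by
  rw [Finset.sum_range_succ]
  have : ∀ n ∈ range m, vv m k X l w th n =
      (if k ≤ n then (fun s => X * ((l * w) ^ s / (s.factorial : ℝ))) (n - k) else 0) := by
    intro n hn
    rw [vv, if_pos (Finset.mem_range.mp hn)]
  rw [Finset.sum_congr rfl this, sum_shift hk (fun s => X * ((l * w) ^ s / (s.factorial : ℝ))), vv, if_neg (lt_irrefl _), ← Finset.mul_sum]
  ring

noncomputable def cc (m : ℕ) (k : ℕ) (Y U E : ℝ) (n : ℕ) : ℝ :=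
  if n < m then (if k ≤ n then Y * (U ^ (n - k) / (n - k).factorial) else 0)
  else Y * (etail (m - k) U + Real.exp U * (E ^ m)⁻¹)

theorem vv_le {m k : ℕ} {X Y l w th U E : ℝ} (hX : |X| ≤ Y) (hU : |l * w| ≤ U)
    (hth : |Real.exp (l * th) - 1| * E ^ m ≤ 1) (hE : 1 ≤ E) (n : ℕ) :
    |vv m k X l w th n| ≤ cc m k Y U E n := by
  have hE0 : 0 < E ^ m := by positivity
  have hY : 0 ≤ Y := (abs_nonneg _).trans hX
  have hU0 : 0 ≤ U := (abs_nonneg _).trans hU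
  unfold vv cc
  split_ifs with h1 h2
  · rw [abs_mul, abs_div, abs_pow, abs_of_pos (show (0:ℝ) < ((n-k).factorial : ℝ) by positivity)]
    gcongr
  · simp
  · rw [abs_mul]
    refine mul_le_mul hX ?_ (abs_nonneg _) hY
    have e : Real.exp (l * (w + th)) - ∑ s ∈ range (m - k), (l * w) ^ s / s.factorial =
        (Real.exp (l * w) - ∑ s ∈ range (m - k), (l * w) ^ s / s.factorial) +
          Real.exp (l * w) * (Real.exp (l * th) - 1) := by
      rw [mul_add, Real.exp_add]; ring
    rw [e]
    refine (abs_add_le _ _).trans (add_le_add ?_ ?_)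
    · exact (etail_abs _ _).trans (etail_mono _ (abs_nonneg _) hU)
    · rw [abs_mul, Real.abs_exp]
      refine mul_le_mul (Real.exp_le_exp.mpr ((le_abs_self _).trans hU)) ?_ (abs_nonneg _) (Real.exp_nonneg _)
      rw [inv_eq_one_div, le_div_iff₀ hE0]
      exact hth

theorem cc_sum {m k : ℕ} (hk : k ≤ m) {Y U E : ℝ} (hY : 0 ≤ Y) (hU : 0 ≤ U) (hE : 1 ≤ E) :
    ∑ n ∈ range (m + 1), E ^ n * cc m k Y U E n ≤ 2 * (Y * E ^ k * Real.exp (E * U)) := by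
  have hE0 : 0 < E := by linarith
  rw [Finset.sum_range_succ]
  have : ∀ n ∈ range m, E ^ n * cc m k Y U E n =
      (if k ≤ n then (fun s => Y * E ^ k * ((E * U) ^ s / (s.factorial : ℝ))) (n - k) else 0) := by
    intro n hn
    rw [cc, if_pos (Finset.mem_range.mp hn)]
    split_ifs with h
    · obtain ⟨d, rfl⟩ := Nat.exists_eq_add_of_le h
      simp only [Nat.add_sub_cancel_left]
      rw [pow_add, mul_pow]; ring
    · simp
  rw [Finset.sum_congr rfl this, sum_shift hk (fun s => Y * E ^ k * ((E * U) ^ s / (s.factorial : ℝ))), cc, if_neg (lt_irrefl _), ← Finset.mul_sum]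
  have h1 := etail_scale (m - k) hE hU
  have h2 : E ^ m = E ^ k * E ^ (m - k) := by rw [← pow_add]; congr 1; omega
  have h3 : Real.exp U ≤ Real.exp (E * U) := Real.exp_le_exp.mpr (by nlinarith)
  have h4 : E ^ m * (Y * (etail (m - k) U + Real.exp U * (E ^ m)⁻¹)) =
      Y * E ^ k * (E ^ (m - k) * etail (m - k) U) + Y * Real.exp U := by
    have : E ^ m * (E ^ m)⁻¹ = 1 := mul_inv_cancel₀ (by positivity)
    calc _ = Y * (E ^ m * etail (m-k) U) + Y * Real.exp U * (E ^ m * (E ^ m)⁻¹) := by ring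
      _ = _ := by rw [this, h2]; ring
  rw [h4]
  have h5 : Y * E ^ k * (E ^ (m - k) * etail (m - k) U) ≤ Y * E ^ k * etail (m - k) (E * U) := by gcongr
  have h6 : Y * Real.exp U ≤ Y * E ^ k * Real.exp (E * U) := by
    have : (1:ℝ) ≤ E ^ k := one_le_pow₀ hE
    calc Y * Real.exp U = Y * 1 * Real.exp U := by ring
      _ ≤ _ := by gcongr
  have h7 : Y * E ^ k * etail (m - k) (E * U) = Y * E ^ k * Real.exp (E * U) -
      Y * E ^ k * ∑ s ∈ range (m - k), (E * U) ^ s / s.factorial := by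
    unfold etail; ring
  linarith [h5, h6, h7]

theorem an_ub {J : Type*} [Fintype J] [DecidableEq J] {M m : ℕ} (hJ : Fintype.card J = M * m)
    (hMm : M ≤ m) (k1 k2 : J → ℕ) (l : J → ℝ) (hk : ∀ j, k1 j + k2 j < M) (x y w th : J → ℝ)
    {a b : ℝ} (hb : b ≠ 0) (hw : ∀ i, w i = a * x i + b * y i) {B W E : ℝ} (hE : 1 ≤ E)
    (hx : ∀ i, |x i| ≤ B) (hy : ∀ i, |y i| ≤ B) (hW : ∀ i, |w i| ≤ W) (hW0 : 0 ≤ W)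
    (hth : ∀ i j, |Real.exp (l j * th i) - 1| * E ^ m ≤ 1) :
    |Matrix.det (Matrix.of fun i j => x i ^ k1 j * y i ^ k2 j * Real.exp (l j * (w i + th i)))|
      * E ^ (M * (m * (m - 1) / 2)) ≤
      (Fintype.card J).factorial * ∏ j, (2 * (B ^ (k1 j + k2 j) * E ^ (k1 j + k2 j) * Real.exp (E * (|l j| * W)))) := by
  have hm : ∀ j, k1 j + k2 j ≤ m := fun j => by have := hk j; omega
  have e1 : ∀ i j, x i ^ k1 j * y i ^ k2 j * Real.exp (l j * (w i + th i)) =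
      ∑ n ∈ range (m + 1), vv m (k1 j + k2 j) (x i ^ k1 j * y i ^ k2 j) (l j) (w i) (th i) n :=
    fun i j => (vv_sum (hm j) _ _ _ _).symm
  simp_rw [e1]
  have hX : ∀ i j, |x i ^ k1 j * y i ^ k2 j| ≤ B ^ (k1 j + k2 j) := by
    intro i j
    have hB : 0 ≤ B := (abs_nonneg _).trans (hx i)
    rw [abs_mul, abs_pow, abs_pow, pow_add]
    have := hx i
    have := hy i
    gcongr
  refine (det_ub hJ (fun j n i => vv m (k1 j + k2 j) (x i ^ k1 j * y i ^ k2 j) (l j) (w i) (th i) n)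
    (fun j n => cc m (k1 j + k2 j) (B ^ (k1 j + k2 j)) (|l j| * W) E n)
    (fun j n i => vv_le (hX i j) (by rw [abs_mul]; gcongr; exact hW i) (hth i j) hE n)
    (fun n => Submodule.span ℝ (Set.range (fun (q : Fin M) => fun i => x i ^ (q : ℕ) * w i ^ (n - q))))
    (fun n _ => ?_) (fun j n hn => ?_) hE).trans ?_
  · exact (finrank_range_le_card _).trans (by simp)
  · show (fun i => vv m (k1 j + k2 j) (x i ^ k1 j * y i ^ k2 j) (l j) (w i) (th i) n) ∈ _
    by_cases hkn : k1 j + k2 j ≤ n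
    · have e2 : (fun i => vv m (k1 j + k2 j) (x i ^ k1 j * y i ^ k2 j) (l j) (w i) (th i) n) =
          ∑ s ∈ range (k2 j + 1), (l j ^ (n - (k1 j + k2 j)) / (n - (k1 j + k2 j)).factorial *
            (b⁻¹ ^ s * (-(b⁻¹ * a)) ^ (k2 j - s) * (k2 j).choose s)) •
            (fun i => x i ^ (k1 j + k2 j - s) * w i ^ (n - (k1 j + k2 j - s))) := by
        funext i
        rw [vv, if_pos hn, if_pos hkn, Finset.sum_apply]
        have ey : y i = b⁻¹ * w i + -(b⁻¹ * a) * x i := by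
          rw [hw i]; field_simp; ring
        rw [ey, add_pow, Finset.mul_sum, Finset.sum_mul]
        apply Finset.sum_congr rfl
        intro s hs
        have hs := Finset.mem_range.mp hs
        simp only [Pi.smul_apply, smul_eq_mul]
        have e3 : k1 j + k2 j - s = k1 j + (k2 j - s) := by omega
        have e4 : n - (k1 j + k2 j - s) = s + (n - (k1 j + k2 j)) := by omega
        rw [e4, e3]
        simp only [mul_pow, pow_add]
        ring
      rw [e2]
      refine Submodule.sum_mem _ (fun s _ => Submodule.smul_mem _ _ (Submodule.subset_span ?_))
      exact ⟨⟨k1 j + k2 j - s, by have := hk j; omega⟩, rfl⟩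
    · have : (fun i => vv m (k1 j + k2 j) (x i ^ k1 j * y i ^ k2 j) (l j) (w i) (th i) n) = 0 := by
        funext i; rw [vv, if_pos hn, if_neg hkn]; rfl
      rw [this]; exact Submodule.zero_mem _
  · by_cases hne : Nonempty J
    · have hB : 0 ≤ B := (abs_nonneg _).trans (hx hne.some)
      refine mul_le_mul_of_nonneg_left ?_ (by positivity)
      refine Finset.prod_le_prod (fun j _ => Finset.sum_nonneg (fun n _ => ?_)) (fun j _ => ?_)
      · refine mul_nonneg (by positivity) ((abs_nonneg _).trans
          (vv_le (hX hne.some j) (w := w hne.some) (by rw [abs_mul]; gcongr; exact hW _) (hth hne.some j) hE n))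
      · exact cc_sum (hm j) (by positivity) (by positivity) hE
    · rw [not_nonempty_iff] at hne
      simp

end ZE

namespace ZE
open Polynomial

theorem exists_al : ∃ α : ℝ, 1.465 ≤ α ∧ α ≤ 1.466 ∧ α ^ 3 = α ^ 2 + 1 := by
  have h := intermediate_value_Icc (a := (1.465:ℝ)) (b := 1.466) (by norm_num)
    (f := fun x : ℝ => x ^ 3 - x ^ 2) (by fun_prop)
  obtain ⟨x, hx, h1⟩ := h (show (1:ℝ) ∈ _ by constructor <;> norm_num)
  exact ⟨x, hx.1, hx.2, by simp only at h1; linarith⟩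

noncomputable def al : ℝ := exists_al.choose
theorem al_lb : 1.465 ≤ al := exists_al.choose_spec.1
theorem al_ub : al ≤ 1.466 := exists_al.choose_spec.2.1
theorem al_cube : al ^ 3 = al ^ 2 + 1 := exists_al.choose_spec.2.2
theorem al_pos : 0 < al := by have := al_lb; linarith

theorem log_al_ub : Real.log al ≤ 0.383 := by
  rw [Real.log_le_iff_le_exp al_pos]
  refine al_ub.trans ?_
  refine le_trans ?_ (Real.sum_le_exp_of_nonneg (x := 0.383) (by norm_num) 6)
  norm_num [Finset.sum_range_succ, Nat.factorial]

theorem log_al_lb : 0.36 ≤ Real.log al := by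
  rw [Real.le_log_iff_exp_le al_pos]
  refine le_trans ?_ al_lb
  refine (Real.exp_bound' (x := 0.36) (by norm_num) (by norm_num) (n := 6) (by norm_num)).trans ?_
  norm_num [Finset.sum_range_succ, Nat.factorial]

noncomputable def be : ℂ := ⟨(1 - al) / 2, Real.sqrt (al * (al - 1) - ((1 - al) / 2) ^ 2)⟩

theorem be_im_sq : be.im ^ 2 = al * (al - 1) - ((1 - al) / 2) ^ 2 := by
  have := al_lb
  have := al_ub
  exact Real.sq_sqrt (by nlinarith)

theorem be_re : be.re = (1 - al) / 2 := rfl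

theorem be_normSq : Complex.normSq be = al * (al - 1) := by
  rw [Complex.normSq_apply, ← sq, ← sq, be_im_sq, be_re]; ring

theorem be_quad : be ^ 2 = (1 - al) * be - al * (al - 1) := by
  apply Complex.ext
  · simp [pow_two, be_re]
    have := be_im_sq
    linear_combination -this
  · simp [pow_two, be_re]
    ring

theorem be_cube : be ^ 3 = be ^ 2 + 1 := by
  have h : (al : ℂ) ^ 3 = al ^ 2 + 1 := by exact_mod_cast al_cube
  have h2 := be_quad
  linear_combination (be - al) * h2 + h

theorem be_ne : be ≠ 0 := by
  intro h
  have h1 := be_normSq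
  rw [h, map_zero] at h1
  have := al_lb
  nlinarith

theorem al_inv : al⁻¹ = al ^ 2 - al := by
  have := al_pos
  have := al_cube
  field_simp
  linear_combination -this

theorem be_inv : be⁻¹ = be ^ 2 - be := by
  have := be_ne
  have := be_cube
  field_simp
  linear_combination -this

theorem norm_be_sq : ‖be‖ ^ 2 = al⁻¹ := by
  rw [Complex.sq_norm, be_normSq, al_inv]; ring

theorem log_norm_be : Real.log ‖be‖ = - (Real.log al) / 2 := by
  have h := congrArg Real.log norm_be_sq
  rw [Real.log_pow, Real.log_inv] at h
  push_cast at h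
  linarith

theorem norm_form (a b c : ℝ) : (a + b * al + c * al ^ 2) * ‖(a:ℂ) + b * be + c * be ^ 2‖ ^ 2
    = a ^ 3 + b ^ 3 + c ^ 3 + a ^ 2 * b + a ^ 2 * c - 2 * a * c ^ 2 + b ^ 2 * c - 3 * a * b * c := by
  rw [Complex.sq_norm, Complex.normSq_apply]
  have h := be_im_sq
  have hc := al_cube
  simp [pow_two, be_re]
  simp [pow_two] at h
  grind

def NF (a b c : ℤ) : ℤ :=
  a ^ 3 + b ^ 3 + c ^ 3 + a ^ 2 * b + a ^ 2 * c - 2 * a * c ^ 2 + b ^ 2 * c - 3 * a * b * c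

theorem NF_even {a b c : ℤ} (h : NF a b c = 0) : (2 ∣ a) ∧ (2 ∣ b) ∧ (2 ∣ c) := by
  have h2 := congrArg (Int.cast : ℤ → ZMod 2) h
  simp only [NF] at h2
  push_cast at h2
  have key : ∀ x y z : ZMod 2, x ^ 3 + y ^ 3 + z ^ 3 + x ^ 2 * y + x ^ 2 * z - 2 * x * z ^ 2 + y ^ 2 * z - 3 * x * y * z = 0 → x = 0 ∧ y = 0 ∧ z = 0 := by decide
  have := key _ _ _ h2
  refine ⟨?_, ?_, ?_⟩
  · exact (ZMod.intCast_zmod_eq_zero_iff_dvd a 2).mp this.1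
  · exact (ZMod.intCast_zmod_eq_zero_iff_dvd b 2).mp this.2.1
  · exact (ZMod.intCast_zmod_eq_zero_iff_dvd c 2).mp this.2.2

theorem NF_zero_aux : ∀ (n : ℕ) (a b c : ℤ), a.natAbs + b.natAbs + c.natAbs ≤ n → NF a b c = 0 → a = 0 ∧ b = 0 ∧ c = 0 := by
  intro n
  induction n with
  | zero => intro a b c h _; omega
  | succ n ih =>
    intro a b c h h0
    obtain ⟨⟨a', rfl⟩, ⟨b', rfl⟩, ⟨c', rfl⟩⟩ := NF_even h0
    have h1 : NF a' b' c' = 0 := by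
      have : NF (2 * a') (2 * b') (2 * c') = 8 * NF a' b' c' := by unfold NF; ring
      omega
    by_cases hz : a' = 0 ∧ b' = 0 ∧ c' = 0
    · omega
    · have := ih a' b' c' (by omega) h1
      omega

noncomputable def ff : ℤ[X] := X ^ 3 - X ^ 2 - 1

theorem ff_natDegree : ff.natDegree = 3 := by unfold ff; compute_degree!

theorem ff_monic : ff.Monic := by unfold ff; monicity!

theorem reduce (Q : ℤ[X]) : ∃ a b c : ℤ, ∃ S : ℤ[X], Q = C a + C b * X + C c * X ^ 2 + ff * S := by
  refine ⟨(Q %ₘ ff).coeff 0, (Q %ₘ ff).coeff 1, (Q %ₘ ff).coeff 2, Q /ₘ ff, ?_⟩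
  conv_lhs => rw [← modByMonic_add_div Q ff]
  congr 1
  have hd : (Q %ₘ ff).natDegree < 3 := by
    have := natDegree_modByMonic_lt Q ff_monic (by intro h; have := ff_natDegree; rw [h] at this; simp at this)
    rwa [ff_natDegree] at this
  conv_lhs => rw [(Q %ₘ ff).as_sum_range' 3 hd]
  simp [Finset.sum_range_succ, ← C_mul_X_pow_eq_monomial]

noncomputable def RR : Subring (ℝ × ℂ) := (aeval (R := ℤ) ((al, be) : ℝ × ℂ)).toRingHom.range

theorem mem_RR {u : ℝ} {v : ℂ} : (u, v) ∈ RR ↔ ∃ Q : ℤ[X], aeval al Q = u ∧ aeval be Q = v := by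
  unfold RR
  rw [RingHom.mem_range]
  refine exists_congr fun Q => ?_
  have h1 : (aeval ((al, be) : ℝ × ℂ) Q).1 = aeval al Q := (aeval_algHom_apply (AlgHom.fst ℤ ℝ ℂ) (al, be) Q).symm
  have h2 : (aeval ((al, be) : ℝ × ℂ) Q).2 = aeval be Q := (aeval_algHom_apply (AlgHom.snd ℤ ℝ ℂ) (al, be) Q).symm
  rw [← h1, ← h2]
  exact Prod.ext_iff

theorem ff_al : aeval al ff = 0 := by simp [ff, al_cube]
theorem ff_be : aeval be ff = 0 := by simp [ff, be_cube]

theorem liouville_aux (Q : ℤ[X]) : (aeval al Q = 0 ∧ ff ∣ Q) ∨ 1 ≤ |aeval al Q| * ‖aeval be Q‖ ^ 2 := by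
  obtain ⟨a, b, c, S, rfl⟩ := reduce Q
  have e1 : aeval al (C a + C b * X + C c * X ^ 2 + ff * S) = (a:ℝ) + b * al + c * al ^ 2 := by
    simp [ff_al]
  have e2 : aeval be (C a + C b * X + C c * X ^ 2 + ff * S) = ((a:ℝ):ℂ) + (b:ℝ) * be + (c:ℝ) * be ^ 2 := by
    simp [ff_be]
  rw [e1, e2]
  have h := norm_form a b c
  by_cases h0 : NF a b c = 0
  · left
    obtain ⟨rfl, rfl, rfl⟩ := NF_zero_aux _ a b c le_rfl h0
    simp
  · right
    have : |((NF a b c : ℤ) : ℝ)| = |(a:ℝ) + b * al + c * al ^ 2| * ‖((a:ℝ):ℂ) + (b:ℝ) * be + (c:ℝ) * be ^ 2‖ ^ 2 := by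
      conv_rhs => rw [← abs_of_nonneg (sq_nonneg ‖((a:ℝ):ℂ) + (b:ℝ) * be + (c:ℝ) * be ^ 2‖), ← abs_mul, h]
      simp [NF]
    rw [← this]
    exact_mod_cast Int.one_le_abs h0

theorem liouville {u : ℝ} {v : ℂ} (h : (u, v) ∈ RR) (hu : u ≠ 0) : 1 ≤ |u| * ‖v‖ ^ 2 := by
  obtain ⟨Q, rfl, rfl⟩ := mem_RR.mp h
  rcases liouville_aux Q with h1 | h1
  · exact absurd h1.1 hu
  · exact h1

theorem vanish {Q : ℤ[X]} (h : aeval al Q = 0) : aeval be Q = 0 ∧ aeval (10 : ZMod 31) Q = 0 := by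
  rcases liouville_aux Q with ⟨_, S, rfl⟩ | h1
  · constructor
    · simp [ff_be]
    · rw [map_mul]
      have : aeval (10 : ZMod 31) ff = 0 := by simp [ff]; decide
      rw [this, zero_mul]
  · rw [h] at h1; norm_num at h1

theorem det_mem {J : Type*} [Fintype J] [DecidableEq J] (U : J → J → ℝ) (V : J → J → ℂ)
    (h : ∀ i j, (U i j, V i j) ∈ RR) : ((Matrix.of U).det, (Matrix.of V).det) ∈ RR := by
  let A : Matrix J J RR := Matrix.of fun i j => ⟨(U i j, V i j), h i j⟩
  have := A.det.2
  convert this using 1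
  refine Prod.ext ?_ ?_
  · have e := RingHom.map_det ((RingHom.fst ℝ ℂ).comp RR.subtype) A
    simp only [RingHom.comp_apply] at e
    refine Eq.trans ?_ e.symm
    rfl
  · have e := RingHom.map_det ((RingHom.snd ℝ ℂ).comp RR.subtype) A
    simp only [RingHom.comp_apply] at e
    refine Eq.trans ?_ e.symm
    rfl

theorem int_mem (z : ℤ) : ((z : ℝ), (z : ℂ)) ∈ RR := mem_RR.mpr ⟨C z, by simp, by simp⟩

theorem mul_mem' {u u' : ℝ} {v v' : ℂ} (h : (u, v) ∈ RR) (h' : (u', v') ∈ RR) : (u * u', v * v') ∈ RR :=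
  RR.mul_mem h h'

theorem pow_mem' {u : ℝ} {v : ℂ} (h : (u, v) ∈ RR) (n : ℕ) : (u ^ n, v ^ n) ∈ RR :=
  RR.pow_mem h n

theorem al_mem : (al, be) ∈ RR := mem_RR.mpr ⟨X, by simp, by simp⟩
theorem al_inv_mem : (al⁻¹, be⁻¹) ∈ RR := mem_RR.mpr ⟨X ^ 2 - X, by simp [al_inv], by simp [be_inv]⟩

theorem zpow_mem' {u : ℝ} {v : ℂ} {d : ℕ} (h : (d * u, d * v) ∈ RR) (h' : (d * u⁻¹, d * v⁻¹) ∈ RR)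
    {n : ℕ} {z : ℤ} (hz : z.natAbs ≤ n) : ((d:ℝ) ^ n * u ^ z, (d:ℂ) ^ n * v ^ z) ∈ RR := by
  obtain ⟨w, hw⟩ := Int.eq_nat_or_neg z
  obtain ⟨e, rfl⟩ := Nat.exists_eq_add_of_le hz
  have hd : (((d:ℝ)) ^ e, (d:ℂ) ^ e) ∈ RR := pow_mem' (by simpa using int_mem d) e
  rcases hw with rfl | rfl
  · have := mul_mem' (pow_mem' h w) hd
    convert this using 2
    · simp only [Int.natAbs_natCast, zpow_natCast]; ring
    · simp only [Int.natAbs_natCast, zpow_natCast]; ring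
  · have := mul_mem' (pow_mem' h' w) hd
    convert this using 2
    · simp only [Int.natAbs_neg, Int.natAbs_natCast, zpow_neg, zpow_natCast]; ring
    · simp only [Int.natAbs_neg, Int.natAbs_natCast, zpow_neg, zpow_natCast]; ring

end ZE

namespace ZE
open Polynomial

theorem ga_prod : (3 * al - 2) * (9 * al ^ 2 - 3 * al - 2) = 31 := by
  linear_combination 27 * al_cube
theorem gb_prod : (3 * be - 2) * (9 * be ^ 2 - 3 * be - 2) = 31 := by
  linear_combination 27 * be_cube

theorem ga_lb : 2.395 ≤ 3 * al - 2 := by have := al_lb; linarith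
theorem ga_ub : 3 * al - 2 ≤ 2.398 := by have := al_ub; linarith
theorem gb_ne : 3 * be - 2 ≠ 0 := by
  intro h
  have := gb_prod
  rw [h] at this; norm_num at this

theorem gb_norm : (3 * al - 2) * ‖3 * be - 2‖ ^ 2 = 31 := by
  have h := norm_form (-2) 3 0
  norm_num at h
  rw [← h]
  congr 1
  · ring
  · congr 2; ring

noncomputable def et (ρ1 ρ2 : ℕ) : ℝ := ρ1 / (ρ2 * (3 * al - 2))
noncomputable def etb (ρ1 ρ2 : ℕ) : ℂ := ρ1 / (ρ2 * (3 * be - 2))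

theorem et_pos {ρ1 ρ2 : ℕ} (h1 : 0 < ρ1) (h2 : 0 < ρ2) : 0 < et ρ1 ρ2 := by
  have := ga_lb
  have : 0 < 3 * al - 2 := by linarith
  unfold et; positivity

theorem etb_ne {ρ1 ρ2 : ℕ} (h1 : 0 < ρ1) (h2 : 0 < ρ2) : etb ρ1 ρ2 ≠ 0 := by
  have := gb_ne
  unfold etb
  have : (ρ1:ℂ) ≠ 0 := by exact_mod_cast h1.ne'
  have : (ρ2:ℂ) ≠ 0 := by exact_mod_cast h2.ne'
  positivity

theorem et_mem {ρ1 ρ2 : ℕ} (h2 : 0 < ρ2) :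
    (((31 * ρ1 * ρ2 : ℕ) : ℝ) * et ρ1 ρ2, ((31 * ρ1 * ρ2 : ℕ) : ℂ) * etb ρ1 ρ2) ∈ RR := by
  have a1 := gb_ne
  have a2 : 3 * al - 2 ≠ 0 := by have := ga_lb; linarith
  have a3 : (ρ2:ℝ) ≠ 0 := by exact_mod_cast h2.ne'
  have a4 : (ρ2:ℂ) ≠ 0 := by exact_mod_cast h2.ne'
  have b1 := ga_prod
  have b2 := gb_prod
  refine mem_RR.mpr ⟨(ρ1 : ℤ[X]) ^ 2 * (9 * X ^ 2 - 3 * X - 2), ?_, ?_⟩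
  · replace b1 : 9 * al ^ 2 - 3 * al - 2 = 31 / (3 * al - 2) := by rw [eq_div_iff a2, mul_comm, b1]
    simp [et, map_ofNat, b1]
    field_simp
  · replace b2 : 9 * be ^ 2 - 3 * be - 2 = 31 / (3 * be - 2) := by rw [eq_div_iff a1, mul_comm, b2]
    simp [etb, map_ofNat, b2]
    field_simp

theorem et_inv_mem {ρ1 ρ2 : ℕ} (h1 : 0 < ρ1) :
    (((31 * ρ1 * ρ2 : ℕ) : ℝ) * (et ρ1 ρ2)⁻¹, ((31 * ρ1 * ρ2 : ℕ) : ℂ) * (etb ρ1 ρ2)⁻¹) ∈ RR := by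
  have a3 : (ρ1:ℝ) ≠ 0 := by exact_mod_cast h1.ne'
  have a4 : (ρ1:ℂ) ≠ 0 := by exact_mod_cast h1.ne'
  refine mem_RR.mpr ⟨31 * (ρ2 : ℤ[X]) ^ 2 * (3 * X - 2), ?_, ?_⟩
  · simp [et, map_ofNat]
    field_simp
  · simp [etb, map_ofNat]
    field_simp

theorem log_et {ρ1 ρ2 : ℕ} (h1 : 0 < ρ1) (h2 : 0 < ρ2) : |Real.log (et ρ1 ρ2)| ≤ Real.log (31 * ρ1 * ρ2) := by
  have g1 := ga_lb
  have g2 := ga_ub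
  have r1 : (1:ℝ) ≤ ρ1 := by exact_mod_cast h1
  have r2 : (1:ℝ) ≤ ρ2 := by exact_mod_cast h2
  unfold et
  rw [Real.log_div (by positivity) (by positivity), Real.log_mul (by positivity) (by positivity),
    Real.log_mul (by positivity) (by positivity), Real.log_mul (by positivity) (by positivity)]
  have l1 := Real.log_nonneg r1
  have l2 := Real.log_nonneg r2
  have l3 : 0 ≤ Real.log (3 * al - 2) := Real.log_nonneg (by linarith)
  have l4 : Real.log (3 * al - 2) ≤ Real.log 31 := Real.log_le_log (by linarith) (by linarith)
  rw [abs_le]; constructor <;> linarith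

theorem log_etb {ρ1 ρ2 : ℕ} (h1 : 0 < ρ1) (h2 : 0 < ρ2) : |Real.log ‖etb ρ1 ρ2‖| ≤ Real.log (31 * ρ1 * ρ2) := by
  have g1 := ga_lb
  have g2 := ga_ub
  have r1 : (1:ℝ) ≤ ρ1 := by exact_mod_cast h1
  have r2 : (1:ℝ) ≤ ρ2 := by exact_mod_cast h2
  have hb := gb_norm
  have p1 : 1 ≤ ‖3 * be - 2‖ := by nlinarith [norm_nonneg (3 * be - 2)]
  have p2 : ‖3 * be - 2‖ ≤ 31 := by nlinarith [norm_nonneg (3 * be - 2)]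
  unfold etb
  rw [norm_div, norm_mul, Complex.norm_natCast, Complex.norm_natCast, Real.log_div (by positivity) (by positivity), Real.log_mul (by positivity) (by positivity),
    Real.log_mul (by positivity) (by positivity), Real.log_mul (by positivity) (by positivity)]
  have l1 := Real.log_nonneg r1
  have l2 := Real.log_nonneg r2
  have l3 := Real.log_nonneg p1
  have l4 : Real.log ‖3 * be - 2‖ ≤ Real.log 31 := Real.log_le_log (by linarith) (by linarith)
  rw [abs_le]; constructor <;> linarith

theorem al_zpow_poly (r : ℤ) : ∃ A : ℤ[X], aeval al A = al ^ r ∧ aeval be A = be ^ r := by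
  have := zpow_mem' (u := al) (v := be) (d := 1) (by simpa using al_mem) (by simpa using al_inv_mem) (z := r) le_rfl
  simpa [mem_RR] using this

theorem norm_be_zpow (r : ℤ) : al ^ r * ‖be ^ r‖ ^ 2 = 1 := by
  have := al_pos
  rw [norm_zpow, ← zpow_natCast, ← zpow_mul, mul_comm r, zpow_mul, zpow_natCast, norm_be_sq, ← mul_zpow,
    mul_inv_cancel₀ this.ne', one_zpow]

theorem cube_aux {P Q n : ℕ} (hQ : 0 < Q) (h : P ^ 3 = Q ^ 3 * 31 ^ n) :
    ∃ n', n = 3 * n' ∧ P = Q * 31 ^ n' := by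
  have : Fact (Nat.Prime 31) := ⟨by norm_num⟩
  have h1 := congrArg (padicValNat 31) h
  rw [padicValNat.mul (by positivity) (by positivity), padicValNat.pow, padicValNat.pow,
    padicValNat.prime_pow] at h1
  have h2 : 3 ∣ n := by omega
  obtain ⟨n', rfl⟩ := h2
  refine ⟨n', rfl, ?_⟩
  rw [mul_comm 3 n', pow_mul, ← mul_pow] at h
  exact Nat.pow_left_injective (n := 3) (by norm_num) h

theorem z31a : (31 : ZMod 31) = 0 := by decide
theorem z31b : ¬ (3 * 10 - 2 : ZMod 31) = 0 := by decide

theorem indep_nat {g ρ1 ρ2 : ℕ} (hg : 2 ≤ g) (h1 : 0 < ρ1) (h2 : 0 < ρ2) (r s : ℤ) (n : ℕ)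
    (h : al ^ r * (g:ℝ) ^ s * et ρ1 ρ2 ^ n = 1) : r = 0 ∧ s = 0 ∧ n = 0 := by
  have hal := al_pos
  have hga : 0 < 3 * al - 2 := by have := ga_lb; linarith
  have hg0 : (g:ℝ) ≠ 0 := by positivity
  obtain ⟨A, hA1, hA2⟩ := al_zpow_poly r
  obtain ⟨P, hP⟩ : ∃ P, P = g ^ s.toNat * ρ1 ^ n := ⟨_, rfl⟩
  obtain ⟨Q, hQ⟩ : ∃ Q, Q = g ^ (-s).toNat * ρ2 ^ n := ⟨_, rfl⟩
  have hP0 : 0 < P := by rw [hP]; positivity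
  have hQ0 : 0 < Q := by rw [hQ]; positivity
  have hs : (g:ℝ) ^ s * g ^ (-s).toNat = g ^ s.toNat := by
    rw [← zpow_natCast, ← zpow_natCast, ← zpow_add₀ hg0]; congr 1; omega
  have e1 : al ^ r * P = Q * (3 * al - 2) ^ n := by
    rw [hP, hQ]; push_cast; rw [← hs]
    unfold et at h
    rw [div_pow, mul_pow] at h
    field_simp at h
    linear_combination (g:ℝ) ^ (-s).toNat * h
  have v1 := vanish (Q := A * C (P:ℤ) - C (Q:ℤ) * (3 * X - 2) ^ n) (by
    simp [hA1, map_ofNat]; linarith)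
  have e2 : be ^ r * P = Q * (3 * be - 2) ^ n := by
    have := v1.1
    simp [hA2, map_ofNat] at this
    linear_combination this
  have e3 : (P:ℝ) ^ 3 = Q ^ 3 * 31 ^ n := by
    have n1 := norm_be_zpow r
    have n2 := gb_norm
    have n3 := congrArg (fun z => ‖z‖) e2
    simp only [norm_mul, Complex.norm_natCast, norm_pow] at n3
    rw [← n2, mul_pow]
    calc (P:ℝ) ^ 3 = (al ^ r * ‖be ^ r‖ ^ 2) * P ^ 3 := by rw [n1, one_mul]
      _ = (al ^ r * P) * (‖be ^ r‖ * P) ^ 2 := by ring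
      _ = _ := by rw [e1, n3]; ring
  obtain ⟨n', rfl, hPQ⟩ := cube_aux hQ0 (by exact_mod_cast e3)
  rcases Nat.eq_zero_or_pos n' with rfl | hn
  · simp at hPQ e1 hP hQ
    have hs0 : s = 0 := by
      have : g ^ s.toNat = g ^ (-s).toNat := by rw [← hP, ← hQ, hPQ]
      have := Nat.pow_right_injective hg this
      omega
    subst hs0
    simp at h
    refine ⟨?_, rfl, rfl⟩
    by_contra hr
    exact hr ((zpow_eq_one_iff_right₀ hal.le (by have := al_lb; linarith)).mp h)
  · exfalso
    have v2 := vanish (Q := A * C (31 ^ n') - (3 * X - 2) ^ (3 * n')) (by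
      simp [hA1, map_ofNat]
      rw [hPQ] at e1
      push_cast at e1
      have : (Q:ℝ) ≠ 0 := by positivity
      apply mul_left_cancel₀ this
      linear_combination e1)
    have h3 := v2.2
    have : Fact (Nat.Prime 31) := ⟨by norm_num⟩
    simp [map_ofNat] at h3
    have z31 : (31 : ZMod 31) = 0 := z31a
    rw [z31, zero_pow hn.ne', mul_zero, zero_sub, neg_eq_zero] at h3
    exact z31b (pow_eq_zero_iff (by omega) |>.mp h3)

theorem indep {g ρ1 ρ2 : ℕ} (hg : 2 ≤ g) (h1 : 0 < ρ1) (h2 : 0 < ρ2) (r s t : ℤ)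
    (h : al ^ r * (g:ℝ) ^ s * et ρ1 ρ2 ^ t = 1) : r = 0 ∧ s = 0 ∧ t = 0 := by
  obtain ⟨n, rfl | rfl⟩ := Int.eq_nat_or_neg t
  · have := indep_nat hg h1 h2 r s n (by simpa using h)
    omega
  · have := indep_nat hg h1 h2 (-r) (-s) n (by
      have := congrArg (fun z => z⁻¹) h
      simp only [mul_inv, inv_one, ← zpow_neg, neg_neg, zpow_natCast] at this
      exact this)
    omega

end ZE

namespace ZE
open Module Finset

structure LFH (g ρ1 ρ2 k T q S T' L' e : ℕ) : Prop where
  hg : 2 ≤ g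
  hρ1 : 0 < ρ1
  hρ2 : 0 < ρ2
  hq : 30000 ≤ q
  he : 20 ≤ e
  hL : L' = 120 * e
  hLq : 2 * L' + 1 ≤ q
  c1 : 1800 * q * (2 * L' + 1) < S * T'
  c3 : 2 * S ≤ T
  cS : S * Real.log g ≤ 0.1 * q
  cT : T' * Real.log (31 * ρ1 * ρ2) ≤ 0.1 * q
  cx : (11 * q + 3 * T' * k : ℝ) ≤ Real.exp e
  cy : (3 * S + 3 * T' * T : ℝ) ≤ Real.exp e

noncomputable def DD (g ρ1 ρ2 k T : ℕ) (hg : 2 ≤ g) (h1 : 0 < ρ1) (h2 : 0 < ρ2) : Dat (ℤ × ℤ × ℤ) where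
  x := AddMonoidHom.mk' (fun σ => ((σ.1 - σ.2.2 * k : ℤ) : ℝ)) (fun a b => by push_cast; simp; ring)
  y := AddMonoidHom.mk' (fun σ => ((σ.2.1 + σ.2.2 * T : ℤ) : ℝ)) (fun a b => by push_cast; simp; ring)
  χ := fun σ => al ^ σ.1 * (g:ℝ) ^ σ.2.1 * et ρ1 ρ2 ^ σ.2.2
  hmul := fun a b => by
    have a1 := al_pos
    have a2 : (g:ℝ) ≠ 0 := by positivity
    have a3 := et_pos h1 h2
    simp only [Prod.fst_add, Prod.snd_add]
    rw [zpow_add₀ a1.ne', zpow_add₀ a2, zpow_add₀ a3.ne']; ring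
  hpos := fun a => by
    have a1 := al_pos
    have a3 := et_pos h1 h2
    positivity
  hinj := fun a b h => by
    have a1 := al_pos
    have a2 : (g:ℝ) ≠ 0 := by positivity
    have a3 := et_pos h1 h2
    have := indep hg h1 h2 (a.1 - b.1) (a.2.1 - b.2.1) (a.2.2 - b.2.2) (by
      simp only at h
      rw [zpow_sub₀ a1.ne', zpow_sub₀ a2, zpow_sub₀ a3.ne']
      have b1 : al ^ b.1 ≠ 0 := by positivity
      have b2 : (g:ℝ) ^ b.2.1 ≠ 0 := by positivity
      have b3 : et ρ1 ρ2 ^ b.2.2 ≠ 0 := by positivity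
      field_simp
      exact h)
    ext <;> omega

variable {g ρ1 ρ2 k T q S T' L' e : ℕ}

theorem joint_inj {σ τ : ℤ × ℤ × ℤ} {S : ℕ} (hS : 2 * S ≤ T) (h : |σ.2.1 - τ.2.1| < 2 * S)
    (hy : σ.2.1 + σ.2.2 * T = τ.2.1 + τ.2.2 * T) : σ.2 = τ.2 := by
  have h2 : (σ.2.2 - τ.2.2) * T = τ.2.1 - σ.2.1 := by linarith
  have h3 : σ.2.2 - τ.2.2 = 0 := by
    by_contra hne
    have := Int.one_le_abs hne
    have h4 : |(σ.2.2 - τ.2.2) * (T:ℤ)| < T := by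
      rw [h2, abs_sub_comm]; omega
    rw [abs_mul, abs_of_nonneg (show (0:ℤ) ≤ T by positivity)] at h4
    nlinarith
  rw [h3] at h2
  ext <;> linarith

theorem boxes (H : LFH g ρ1 ρ2 k T q S T' L' e) :
    (DD g ρ1 ρ2 k T H.hg H.hρ1 H.hρ2).Boxes (20 * q) (60 * q) (2 * L' + 1)
      (Ico (-(11 * q : ℤ)) (-(10 * q : ℤ)) ×ˢ Ico (-(3 * S : ℤ)) (-(S : ℤ)) ×ˢ Ico (-(3 * T' : ℤ)) (-(T' : ℤ)))
      (Ico (0 : ℤ) q ×ˢ Ico (0 : ℤ) (2 * S) ×ˢ Ico (0 : ℤ) (2 * T'))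
      (Ico (0 : ℤ) (20 * q) ×ˢ Ico (0 : ℤ) (2 * S) ×ˢ Ico (0 : ℤ) (2 * T'))
      (Ico (0 : ℤ) (20 * q) ×ˢ {0} ×ˢ {0})
      ({0} ×ˢ Ico (0 : ℤ) (2 * S) ×ˢ Ico (0 : ℤ) (2 * T')) := by
  have hq := H.hq
  have he := H.he
  have hL := H.hL
  have hLq := H.hLq
  have c1 := H.c1
  have c3 := H.c3
  have hS : 0 < S := Nat.pos_of_ne_zero (by rintro rfl; simp at c1)
  have hT : 0 < T' := Nat.pos_of_ne_zero (by rintro rfl; simp at c1)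
  have hc : 6 * (20 * q * (60 * q) * (2 * L' + 1)) < q * (2 * S * (2 * T')) := by nlinarith
  refine ⟨by omega, by omega, by omega, ?_, ?_, ?_, ?_, ?_, ?_, ?_, ?_, ?_, ?_, ?_, ?_, ?_, ?_⟩
  · intro σ h
    simp only [mem_product, mem_Ico, mem_singleton] at h ⊢
    omega
  · intro σ h
    simp only [mem_product, mem_Ico, mem_singleton] at h ⊢
    omega
  · intro σ h
    simp only [mem_product, mem_Ico, mem_singleton] at h
    simp [DD, h]
  · intro σ h τ h' hx
    simp only [coe_product, Set.mem_prod, mem_coe, mem_product, mem_Ico, mem_singleton] at h h'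
    simp only [DD, AddMonoidHom.mk'_apply, Int.cast_inj, h.2.2, h'.2.2] at hx
    ext <;> omega
  · simp
  · simp; omega
  · intro σ h τ h' hy
    simp only [coe_product, Set.mem_prod, mem_coe, mem_product, mem_Ico, mem_singleton] at h h'
    simp only [DD, AddMonoidHom.mk'_apply, Int.cast_inj] at hy
    have := joint_inj c3 (by rw [abs_lt]; constructor <;> omega) hy
    exact Prod.ext (by omega) this
  · simp
    rw [show (2 * (S:ℤ)).toNat = 2 * S by omega, show (2 * (T':ℤ)).toNat = 2 * T' by omega]
    nlinarith
  · simp; omega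
  · simp; omega
  · intro σ h τ h' hx hy
    simp only [mem_product, mem_Ico] at h h'
    simp only [DD, AddMonoidHom.mk'_apply, Int.cast_inj] at hx hy
    have := joint_inj c3 (by rw [abs_lt]; constructor <;> omega) hy
    rw [this] at hx
    exact Prod.ext (by linarith) this
  · intro σ h τ h' hx hy
    simp only [mem_product, mem_Ico] at h h'
    simp only [DD, AddMonoidHom.mk'_apply, Int.cast_inj] at hx hy
    have := joint_inj c3 (by rw [abs_lt]; constructor <;> omega) hy
    rw [this] at hx
    exact Prod.ext (by linarith) this
  · simp
    rw [show (2 * (S:ℤ)).toNat = 2 * S by omega, show (2 * (T':ℤ)).toNat = 2 * T' by omega]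
    exact hc
  · simp
    rw [show (-(10 * q : ℤ) + 11 * q).toNat = q by omega, show (-(S:ℤ) + 3 * S).toNat = 2 * S by omega,
      show (-(T':ℤ) + 3 * T').toNat = 2 * T' by omega]
    exact hc

theorem rows (H : LFH g ρ1 ρ2 k T q S T' L' e) :
    ∃ σ : Fin (20 * q) × Fin (60 * q) × Fin (2 * L' + 1) → ℤ × ℤ × ℤ,
      (∀ i, |(σ i).1| ≤ 11 * q ∧ |(σ i).2.1| ≤ 3 * S ∧ |(σ i).2.2| ≤ 3 * T') ∧
      Matrix.det (Matrix.of fun i j : Fin (20 * q) × Fin (60 * q) × Fin (2 * L' + 1) =>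
        (((σ i).1 - (σ i).2.2 * k : ℤ) : ℝ) ^ (j.1 : ℕ) * (((σ i).2.1 + (σ i).2.2 * T : ℤ) : ℝ) ^ (j.2.1 : ℕ) *
          (al ^ (σ i).1 * (g:ℝ) ^ (σ i).2.1 * et ρ1 ρ2 ^ (σ i).2.2) ^ (j.2.2 : ℕ)) ≠ 0 := by
  have hB := boxes H
  let I := {σ : ℤ × ℤ × ℤ // |σ.1| ≤ 11 * q ∧ |σ.2.1| ≤ 3 * S ∧ |σ.2.2| ≤ 3 * T'}
  let J := Fin (20 * q) × Fin (60 * q) × Fin (2 * L' + 1)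
  obtain ⟨f, hf⟩ := exists_rows (I := I) (J := J) (fun i j =>
      (((i.1).1 - (i.1).2.2 * k : ℤ) : ℝ) ^ (j.1 : ℕ) * (((i.1).2.1 + (i.1).2.2 * T : ℤ) : ℝ) ^ (j.2.1 : ℕ) *
          (al ^ (i.1).1 * (g:ℝ) ^ (i.1).2.1 * et ρ1 ρ2 ^ (i.1).2.2) ^ (j.2.2 : ℕ)) (by
    intro u hu
    let ex : J → (Fin 3 →₀ ℕ) := fun j => Finsupp.equivFunOnFinite.symm ![(j.1:ℕ), j.2.1, j.2.2]
    have hex : Function.Injective ex := by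
      rintro ⟨a, b, c⟩ ⟨a', b', c'⟩ h
      have h0 := DFunLike.congr_fun h 0
      have h1 := DFunLike.congr_fun h 1
      have h2 := DFunLike.congr_fun h 2
      simp [ex] at h0 h1 h2
      ext <;> simp [*]
    let P : A3 := ∑ j, MvPolynomial.monomial (ex j) (u j)
    have hP : P ∈ VV (20 * q) (60 * q) (2 * L' + 1) 1 := by
      refine Submodule.sum_mem _ fun j _ => ?_
      rw [mem_VV_iff]
      intro d hd
      have := MvPolynomial.support_monomial_subset hd
      rw [mem_singleton] at this
      subst this
      have := j.2.2.2
      simp [ex]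
      omega
    have hev : ∀ x y z : ℝ, MvPolynomial.eval ![x, y, z] P = ∑ j, u j * (x ^ (j.1:ℕ) * y ^ (j.2.1:ℕ) * z ^ (j.2.2:ℕ)) := by
      intro x y z
      simp only [P, map_sum, MvPolynomial.eval_monomial]
      refine sum_congr rfl fun j _ => ?_
      rw [Finsupp.prod_fintype _ _ (by simp)]
      simp [ex, Fin.prod_univ_three]
    have hP0 : P = 0 := by
      refine Dat.zero_estimate _ hB hP ?_
      intro σ h σ' h' σ'' h''
      simp only [mem_product, mem_Ico] at h h' h''
      unfold Dat.pt
      rw [mem_mI, hev]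
      refine hu ⟨σ' + σ'' + σ, ?_⟩
      simp only [Prod.fst_add, Prod.snd_add, abs_le]
      omega
    funext j
    have := congrArg (MvPolynomial.coeff (ex j)) hP0
    simp only [P, MvPolynomial.coeff_sum, MvPolynomial.coeff_monomial, MvPolynomial.coeff_zero] at this
    rw [Finset.sum_eq_single j] at this
    · simpa using this
    · intro b _ hb
      rw [if_neg (fun h => hb (hex h))]
    · simp)
  exact ⟨fun i => (f i).1, fun i => (f i).2, hf⟩

end ZE

namespace ZE
open Module Finset

variable {g ρ1 ρ2 k T q S T' L' e : ℕ}

theorem sum_abs (n : ℕ) : ∑ j ∈ range (2 * n + 1), |(j:ℝ) - n| = n * (n + 1) := by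
  induction n with
  | zero => simp
  | succ n ih =>
    rw [show 2 * (n + 1) + 1 = (2 * n + 1 + 1) + 1 by ring, sum_range_succ, sum_range_succ']
    have : ∀ j ∈ range (2 * n + 1), |((j + 1 : ℕ) : ℝ) - (n + 1 : ℕ)| = |(j:ℝ) - n| := by
      intro j _; push_cast; congr 1; ring
    rw [sum_congr rfl this, ih]
    push_cast
    have h0 : (0:ℝ) ≤ n := by positivity
    rw [abs_of_nonpos (a := (0:ℝ) - (n + 1)) (by linarith), abs_of_nonneg (by linarith)]
    ring

noncomputable def lj (L' : ℕ) (j : Fin (20 * q) × Fin (60 * q) × Fin (2 * L' + 1)) : ℝ := ((j.2.2 : ℕ) : ℝ) - L'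

theorem sum_lj (q L' : ℕ) : ∑ j : Fin (20 * q) × Fin (60 * q) × Fin (2 * L' + 1), |lj L' j| = 1200 * q ^ 2 * (L' * (L' + 1)) := by
  simp only [lj, Fintype.sum_prod_type]
  rw [Fin.sum_univ_eq_sum_range (fun j => |(j:ℝ) - L'|), sum_abs]
  simp
  ring

theorem lj_abs (j : Fin (20 * q) × Fin (60 * q) × Fin (2 * L' + 1)) : |lj L' j| ≤ L' := by
  have := j.2.2.2
  have h2 : ((j.2.2 : ℕ) : ℝ) ≤ 2 * L' := by exact_mod_cast (by omega : (j.2.2:ℕ) ≤ 2 * L')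
  have h3 : (0:ℝ) ≤ ((j.2.2 : ℕ) : ℝ) := by positivity
  unfold lj
  rw [abs_le]; constructor <;> linarith

noncomputable def lchi (g ρ1 ρ2 : ℕ) (σ : ℤ × ℤ × ℤ) : ℝ :=
  σ.1 * Real.log al + σ.2.1 * Real.log g + σ.2.2 * Real.log (et ρ1 ρ2)

noncomputable def xx (k : ℕ) (σ : ℤ × ℤ × ℤ) : ℝ := ((σ.1 - σ.2.2 * k : ℤ) : ℝ)
noncomputable def yy (T : ℕ) (σ : ℤ × ℤ × ℤ) : ℝ := ((σ.2.1 + σ.2.2 * T : ℤ) : ℝ)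

theorem exp_lchi (hg : 2 ≤ g) (h1 : 0 < ρ1) (h2 : 0 < ρ2) (σ : ℤ × ℤ × ℤ) (z : ℤ) :
    Real.exp (z * lchi g ρ1 ρ2 σ) = (al ^ σ.1 * (g:ℝ) ^ σ.2.1 * et ρ1 ρ2 ^ σ.2.2) ^ z := by
  have a1 := al_pos
  have a3 := et_pos h1 h2
  have a2 : (0:ℝ) < g := by positivity
  rw [← Real.exp_log (show 0 < (al ^ σ.1 * (g:ℝ) ^ σ.2.1 * et ρ1 ρ2 ^ σ.2.2) ^ z by positivity)]
  rw [Real.log_zpow, Real.log_mul (by positivity) (by positivity), Real.log_mul (by positivity) (by positivity),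
    Real.log_zpow, Real.log_zpow, Real.log_zpow, lchi]

theorem abs3 {σ : ℤ × ℤ × ℤ} (h : |σ.1| ≤ 11 * q ∧ |σ.2.1| ≤ 3 * S ∧ |σ.2.2| ≤ 3 * T') :
    |(σ.1:ℝ)| ≤ 11 * q ∧ |(σ.2.1:ℝ)| ≤ 3 * S ∧ |(σ.2.2:ℝ)| ≤ 3 * T' := by
  exact ⟨by exact_mod_cast h.1, by exact_mod_cast h.2.1, by exact_mod_cast h.2.2⟩

theorem xx_le (H : LFH g ρ1 ρ2 k T q S T' L' e) {σ : ℤ × ℤ × ℤ}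
    (h : |σ.1| ≤ 11 * q ∧ |σ.2.1| ≤ 3 * S ∧ |σ.2.2| ≤ 3 * T') : |xx k σ| ≤ Real.exp e := by
  refine le_trans ?_ H.cx
  obtain ⟨h1, h2, h3⟩ := abs3 h
  unfold xx
  push_cast
  calc |(σ.1:ℝ) - σ.2.2 * k| ≤ |(σ.1:ℝ)| + |(σ.2.2:ℝ) * k| := abs_sub _ _
    _ = |(σ.1:ℝ)| + |(σ.2.2:ℝ)| * k := by rw [abs_mul, Nat.abs_cast]
    _ ≤ _ := by gcongr

theorem yy_le (H : LFH g ρ1 ρ2 k T q S T' L' e) {σ : ℤ × ℤ × ℤ}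
    (h : |σ.1| ≤ 11 * q ∧ |σ.2.1| ≤ 3 * S ∧ |σ.2.2| ≤ 3 * T') : |yy T σ| ≤ Real.exp e := by
  refine le_trans ?_ H.cy
  obtain ⟨h1, h2, h3⟩ := abs3 h
  unfold yy
  push_cast
  calc |(σ.2.1:ℝ) + σ.2.2 * T| ≤ |(σ.2.1:ℝ)| + |(σ.2.2:ℝ) * T| := abs_add_le _ _
    _ = |(σ.2.1:ℝ)| + |(σ.2.2:ℝ)| * T := by rw [abs_mul, Nat.abs_cast]
    _ ≤ _ := by gcongr

theorem lin_le (H : LFH g ρ1 ρ2 k T q S T' L' e) {σ : ℤ × ℤ × ℤ}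
    (h : |σ.1| ≤ 11 * q ∧ |σ.2.1| ≤ 3 * S ∧ |σ.2.2| ≤ 3 * T') {c u v : ℝ} (hu : |u| ≤ c)
    (hv : |v| ≤ Real.log (31 * ρ1 * ρ2)) :
    |σ.1 * u + σ.2.1 * Real.log g + σ.2.2 * v| ≤ (11 * c + 0.6) * q := by
  obtain ⟨h1, h2, h3⟩ := abs3 h
  have cS := H.cS
  have cT := H.cT
  have hg : 0 ≤ Real.log g := Real.log_natCast_nonneg g
  calc |σ.1 * u + σ.2.1 * Real.log g + σ.2.2 * v| ≤ |σ.1 * u| + |σ.2.1 * Real.log g| + |σ.2.2 * v| := abs_add_three _ _ _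
    _ = |(σ.1:ℝ)| * |u| + |(σ.2.1:ℝ)| * Real.log g + |(σ.2.2:ℝ)| * |v| := by
        rw [abs_mul, abs_mul, abs_mul, abs_of_nonneg hg]
    _ ≤ (11 * q) * c + (3 * S) * Real.log g + (3 * T') * Real.log (31 * ρ1 * ρ2) := by
        gcongr
    _ ≤ _ := by linarith

theorem rows2 (H : LFH g ρ1 ρ2 k T q S T' L' e) :
    ∃ σ : Fin (20 * q) × Fin (60 * q) × Fin (2 * L' + 1) → ℤ × ℤ × ℤ,
      (∀ i, |(σ i).1| ≤ 11 * q ∧ |(σ i).2.1| ≤ 3 * S ∧ |(σ i).2.2| ≤ 3 * T') ∧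
      Matrix.det (Matrix.of fun i j : Fin (20 * q) × Fin (60 * q) × Fin (2 * L' + 1) =>
        xx k (σ i) ^ (j.1 : ℕ) * yy T (σ i) ^ (j.2.1 : ℕ) * Real.exp (lj L' j * lchi g ρ1 ρ2 (σ i))) ≠ 0 := by
  obtain ⟨σ, h1, h2⟩ := rows H
  refine ⟨σ, h1, ?_⟩
  have key := Matrix.det_mul_column (fun i => Real.exp (-L' * lchi g ρ1 ρ2 (σ i)))
    (Matrix.of fun i j : Fin (20 * q) × Fin (60 * q) × Fin (2 * L' + 1) =>
        (((σ i).1 - (σ i).2.2 * k : ℤ) : ℝ) ^ (j.1 : ℕ) * (((σ i).2.1 + (σ i).2.2 * T : ℤ) : ℝ) ^ (j.2.1 : ℕ) *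
          (al ^ (σ i).1 * (g:ℝ) ^ (σ i).2.1 * et ρ1 ρ2 ^ (σ i).2.2) ^ (j.2.2 : ℕ))
  have e1 : (Matrix.of fun i j : Fin (20 * q) × Fin (60 * q) × Fin (2 * L' + 1) =>
        xx k (σ i) ^ (j.1 : ℕ) * yy T (σ i) ^ (j.2.1 : ℕ) * Real.exp (lj L' j * lchi g ρ1 ρ2 (σ i))) =
      Matrix.of fun i j => Real.exp (-L' * lchi g ρ1 ρ2 (σ i)) * (Matrix.of fun i j : Fin (20 * q) × Fin (60 * q) × Fin (2 * L' + 1) =>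
        (((σ i).1 - (σ i).2.2 * k : ℤ) : ℝ) ^ (j.1 : ℕ) * (((σ i).2.1 + (σ i).2.2 * T : ℤ) : ℝ) ^ (j.2.1 : ℕ) *
          (al ^ (σ i).1 * (g:ℝ) ^ (σ i).2.1 * et ρ1 ρ2 ^ (σ i).2.2) ^ (j.2.2 : ℕ)) i j := by
    ext i j
    simp only [Matrix.of_apply]
    have := exp_lchi H.hg H.hρ1 H.hρ2 (σ i) ((j.2.2 : ℕ) : ℤ)
    rw [zpow_natCast] at this
    rw [← this, xx, yy, lj, show (((j.2.2:ℕ):ℝ) - L') * lchi g ρ1 ρ2 (σ i) = -L' * lchi g ρ1 ρ2 (σ i) + (((j.2.2 : ℕ) : ℤ):ℝ) * lchi g ρ1 ρ2 (σ i) by push_cast; ring, Real.exp_add]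
    ring
  rw [e1, key]
  refine mul_ne_zero ?_ h2
  exact prod_ne_zero_iff.mpr fun i _ => (Real.exp_pos _).ne'

noncomputable def lCc (g ρ1 ρ2 S T' L' : ℕ) : ℝ := 3 * S * L' * Real.log g + 3 * T' * L' * Real.log (31 * ρ1 * ρ2)

theorem lb_aux (H : LFH g ρ1 ρ2 k T q S T' L' e)
    {σ : Fin (20 * q) × Fin (60 * q) × Fin (2 * L' + 1) → ℤ × ℤ × ℤ}
    (hσ : ∀ i, |(σ i).1| ≤ 11 * q ∧ |(σ i).2.1| ≤ 3 * S ∧ |(σ i).2.2| ≤ 3 * T')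
    (hd : Matrix.det (Matrix.of fun i j : Fin (20 * q) × Fin (60 * q) × Fin (2 * L' + 1) =>
        xx k (σ i) ^ (j.1 : ℕ) * yy T (σ i) ^ (j.2.1 : ℕ) * Real.exp (lj L' j * lchi g ρ1 ρ2 (σ i))) ≠ 0) :
    1 ≤ (Real.exp (lCc g ρ1 ρ2 S T' L')) ^ (1200 * q ^ 2 * (2 * L' + 1)) *
      |Matrix.det (Matrix.of fun i j : Fin (20 * q) × Fin (60 * q) × Fin (2 * L' + 1) =>
        xx k (σ i) ^ (j.1 : ℕ) * yy T (σ i) ^ (j.2.1 : ℕ) * Real.exp (lj L' j * lchi g ρ1 ρ2 (σ i)))| *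
      ((1200 * q ^ 2 * (2 * L' + 1)).factorial * ∏ j : Fin (20 * q) × Fin (60 * q) × Fin (2 * L' + 1),
        (Real.exp (lCc g ρ1 ρ2 S T' L') * Real.exp (80 * q * e) * Real.exp (|lj L' j| * (2.7065 * q)))) ^ 2 := by
  have a1 := al_pos
  have a3 := et_pos H.hρ1 H.hρ2
  have hg := H.hg
  have hρ1 := H.hρ1
  have hρ2 := H.hρ2
  have a2 : (0:ℝ) < g := by positivity
  have hcard : Fintype.card (Fin (20 * q) × Fin (60 * q) × Fin (2 * L' + 1)) = 1200 * q ^ 2 * (2 * L' + 1) := by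
    simp; ring
  have hCc : Real.exp (lCc g ρ1 ρ2 S T' L') = (g:ℝ) ^ (3 * S * L') * ((31 * ρ1 * ρ2 : ℕ):ℝ) ^ (3 * T' * L') := by
    rw [← Real.exp_log (show (0:ℝ) < (g:ℝ) ^ (3 * S * L') * ((31 * ρ1 * ρ2 : ℕ):ℝ) ^ (3 * T' * L') by positivity)]
    rw [Real.log_mul (by positivity) (by positivity), Real.log_pow, Real.log_pow, lCc]
    push_cast
    rfl
  set c := Real.exp (lCc g ρ1 ρ2 S T' L') with hc
  let zj : Fin (20 * q) × Fin (60 * q) × Fin (2 * L' + 1) → ℤ := fun j => ((j.2.2:ℕ):ℤ) - L'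
  have hzj : ∀ j, ((zj j : ℤ) : ℝ) = lj L' j := fun j => by simp [zj, lj]
  have hzj' : ∀ j, (zj j).natAbs ≤ L' := fun j => by
    have := j.2.2.2
    simp only [zj]; omega
  let V : Fin (20 * q) × Fin (60 * q) × Fin (2 * L' + 1) → Fin (20 * q) × Fin (60 * q) × Fin (2 * L' + 1) → ℂ :=
    fun i j => (c:ℂ) * (((xx k (σ i) : ℝ) : ℂ) ^ (j.1 : ℕ) * ((yy T (σ i) : ℝ) : ℂ) ^ (j.2.1 : ℕ) *
      (be ^ (σ i).1 * (g:ℂ) ^ (σ i).2.1 * etb ρ1 ρ2 ^ (σ i).2.2) ^ zj j)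
  have hmem := det_mem (fun i j => c * (xx k (σ i) ^ (j.1 : ℕ) * yy T (σ i) ^ (j.2.1 : ℕ) * Real.exp (lj L' j * lchi g ρ1 ρ2 (σ i)))) V (by
    intro i j
    have m1 := zpow_mem' (u := al) (v := be) (d := 1) (by simpa using al_mem) (by simpa using al_inv_mem) (z := (σ i).1 * zj j) le_rfl
    have m2 := zpow_mem' (u := (g:ℝ)) (v := (g:ℂ)) (d := g) (n := 3 * S * L') (z := (σ i).2.1 * zj j)
      (by simpa using int_mem (g * g))
      (by
        have : (g:ℂ) ≠ 0 := by exact_mod_cast a2.ne'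
        simpa [a2.ne', this] using int_mem 1)
      (by
        rw [Int.natAbs_mul]
        exact Nat.mul_le_mul (by have := abs_le.mp (hσ i).2.1; omega) (hzj' j))
    have m3 := zpow_mem' (et_mem (ρ1 := ρ1) hρ2) (et_inv_mem (ρ2 := ρ2) hρ1) (n := 3 * T' * L') (z := (σ i).2.2 * zj j)
      (by
        rw [Int.natAbs_mul]
        exact Nat.mul_le_mul (by have := abs_le.mp (hσ i).2.2; omega) (hzj' j))
    have m4 := pow_mem' (int_mem ((σ i).1 - (σ i).2.2 * k)) (j.1 : ℕ)
    have m5 := pow_mem' (int_mem ((σ i).2.1 + (σ i).2.2 * T)) (j.2.1 : ℕ)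
    have := mul_mem' (mul_mem' (mul_mem' (mul_mem' m1 m2) m3) m4) m5
    convert this using 2
    · rw [← hzj, exp_lchi hg hρ1 hρ2, mul_zpow, mul_zpow, zpow_mul, zpow_mul, zpow_mul, hCc]
      simp only [xx, yy, Nat.cast_one, one_pow]
      ring
    · simp only [V]
      rw [mul_zpow, mul_zpow, zpow_mul, zpow_mul, zpow_mul, hCc]
      simp only [xx, yy, Nat.cast_one, one_pow]
      push_cast
      ring)
  have hdet : Matrix.det (Matrix.of fun i j : Fin (20 * q) × Fin (60 * q) × Fin (2 * L' + 1) =>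
      c * (xx k (σ i) ^ (j.1 : ℕ) * yy T (σ i) ^ (j.2.1 : ℕ) * Real.exp (lj L' j * lchi g ρ1 ρ2 (σ i)))) =
      c ^ (1200 * q ^ 2 * (2 * L' + 1)) * Matrix.det (Matrix.of fun i j : Fin (20 * q) × Fin (60 * q) × Fin (2 * L' + 1) =>
      (xx k (σ i) ^ (j.1 : ℕ) * yy T (σ i) ^ (j.2.1 : ℕ) * Real.exp (lj L' j * lchi g ρ1 ρ2 (σ i)))) := by
    rw [← hcard, ← Matrix.det_smul]
    rfl
  rw [hdet] at hmem
  have hli := liouville hmem (mul_ne_zero (by positivity) hd)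
  refine hli.trans ?_
  rw [abs_mul, abs_of_pos (show 0 < c ^ (1200 * q ^ 2 * (2 * L' + 1)) by positivity)]
  gcongr
  refine (det_norm_le _ _ ?_).trans (by rw [hcard])
  intro i j
  simp only [V, Matrix.of_apply, norm_mul, norm_pow, Complex.norm_real, Real.norm_eq_abs]
  rw [abs_of_pos (show 0 < c by positivity), mul_assoc c (Real.exp _)]
  refine mul_le_mul_of_nonneg_left ?_ (show 0 ≤ c by positivity)
  have ex1 : 1 ≤ Real.exp e := Real.one_le_exp (by positivity)
  have n1 : |xx k (σ i)| ^ (j.1:ℕ) * |yy T (σ i)| ^ (j.2.1:ℕ) ≤ Real.exp (80 * q * e) := by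
    calc |xx k (σ i)| ^ (j.1:ℕ) * |yy T (σ i)| ^ (j.2.1:ℕ) ≤ Real.exp e ^ (j.1:ℕ) * Real.exp e ^ (j.2.1:ℕ) := by
          gcongr
          · exact xx_le H (hσ i)
          · exact yy_le H (hσ i)
      _ = Real.exp e ^ ((j.1:ℕ) + (j.2.1:ℕ)) := by rw [pow_add]
      _ ≤ Real.exp e ^ (80 * q) := by
          apply pow_le_pow_right₀ ex1
          have := j.1.2
          have := j.2.1.2
          omega
      _ = _ := by rw [← Real.exp_nat_mul]; push_cast; rfl
  have n2 : ‖(be ^ (σ i).1 * (g:ℂ) ^ (σ i).2.1 * etb ρ1 ρ2 ^ (σ i).2.2) ^ zj j‖ ≤ Real.exp (|lj L' j| * (2.7065 * q)) := by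
    have b1 : 0 < ‖be‖ := norm_pos_iff.mpr be_ne
    have b2 : 0 < ‖etb ρ1 ρ2‖ := norm_pos_iff.mpr (etb_ne hρ1 hρ2)
    have b3 : 0 < ‖(g:ℂ)‖ := by rw [Complex.norm_natCast]; exact a2
    rw [norm_zpow, norm_mul, norm_mul, norm_zpow, norm_zpow, norm_zpow]
    rw [← Real.log_le_iff_le_exp (by positivity), Real.log_zpow, Real.log_mul (by positivity) (by positivity),
      Real.log_mul (by positivity) (by positivity), Real.log_zpow, Real.log_zpow, Real.log_zpow, Complex.norm_natCast, hzj]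
    refine (le_abs_self _).trans ?_
    rw [abs_mul]
    gcongr
    have hb : |Real.log ‖be‖| ≤ 0.1915 := by
      rw [log_norm_be, abs_le]
      have := log_al_ub
      have := log_al_lb
      constructor <;> linarith
    refine (lin_le H (hσ i) hb (log_etb hρ1 hρ2)).trans (le_of_eq ?_)
    ring
  exact mul_le_mul n1 n2 (norm_nonneg _) (Real.exp_pos _).le

end ZE

namespace ZE
open Module Finset

variable {g ρ1 ρ2 k T q S T' L' e : ℕ}

theorem fact_le (H : LFH g ρ1 ρ2 k T q S T' L' e) :
    ((1200 * q ^ 2 * (2 * L' + 1)).factorial : ℝ) ≤ Real.exp ((1200 * q ^ 2 * (2 * L' + 1)) * q) := by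
  have hq : (30000:ℝ) ≤ q := by exact_mod_cast H.hq
  have hLq : (2 * L' + 1 : ℝ) ≤ q := by exact_mod_cast H.hLq
  have h1 : ((1200 * q ^ 2 * (2 * L' + 1) : ℕ) : ℝ) ≤ Real.exp q := by
    have h2 := Real.pow_div_factorial_le_exp (q:ℝ) (by positivity) 4
    refine le_trans ?_ h2
    rw [le_div_iff₀ (by positivity)]
    push_cast
    norm_num [Nat.factorial]
    calc (1200 * (q:ℝ) ^ 2 * (2 * L' + 1)) * (24:ℝ) ≤ (1200 * (q:ℝ) ^ 2 * q) * (24:ℝ) := by gcongr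
      _ = 28800 * (q:ℝ) ^ 3 := by ring
      _ ≤ q * (q:ℝ) ^ 3 := by gcongr; linarith
      _ = _ := by ring
  calc ((1200 * q ^ 2 * (2 * L' + 1)).factorial : ℝ) ≤ ((1200 * q ^ 2 * (2 * L' + 1) : ℕ) : ℝ) ^ (1200 * q ^ 2 * (2 * L' + 1)) := by
        exact_mod_cast Nat.factorial_le_pow _
    _ ≤ Real.exp q ^ (1200 * q ^ 2 * (2 * L' + 1)) := by gcongr
    _ = _ := by rw [← Real.exp_nat_mul]; push_cast; rfl

theorem prod_exp (q L' : ℕ) (a b : ℝ) : ∏ j : Fin (20 * q) × Fin (60 * q) × Fin (2 * L' + 1), Real.exp (a + |lj L' j| * b) =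
    Real.exp (1200 * q ^ 2 * (2 * L' + 1) * a + 1200 * q ^ 2 * (L' * (L' + 1)) * b) := by
  rw [← Real.exp_sum, sum_add_distrib, ← sum_mul, sum_lj]
  congr 2
  rw [sum_const, card_univ, nsmul_eq_mul]
  simp only [Fintype.card_prod, Fintype.card_fin]
  push_cast
  ring

theorem num_final {q e L' c D : ℝ} (hq : 30000 ≤ q) (he : 20 ≤ e) (hL : L' = 120 * e) (hlCc : c ≤ 0.6 * (q * L'))
    (U2 : D + 80 * q * (15 * q * (2 * L' + 1) * (15 * q * (2 * L' + 1) - 1) / 2) ≤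
      1200 * q ^ 2 * (2 * L' + 1) * q + (1200 * q ^ 2 * (2 * L' + 1) * (1 + 80 * q * (e + 1)) +
        1200 * q ^ 2 * (L' * (L' + 1)) * (2.7183 * (4.813 * q + 1))))
    (L2 : 0 ≤ 1200 * q ^ 2 * (2 * L' + 1) * c + D + 2 * (1200 * q ^ 2 * (2 * L' + 1) * q +
      (1200 * q ^ 2 * (2 * L' + 1) * (c + 80 * q * e) + 1200 * q ^ 2 * (L' * (L' + 1)) * (2.7065 * q)))) : False := by
  have hL0 : 0 < L' := by linarith
  have hN : (0:ℝ) < 1200 * q ^ 2 * (2 * L' + 1) := by positivity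
  have hS : 1200 * q ^ 2 * (L' * (L' + 1)) ≤ 1200 * q ^ 2 * (2 * L' + 1) * (0.501 * L') := by
    have : L' * (L' + 1) ≤ (2 * L' + 1) * (0.501 * L') := by nlinarith
    rw [mul_assoc (1200 * q ^ 2)]
    gcongr
  set N : ℝ := 1200 * q ^ 2 * (2 * L' + 1) with hNd
  set Sg : ℝ := 1200 * q ^ 2 * (L' * (L' + 1)) with hSg
  have hcoef : Sg * (2.7183 * (4.813 * q + 1) + 5.413 * q) ≤ N * (0.501 * L') * (2.7183 * (4.813 * q + 1) + 5.413 * q) := by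
    gcongr
  have hgN : (80 * q * (15 * q * (2 * L' + 1) * (15 * q * (2 * L' + 1) - 1) / 2) : ℝ) = N * ((15 * q * (2 * L' + 1) - 1) / 2) := by
    rw [hNd]; ring
  rw [hgN] at U2
  have main : N * ((15 * q * (2 * L' + 1) - 1) / 2) ≤ N * (3 * c + 3 * q + 1 + 80 * q * (e + 1) + 160 * q * e
      + (0.501 * L') * (2.7183 * (4.813 * q + 1) + 5.413 * q)) := by linarith
  have main2 := le_of_mul_le_mul_left main hN
  have p1 : (30000:ℝ) * L' ≤ q * L' := by gcongr
  have p2 : q * L' = 120 * (q * e) := by rw [hL]; ring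
  have p3 : (20:ℝ) * q ≤ q * e := by nlinarith
  nlinarith

set_option maxHeartbeats 1000000 in
theorem LF (H : LFH g ρ1 ρ2 k T q S T' L' e) :
    1 < |k * Real.log al - T * Real.log g + Real.log (et ρ1 ρ2)| * (6 * T' * L') * Real.exp (15 * q * (2 * L' + 1)) := by
  by_contra! hΛ
  set Λ := k * Real.log al - T * Real.log g + Real.log (et ρ1 ρ2) with hΛd
  obtain ⟨σ, hσ, hd⟩ := rows2 H
  have hg := H.hg
  have hq : (30000:ℝ) ≤ q := by exact_mod_cast H.hq
  have he : (20:ℝ) ≤ e := by exact_mod_cast H.he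
  have hL : (L':ℝ) = 120 * e := by exact_mod_cast H.hL
  have hE1 : (1:ℝ) ≤ Real.exp (15 * q * (2 * L' + 1)) := Real.one_le_exp (by positivity)
  have hlg : 0 < Real.log g := Real.log_pos (by exact_mod_cast hg)
  have hΛ1 : 3 * T' * |Λ| ≤ 1 := by
    have h0 : 0 ≤ |Λ| * (6 * T') := by positivity
    have : |Λ| * (6 * T') * 1 * 1 ≤ |Λ| * (6 * T') * L' * Real.exp (15 * q * (2 * L' + 1)) := by
      gcongr
      linarith
    nlinarith
  have hlb := lb_aux H hσ hd
  have hub := an_ub (J := Fin (20 * q) × Fin (60 * q) × Fin (2 * L' + 1)) (M := 80 * q) (m := 15 * q * (2 * L' + 1))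
    (by simp; ring) (by have := H.hL; have := H.he; nlinarith [H.hq]) (fun j => j.1) (fun j => j.2.1) (lj L')
    (fun j => by have := j.1.2; have := j.2.1.2; omega) (fun i => xx k (σ i)) (fun i => yy T (σ i))
    (fun i => Real.log al * xx k (σ i) + Real.log g * yy T (σ i)) (fun i => (σ i).2.2 * Λ)
    (a := Real.log al) (b := Real.log g) hlg.ne' (fun i => rfl) (B := Real.exp e) (W := 4.813 * q + 1) (E := Real.exp 1)
    (Real.one_le_exp (by norm_num)) (fun i => xx_le H (hσ i)) (fun i => yy_le H (hσ i))
    (fun i => by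
      have e1 : Real.log al * xx k (σ i) + Real.log g * yy T (σ i) =
          ((σ i).1 * Real.log al + (σ i).2.1 * Real.log g + (σ i).2.2 * Real.log (et ρ1 ρ2)) - (σ i).2.2 * Λ := by
        rw [hΛd, xx, yy]; push_cast; ring
      rw [e1]
      refine (abs_sub _ _).trans ?_
      have h1 := lin_le H (hσ i) (c := 0.383) (u := Real.log al) (by
        have := log_al_ub
        have := log_al_lb
        rw [abs_le]; constructor <;> linarith) (log_et H.hρ1 H.hρ2)
      have h2 : |((σ i).2.2:ℝ) * Λ| ≤ 3 * T' * |Λ| := by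
        rw [abs_mul]
        gcongr
        exact (abs3 (hσ i)).2.2
      linarith)
    (by positivity)
    (fun i j => by
      have h1 : |lj L' j * ((σ i).2.2 * Λ)| ≤ L' * (3 * T' * |Λ|) := by
        rw [abs_mul, abs_mul]
        gcongr
        · exact lj_abs j
        · exact (abs3 (hσ i)).2.2
      have hm : Real.exp 1 ^ (15 * q * (2 * L' + 1)) = Real.exp (15 * q * (2 * L' + 1)) := by
        rw [← Real.exp_nat_mul]; push_cast; rw [mul_one]
      have h2 : L' * (3 * T' * |Λ|) ≤ 1 := by
        have h0 : 0 ≤ |Λ| * (6 * T' * L') := by positivity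
        nlinarith
      have h3 := Real.abs_exp_sub_one_le (h1.trans h2)
      rw [hm]
      calc |Real.exp (lj L' j * ((σ i).2.2 * Λ)) - 1| * Real.exp (15 * q * (2 * L' + 1))
          ≤ (2 * (L' * (3 * T' * |Λ|))) * Real.exp (15 * q * (2 * L' + 1)) := by
            gcongr
            linarith
        _ = |Λ| * (6 * T' * L') * Real.exp (15 * q * (2 * L' + 1)) := by ring
        _ ≤ 1 := hΛ)
  have e2 : ∀ i j : Fin (20 * q) × Fin (60 * q) × Fin (2 * L' + 1),
      lj L' j * (Real.log al * xx k (σ i) + Real.log g * yy T (σ i) + (σ i).2.2 * Λ) = lj L' j * lchi g ρ1 ρ2 (σ i) := by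
    intro i j
    rw [hΛd, xx, yy, lchi]; push_cast; ring
  simp only [e2] at hub
  have hcard : Fintype.card (Fin (20 * q) × Fin (60 * q) × Fin (2 * L' + 1)) = 1200 * q ^ 2 * (2 * L' + 1) := by
    simp; ring
  rw [hcard] at hub
  set Δ := |Matrix.det (Matrix.of fun i j : Fin (20 * q) × Fin (60 * q) × Fin (2 * L' + 1) =>
        xx k (σ i) ^ (j.1 : ℕ) * yy T (σ i) ^ (j.2.1 : ℕ) * Real.exp (lj L' j * lchi g ρ1 ρ2 (σ i)))| with hΔ
  have hΔ0 : 0 < Δ := abs_pos.mpr hd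
  have hf := fact_le H
  have hgain : Real.exp (80 * q * (15 * q * (2 * L' + 1) * (15 * q * (2 * L' + 1) - 1) / 2)) ≤
      Real.exp 1 ^ (80 * q * (15 * q * (2 * L' + 1) * (15 * q * (2 * L' + 1) - 1) / 2)) := by
    rw [← Real.exp_nat_mul, mul_one]
    apply Real.exp_le_exp.mpr
    have h1 : 15 * q * (2 * L' + 1) * (15 * q * (2 * L' + 1) - 1) = 2 * (15 * q * (2 * L' + 1) * (15 * q * (2 * L' + 1) - 1) / 2) :=
      (Nat.mul_div_cancel' (Nat.even_mul_pred_self _).two_dvd).symm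
    have h2 := congrArg (Nat.cast : ℕ → ℝ) h1
    have h4 : 1 ≤ 15 * q * (2 * L' + 1) := by nlinarith [H.hq]
    rw [Nat.cast_mul, Nat.cast_mul 2, Nat.cast_sub h4] at h2
    push_cast at h2 ⊢
    apply le_of_eq
    linear_combination (40 * q : ℝ) * h2
  have hub2 : ∏ j : Fin (20 * q) × Fin (60 * q) × Fin (2 * L' + 1), (2 * (Real.exp e ^ ((j.1:ℕ) + (j.2.1:ℕ)) *
      Real.exp 1 ^ ((j.1:ℕ) + (j.2.1:ℕ)) * Real.exp (Real.exp 1 * (|lj L' j| * (4.813 * q + 1))))) ≤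
      ∏ j : Fin (20 * q) × Fin (60 * q) × Fin (2 * L' + 1), Real.exp ((1 + 80 * q * (e + 1)) + |lj L' j| * (2.7183 * (4.813 * q + 1))) := by
    apply prod_le_prod
    · intro j _; positivity
    · intro j _
      rw [Real.exp_add, Real.exp_add]
      have t1 : (2:ℝ) ≤ Real.exp 1 := by have := Real.add_one_le_exp (1:ℝ); linarith
      have t2 : Real.exp e ^ ((j.1:ℕ) + (j.2.1:ℕ)) * Real.exp 1 ^ ((j.1:ℕ) + (j.2.1:ℕ)) ≤ Real.exp (80 * q * (e + 1)) := by
        rw [← mul_pow, ← Real.exp_add, ← Real.exp_nat_mul]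
        apply Real.exp_le_exp.mpr
        have : (((j.1:ℕ) + (j.2.1:ℕ) : ℕ) : ℝ) ≤ 80 * q := by
          have := j.1.2
          have := j.2.1.2
          exact_mod_cast (by omega : (j.1:ℕ) + (j.2.1:ℕ) ≤ 80 * q)
        gcongr
      have t3 : Real.exp (Real.exp 1 * (|lj L' j| * (4.813 * q + 1))) ≤ Real.exp (|lj L' j| * (2.7183 * (4.813 * q + 1))) := by
        apply Real.exp_le_exp.mpr
        have := Real.exp_one_lt_d9.le
        calc Real.exp 1 * (|lj L' j| * (4.813 * q + 1)) ≤ 2.7183 * (|lj L' j| * (4.813 * q + 1)) := by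
              gcongr; linarith
          _ = _ := by ring
      calc _ ≤ Real.exp 1 * (Real.exp (80 * q * (e + 1)) * Real.exp (|lj L' j| * (2.7183 * (4.813 * q + 1)))) := by gcongr
        _ = _ := by ring
  rw [prod_exp] at hub2
  have hlb2 : ∏ j : Fin (20 * q) × Fin (60 * q) × Fin (2 * L' + 1),
        (Real.exp (lCc g ρ1 ρ2 S T' L') * Real.exp (80 * q * e) * Real.exp (|lj L' j| * (2.7065 * q))) =
        ∏ j : Fin (20 * q) × Fin (60 * q) × Fin (2 * L' + 1), Real.exp ((lCc g ρ1 ρ2 S T' L' + 80 * q * e) + |lj L' j| * (2.7065 * q)) := by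
    apply prod_congr rfl
    intro j _
    rw [Real.exp_add, Real.exp_add]
  rw [hlb2, prod_exp, ← Real.exp_nat_mul] at hlb
  have U := (mul_le_mul_of_nonneg_left hgain hΔ0.le).trans (hub.trans (mul_le_mul hf hub2 (prod_nonneg fun j _ => by positivity) (by positivity)))
  have Lb : 1 ≤ Real.exp (((1200 * q ^ 2 * (2 * L' + 1) : ℕ) : ℝ) * lCc g ρ1 ρ2 S T' L') * Δ * (Real.exp ((1200 * q ^ 2 * (2 * L' + 1)) * q) *
      Real.exp (1200 * q ^ 2 * (2 * L' + 1) * (lCc g ρ1 ρ2 S T' L' + 80 * q * e) + 1200 * q ^ 2 * (L' * (L' + 1)) * (2.7065 * q))) ^ 2 := by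
    refine hlb.trans ?_
    refine mul_le_mul_of_nonneg_left ?_ (by positivity)
    refine pow_le_pow_left₀ (by positivity) ?_ 2
    exact mul_le_mul_of_nonneg_right hf (Real.exp_pos _).le
  have U2 := Real.log_le_log (by positivity) U
  have L2 := Real.log_le_log (by positivity) Lb
  rw [Real.log_mul (by positivity) (by positivity), Real.log_mul (by positivity) (by positivity), Real.log_exp, Real.log_exp, Real.log_exp] at U2
  rw [Real.log_one, Real.log_mul (by positivity) (by positivity), Real.log_mul (by positivity) (by positivity), Real.log_pow,
    Real.log_mul (by positivity) (by positivity), Real.log_exp, Real.log_exp, Real.log_exp] at L2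
  have cS := H.cS
  have cT := H.cT
  have hlCc : lCc g ρ1 ρ2 S T' L' ≤ 0.6 * (q * L') := by
    unfold lCc
    have h0 : (0:ℝ) ≤ L' := by positivity
    nlinarith
  push_cast at U2 L2
  exact num_final hq he hL hlCc U2 L2

end ZE

namespace ZE

theorem log2_lb : 0.6931 ≤ Real.log 2 := by have := Real.log_two_gt_d9; linarith
theorem log2_ub : Real.log 2 ≤ 0.6932 := by have := Real.log_two_lt_d9; linarith

theorem logg_lb {g : ℕ} (hg : 2 ≤ g) : 0.6931 ≤ Real.log g :=
  log2_lb.trans (Real.log_le_log (by norm_num) (by exact_mod_cast hg))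

set_option maxHeartbeats 2000000 in
theorem LF2 {g ρ1 ρ2 k T e : ℕ} (hg : 2 ≤ g) (h1 : 0 < ρ1) (h2 : 0 < ρ2) (he : 20 ≤ e) {H : ℝ}
    (hH : Real.log (31 * ρ1 * ρ2) ≤ H) (hTk : T ≤ k) (hHk : H ≤ k)
    (hexp : 5e8 * e * Real.log g * k ≤ Real.exp e) :
    (T * Real.log g ≤ 1e7 * e * Real.log g * H) ∨
      Real.exp (-(1.6e11 * e ^ 2 * Real.log g * H)) < |k * Real.log al - T * Real.log g + Real.log (et ρ1 ρ2)| := by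
  obtain ⟨h, hh⟩ : ∃ h, h = Real.log g := ⟨_, rfl⟩
  have hlb := logg_lb hg
  rw [← hh] at hlb hexp ⊢
  have heR : (20:ℝ) ≤ e := by exact_mod_cast he
  have hHlb : 2.77 ≤ H := by
    refine le_trans ?_ hH
    have r1 : (1:ℝ) ≤ ρ1 := by exact_mod_cast h1
    have r2 : (1:ℝ) ≤ ρ2 := by exact_mod_cast h2
    have : Real.log (2 ^ 4) ≤ Real.log (31 * ρ1 * ρ2) := by
      apply Real.log_le_log (by norm_num)
      nlinarith
    rw [Real.log_pow] at this
    have := log2_lb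
    push_cast at *
    linarith
  obtain ⟨Z, hZ⟩ : ∃ Z, Z = e * h * H := ⟨_, rfl⟩
  have heh : 13.8 ≤ e * h := by nlinarith
  have hZH : 13.8 * H ≤ Z := by rw [hZ]; gcongr
  have heH : 55 ≤ e * H := by nlinarith
  have hZh : 55 * h ≤ Z := by
    calc 55 * h ≤ (e * H) * h := by gcongr
      _ = Z := by rw [hZ]; ring
  have hhH : 1.9 ≤ h * H := by nlinarith
  have hZe : 1.9 * e ≤ Z := by
    calc 1.9 * (e:ℝ) ≤ (h * H) * e := by gcongr
      _ = Z := by rw [hZ]; ring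
  have hZ38 : 38 ≤ Z := by linarith
  obtain ⟨q, hq⟩ : ∃ q, q = ⌈4.4e7 * Z⌉₊ := ⟨_, rfl⟩
  have q1 : 4.4e7 * Z ≤ q := by rw [hq]; exact Nat.le_ceil _
  have q2 : (q:ℝ) ≤ 4.401e7 * Z := by
    have : (q:ℝ) < 4.4e7 * Z + 1 := by rw [hq]; exact Nat.ceil_lt_add_one (by positivity)
    linarith
  have h0 : 0 < h := by linarith
  have H0 : 0 < H := by linarith
  obtain ⟨S, hS⟩ : ∃ S, S = ⌊0.1 * q / h⌋₊ := ⟨_, rfl⟩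
  obtain ⟨T', hT'⟩ : ∃ T', T' = ⌊0.1 * q / H⌋₊ := ⟨_, rfl⟩
  have S1 : (S:ℝ) * h ≤ 0.1 * q := by
    rw [← le_div_iff₀ h0, hS]; exact Nat.floor_le (by positivity)
  have S2 : 0.0999 * q ≤ S * h := by
    have : 0.1 * q / h < S + 1 := by rw [hS]; exact Nat.lt_floor_add_one _
    rw [div_lt_iff₀ h0] at this
    linarith
  have T1 : (T':ℝ) * H ≤ 0.1 * q := by
    rw [← le_div_iff₀ H0, hT']; exact Nat.floor_le (by positivity)
  have T2 : 0.0999 * q ≤ T' * H := by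
    have : 0.1 * q / H < T' + 1 := by rw [hT']; exact Nat.lt_floor_add_one _
    rw [div_lt_iff₀ H0] at this
    linarith
  have q0 : (0:ℝ) < q := by linarith
  have T3 : (T':ℝ) ≤ 4.401e6 * (e * h) := by
    have : (T':ℝ) * H ≤ 4.401e6 * (e * h) * H := by
      calc (T':ℝ) * H ≤ 4.401e6 * Z := by linarith
        _ = _ := by rw [hZ]; ring
    exact le_of_mul_le_mul_right this H0
  by_cases c3 : 2 * S ≤ T
  · right
    have hLFH : LFH g ρ1 ρ2 k T q S T' (120 * e) e := by
      have cx : (11 * q + 3 * T' * k : ℝ) ≤ Real.exp e := by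
        refine le_trans ?_ hexp
        have a1 : 11 * (q:ℝ) ≤ 4.85e8 * (e * h) * k := by
          calc 11 * (q:ℝ) ≤ 4.85e8 * Z := by linarith
            _ = 4.85e8 * (e * h) * H := by rw [hZ]; ring
            _ ≤ _ := by gcongr
        have a2 : 3 * (T':ℝ) * k ≤ 3 * (4.401e6 * (e * h)) * k := by gcongr
        have a3 : 0 ≤ e * h * (k:ℝ) := by positivity
        linarith
      refine ⟨hg, h1, h2, ?_, he, rfl, ?_, ?_, c3, ?_, ?_, cx, ?_⟩
      · exact_mod_cast (by linarith : (30000:ℝ) ≤ q)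
      · exact_mod_cast (by linarith : 2 * (120 * (e:ℝ)) + 1 ≤ q)
      · have : 1800 * q * (2 * (120 * e) + 1) < (S:ℝ) * T' := by
          have b0 : 0 < h * H := by positivity
          refine lt_of_mul_lt_mul_right ?_ b0.le
          calc 1800 * q * (2 * (120 * e) + 1) * (h * H) ≤ 1800 * q * (240.05 * e) * (h * H) := by
                gcongr
                linarith
            _ = 432090 * (q * Z) := by rw [hZ]; ring
            _ < 0.00998 * (q * (4.4e7 * Z)) := by nlinarith
            _ ≤ 0.00998 * (q * q) := by gcongr
            _ ≤ (0.0999 * q) * (0.0999 * q) := by nlinarith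
            _ ≤ (S * h) * (T' * H) := by gcongr
            _ = _ := by ring
        exact_mod_cast this
      · rw [← hh]; exact S1
      · refine le_trans ?_ T1; gcongr
      · refine le_trans ?_ cx
        have a1 : 3 * (S:ℝ) ≤ 11 * q := by nlinarith
        have a2 : (T:ℝ) ≤ k := by exact_mod_cast hTk
        gcongr
    have hl := LF hLFH
    rw [← hh] at hl
    have hb : (6 * T' * (120 * e : ℕ) : ℝ) * Real.exp (15 * q * (2 * (120 * e : ℕ) + 1)) ≤ Real.exp (1.6e11 * e ^ 2 * h * H) := by
      have c1 : (6 * T' * (120 * e : ℕ) : ℝ) ≤ Real.exp (6 * T' * (120 * e : ℕ)) := by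
        have := Real.add_one_le_exp (6 * T' * (120 * e : ℕ) : ℝ)
        linarith
      calc _ ≤ Real.exp (6 * T' * (120 * e : ℕ)) * Real.exp (15 * q * (2 * (120 * e : ℕ) + 1)) := by gcongr
        _ = Real.exp (6 * T' * (120 * e : ℕ) + 15 * q * (2 * (120 * e : ℕ) + 1)) := by rw [Real.exp_add]
        _ ≤ _ := by
          apply Real.exp_le_exp.mpr
          push_cast
          have d1 : 6 * (T':ℝ) * (120 * e) ≤ 1.2e9 * (e * Z) := by
            calc 6 * (T':ℝ) * (120 * e) ≤ 6 * (4.401e6 * (e * h)) * (120 * e) := by gcongr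
              _ = 3.16872e9 * (e * (e * h)) * 1 := by ring
              _ ≤ 3.16872e9 * (e * (e * h)) * (H / 2.77) := by
                gcongr
                rw [le_div_iff₀ (by norm_num)]; linarith
              _ = (3.16872e9 / 2.77) * (e * Z) := by rw [hZ]; ring
              _ ≤ _ := by gcongr; norm_num
          have d2 : 15 * (q:ℝ) * (2 * (120 * e) + 1) ≤ 1.585e11 * (e * Z) := by
            calc 15 * (q:ℝ) * (2 * (120 * e) + 1) ≤ 15 * (4.401e7 * Z) * (240.05 * e) := by
                  gcongr
                  linarith
              _ = (15 * 4.401e7 * 240.05) * (e * Z) := by ring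
              _ ≤ _ := by gcongr; norm_num
          have d3 : 1.6e11 * (e:ℝ) ^ 2 * h * H = 1.6e11 * (e * Z) := by rw [hZ]; ring
          have d4 : 0 ≤ e * Z := by positivity
          rw [d3]
          linarith
    rw [mul_assoc] at hl
    have hl2 : 1 < |k * Real.log al - T * h + Real.log (et ρ1 ρ2)| * Real.exp (1.6e11 * e ^ 2 * h * H) :=
      hl.trans_le (by gcongr)
    rw [Real.exp_neg]
    rwa [inv_lt_iff_one_lt_mul₀ (Real.exp_pos _)]
  · left
    have : (T:ℝ) ≤ 2 * S := by exact_mod_cast (by omega : T ≤ 2 * S)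
    calc T * h ≤ 2 * S * h := by gcongr
      _ ≤ 1e7 * Z := by linarith
      _ = _ := by rw [hZ]; ring

end ZE

namespace ZE

theorem binet_aux (k : ℕ) : (narayana k : ℝ) = al ^ k / (3 * al - 2) + 2 * (be ^ k * (9 * be ^ 2 - 3 * be - 2)).re / 31
    ∧ (narayana (k+1) : ℝ) = al ^ (k+1) / (3 * al - 2) + 2 * (be ^ (k+1) * (9 * be ^ 2 - 3 * be - 2)).re / 31
    ∧ (narayana (k+2) : ℝ) = al ^ (k+2) / (3 * al - 2) + 2 * (be ^ (k+2) * (9 * be ^ 2 - 3 * be - 2)).re / 31 := by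
  induction k with
  | zero =>
    have hc : (3 * al - 2)⁻¹ = (9 * al ^ 2 - 3 * al - 2) / 31 := by
      have := ga_lb
      have h0 : (3 * al - 2) ≠ 0 := by linarith
      rw [inv_eq_iff_eq_inv, inv_div, eq_div_iff]
      · exact ga_prod
      · intro h
        have := ga_prod
        rw [h] at this; norm_num at this
    have e0 : (be ^ 0 * (9 * be ^ 2 - 3 * be - 2)) = ((9 * (1 - al) - 3 : ℝ):ℂ) * be + ((-9 * al * (al - 1) - 2:ℝ):ℂ) := by
      rw [be_quad]; push_cast; ring
    have e1 : (be ^ 1 * (9 * be ^ 2 - 3 * be - 2)) = ((6 * (1 - al) - 2 : ℝ):ℂ) * be + ((-6 * al * (al - 1) + 9:ℝ):ℂ) := by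
      push_cast
      linear_combination 9 * be_cube + 6 * be_quad
    have e2 : (be ^ 2 * (9 * be ^ 2 - 3 * be - 2)) = ((4 * (1 - al) + 9 : ℝ):ℂ) * be + ((-4 * al * (al - 1) + 6:ℝ):ℂ) := by
      push_cast
      linear_combination (9 * be + 6) * be_cube + 4 * be_quad
    simp only [zero_add]
    rw [e0, e1, e2]
    simp only [Complex.add_re, Complex.re_ofReal_mul, Complex.ofReal_re, be_re, div_eq_mul_inv, hc, narayana]
    have := al_cube
    refine ⟨?_, ?_, ?_⟩
    · push_cast; linear_combination 0 * al_cube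
    · push_cast; linear_combination -9/31 * al_cube
    · push_cast; linear_combination (-9 * al / 31 - 6 / 31) * al_cube
  | succ k ih =>
    refine ⟨ih.2.1, ih.2.2, ?_⟩
    have e : be ^ (k+1+2) * (9 * be ^ 2 - 3 * be - 2) = be ^ (k+2) * (9 * be ^ 2 - 3 * be - 2) + be ^ k * (9 * be ^ 2 - 3 * be - 2) := by
      linear_combination be ^ k * (9 * be ^ 2 - 3 * be - 2) * be_cube
    have e' : al ^ (k+1+2) = al ^ (k+2) + al ^ k := by
      linear_combination al ^ k * al_cube
    rw [e, e', show narayana (k+1+2) = narayana (k+2) + narayana k from rfl, Complex.add_re]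
    push_cast
    rw [ih.1, ih.2.2]
    ring

theorem binet (k : ℕ) : |(narayana k : ℝ) - al ^ k / (3 * al - 2)| ≤ 0.56 := by
  rw [(binet_aux k).1, add_sub_cancel_left]
  have hb : ‖be‖ ≤ 1 := by
    have := norm_be_sq
    have h1 : al⁻¹ ≤ 1 := inv_le_one_of_one_le₀ (by have := al_lb; linarith)
    nlinarith [norm_nonneg be]
  have h3 : ‖3 * be - 2‖ * ‖9 * be ^ 2 - 3 * be - 2‖ = 31 := by
    rw [← norm_mul, gb_prod]; simp
  have h4 : 3.58 ≤ ‖3 * be - 2‖ := by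
    by_contra! h
    have h5 := gb_norm
    have h6 := ga_ub
    have : ‖3 * be - 2‖ ^ 2 ≤ 3.58 ^ 2 := by gcongr
    nlinarith [ga_lb]
  have h7 : ‖9 * be ^ 2 - 3 * be - 2‖ ≤ 31 / 3.58 := by
    rw [le_div_iff₀ (by norm_num), ← h3, mul_comm]
    gcongr
  have h8 : |(be ^ k * (9 * be ^ 2 - 3 * be - 2)).re| ≤ 31 / 3.58 := by
    refine (Complex.abs_re_le_norm _).trans ?_
    rw [norm_mul, norm_pow]
    have : ‖be‖ ^ k ≤ 1 := pow_le_one₀ (norm_nonneg _) hb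
    calc _ ≤ 1 * ‖9 * be ^ 2 - 3 * be - 2‖ := by gcongr
      _ ≤ _ := by rwa [one_mul]
  rw [abs_div, abs_mul]
  norm_num at h8 ⊢
  linarith

theorem nar_le (k : ℕ) : (narayana k : ℝ) ≤ al ^ k ∧ (narayana (k+1) : ℝ) ≤ al ^ (k+1) ∧ (narayana (k+2) : ℝ) ≤ al ^ (k+2) := by
  have := al_lb
  induction k with
  | zero => refine ⟨by simp [narayana], by simp [narayana]; linarith, by rw [show narayana (0+2) = 1 from rfl]; push_cast; nlinarith⟩
  | succ k ih =>
    refine ⟨ih.2.1, ih.2.2, ?_⟩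
    have e' : al ^ (k+1+2) = al ^ (k+2) + al ^ k := by
      linear_combination al ^ k * al_cube
    rw [e', show narayana (k+1+2) = narayana (k+2) + narayana k from rfl]
    push_cast
    linarith [ih.1, ih.2.2]

theorem step {g k D P R T l e : ℕ} (hg : 2 ≤ g) (hD : 0 < D) (hP : 0 < P)
    (heq : narayana k * (g-1)^4 = D * P * R)
    (hR : |(R:ℝ) / (g:ℝ) ^ T - 1| ≤ 4 / (g:ℝ) ^ l)
    (hDP : (g-1)^4 * g^l ≤ g * (D * P * g^T))
    (hTk : T ≤ k) (hlT : l ≤ T) (he : 20 ≤ e) {H : ℝ} (hH : Real.log (31 * ((g-1)^4 : ℕ) * (D * P : ℕ)) ≤ H)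
    (hHk : H ≤ k) (hHh : 5 * Real.log g ≤ H)
    (hexp : 5e8 * e * Real.log g * k ≤ Real.exp e) :
    l * Real.log g ≤ 1.601e11 * e ^ 2 * Real.log g * H := by
  have hlb := logg_lb hg
  have h1 : 0 < (g-1)^4 := by have : 0 < g - 1 := by omega
                              positivity
  have h2 : 0 < D * P := by positivity
  have heR : (20:ℝ) ≤ e := by exact_mod_cast he
  have hgR : (2:ℝ) ≤ g := by exact_mod_cast hg
  have hg0 : (0:ℝ) < g := by linarith
  have hL := LF2 hg h1 h2 he hH hTk hHk hexp
  obtain ⟨ρ, hρ⟩ : ∃ ρ, ρ = (g-1)^4 := ⟨_, rfl⟩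
  obtain ⟨σ, hσ⟩ : ∃ σ, σ = D * P := ⟨_, rfl⟩
  rw [← hρ] at heq hDP h1 hL
  rw [← hσ] at heq hDP h2 hL
  clear hH
  have H0 : 3.4 ≤ H := by linarith
  have hV : 20 ^ 2 * 0.6931 * H ≤ e ^ 2 * Real.log g * H := by gcongr
  rcases hL with hL | hL
  · have : (l:ℝ) * Real.log g ≤ T * Real.log g := by gcongr
    have h3 : (1:ℝ) * (e * Real.log g * H) ≤ e * (e * Real.log g * H) := by gcongr; linarith
    have h4 : 0 ≤ e * (e * Real.log g * H) := by positivity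
    nlinarith
  have hρR : (0:ℝ) < ρ := by exact_mod_cast h1
  have hσR : (0:ℝ) < σ := by exact_mod_cast h2
  have hga := ga_lb
  have hga0 : 0 < 3 * al - 2 := by linarith
  have hX : Real.exp (k * Real.log al - T * Real.log g + Real.log (et ρ σ)) = et ρ σ * al ^ k / g ^ T := by
    rw [Real.exp_add, Real.exp_sub, Real.exp_log (et_pos h1 h2), ← Real.log_pow, ← Real.log_pow, Real.exp_log (pow_pos al_pos _),
      Real.exp_log (by positivity)]
    ring
  obtain ⟨Λ, hΛ⟩ : ∃ Λ, Λ = k * Real.log al - T * Real.log g + Real.log (et ρ σ) := ⟨_, rfl⟩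
  rw [← hΛ] at hX hL
  have hε : |Real.exp Λ - 1| ≤ 2.56 * g / g ^ l := by
    have hb := binet k
    have heqR : (narayana k : ℝ) * ρ = σ * R := by exact_mod_cast heq
    have hE : Real.exp Λ - 1 = (R / (g:ℝ)^T - 1) - (narayana k - al ^ k / (3 * al - 2)) * (ρ / (σ * g ^ T)) := by
      have hR' : (R:ℝ) = narayana k * ρ / σ := by
        rw [eq_div_iff hσR.ne']; linarith
      have q1 : et ρ σ * al ^ k / (g:ℝ) ^ T = (al ^ k / (3 * al - 2)) * (ρ / (σ * g ^ T)) := by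
        rw [et]
        generalize 3 * al - 2 = γ
        rw [div_mul_eq_mul_div, div_div, div_mul_div_comm]
        congr 1 <;> ring
      have q2 : (R:ℝ) / (g:ℝ) ^ T = narayana k * (ρ / (σ * g ^ T)) := by
        rw [hR', div_div, mul_div_assoc]
      rw [hX, q1, q2]
      ring
    have hDPR : (ρ:ℝ) * g ^ l ≤ g * (σ * g ^ T) := by exact_mod_cast hDP
    have h5 : (ρ:ℝ) / (σ * g ^ T) ≤ g / g ^ l := by
      rw [div_le_div_iff₀ (by positivity) (by positivity)]; exact hDPR
    rw [hE]
    refine (abs_sub _ _).trans ?_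
    rw [abs_mul, abs_of_nonneg (a := (ρ:ℝ) / (σ * g ^ T)) (by positivity)]
    calc _ ≤ 4 / (g:ℝ)^l + 0.56 * (g / g ^ l) := by gcongr
      _ ≤ 2 * g / g ^ l + 0.56 * (g / g ^ l) := by gcongr; linarith
      _ = _ := by ring
  have hlog3 : Real.log 6 ≤ 2.1 := by
    have : Real.log 6 ≤ Real.log (2^3) := Real.log_le_log (by norm_num) (by norm_num)
    rw [Real.log_pow] at this
    have := log2_ub
    push_cast at *; linarith
  by_cases hs : |Real.exp Λ - 1| ≤ 1/2
  · have hΛ2 : |Λ| ≤ 2 * |Real.exp Λ - 1| := by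
      obtain ⟨x, hx⟩ : ∃ x, x = Real.exp Λ := ⟨_, rfl⟩
      have hxΛ : Λ = Real.log x := by rw [hx, Real.log_exp]
      rw [← hx] at hs ⊢
      have hx0 : 0 < x := by rw [hx]; exact Real.exp_pos _
      rw [abs_le] at hs
      have u1 := Real.log_le_sub_one_of_pos hx0
      have u2 := Real.one_sub_inv_le_log_of_pos hx0
      rw [hxΛ, abs_le]
      have u3 : x⁻¹ ≤ 2 := by
        rw [inv_le_comm₀ hx0 (by norm_num)]; linarith
      have u4 : 1 - x⁻¹ = (x - 1) * x⁻¹ := by field_simp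
      have u5 : 0 < x⁻¹ := by positivity
      have u6 := abs_nonneg (x-1)
      have u7 := le_abs_self (x-1)
      have u8 := neg_abs_le (x-1)
      constructor
      · rw [u4] at u2
        have : - |x - 1| * x⁻¹ ≤ (x-1) * x⁻¹ := by gcongr
        nlinarith
      · linarith
    have h6 : Real.exp (-(1.6e11 * e ^ 2 * Real.log g * H)) < 6 * (g / g^l) := by
      refine hL.trans_le (hΛ2.trans ?_)
      have : 0 ≤ (g:ℝ) / g ^ l := by positivity
      calc _ ≤ 2 * (2.56 * (g:ℝ) / g ^ l) := by gcongr
        _ = 5.12 * ((g:ℝ) / g^l) := by ring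
        _ ≤ _ := by nlinarith
    rw [← Real.lt_log_iff_exp_lt (by positivity), Real.log_mul (by norm_num) (by positivity), Real.log_div (by positivity) (by positivity), Real.log_pow] at h6
    linarith
  · rw [not_le] at hs
    have h7 := hs.le.trans hε
    have h8 : (g:ℝ)^l ≤ 6 * g := by
      rw [le_div_iff₀ (by positivity)] at h7
      linarith
    have h9 := Real.log_le_log (by positivity) h8
    rw [Real.log_pow, Real.log_mul (by norm_num) (by positivity)] at h9
    linarith

end ZE

namespace ZE

theorem num_contra {t k h : ℝ} (hh : 0.6931 ≤ h) (ht : 2.11e67 * h ^ 12 ≤ t)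
    (hk1 : t * h ≤ k) (hk2 : 0.36 * k ≤ 4 * t * h + 1.387)
    (hc : ∀ e : ℕ, 20 ≤ e → 5e8 * e * h * k ≤ Real.exp e → t * h ≤ (1.602e11 * e ^ 2 * h) ^ 4 * (13 * h)) : False := by
  have h0 : 0 < h := by linarith
  have t0 : 0 < t := lt_of_lt_of_le (by positivity) ht
  have k0 : 0 < k := lt_of_lt_of_le (by positivity) hk1
  have l2 := log2_lb
  have l2' := log2_ub
  obtain ⟨τ, hτ⟩ : ∃ τ, τ = Real.log t := ⟨_, rfl⟩
  obtain ⟨η, hη⟩ : ∃ η, η = Real.log h := ⟨_, rfl⟩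
  obtain ⟨κ, hκ⟩ : ∃ κ, κ = Real.log k := ⟨_, rfl⟩
  have η1 : -0.4428 ≤ η := by
    have := Real.one_sub_inv_le_log_of_pos h0
    rw [← hη] at this
    have h3 : h⁻¹ ≤ 0.6931⁻¹ := by gcongr
    norm_num at h3
    linarith
  have τ1 : 154.56 + 12 * η ≤ τ := by
    have h1 : (2:ℝ) ^ 223 * h ^ 12 ≤ t := le_trans (by gcongr; norm_num) ht
    have := Real.log_le_log (by positivity) h1
    rw [Real.log_mul (by positivity) (by positivity), Real.log_pow, Real.log_pow, ← hη, ← hτ] at this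
    push_cast at this
    linarith
  have κ1 : τ + η ≤ κ := by
    have := Real.log_le_log (by positivity) hk1
    rw [Real.log_mul (by positivity) (by positivity)] at this
    rw [hτ, hη, hκ]; exact this
  have th10 : 10 ≤ t * h := by
    have h1 : (1:ℝ) ≤ τ + η := by linarith
    by_contra! h2
    have h3 := Real.log_le_log (by positivity) (h2.le.trans (show (10:ℝ) ≤ 2^4 by norm_num))
    rw [Real.log_mul (by positivity) (by positivity), Real.log_pow, ← hη, ← hτ] at h3
    push_cast at h3
    linarith
  have κ2 : κ ≤ 2.773 + τ + η := by
    have h1 : k ≤ 2 ^ 4 * (t * h) := by linarith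
    have := Real.log_le_log k0 h1
    rw [Real.log_mul (by positivity) (by positivity), Real.log_mul (by positivity) (by positivity), Real.log_pow, ← hη, ← hτ, ← hκ] at this
    push_cast at this
    linarith
  have κ0 : 0 ≤ κ := by linarith
  obtain ⟨e, he⟩ : ∃ e : ℕ, e = ⌈1.2 * κ⌉₊ + 1 := ⟨_, rfl⟩
  have e1 : 1.2 * κ + 1 ≤ e := by
    rw [he]; push_cast
    have := Nat.le_ceil (1.2 * κ)
    linarith
  have e2 : e ≤ 1.2 * κ + 2 := by
    rw [he]; push_cast
    have := Nat.ceil_lt_add_one (a := 1.2 * κ) (by positivity)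
    linarith
  have e20 : (20:ℝ) ≤ e := by linarith
  have e0 : (0:ℝ) < e := by linarith
  have le : Real.log e ≤ e / 256 + 4.5456 := by
    have h1 := Real.log_le_sub_one_of_pos (x := (e:ℝ) / 2 ^ 8) (by positivity)
    rw [Real.log_div (by positivity) (by positivity), Real.log_pow] at h1
    push_cast at h1
    norm_num at h1
    linarith
  have hexp : 5e8 * e * h * k ≤ Real.exp e := by
    rw [← Real.log_le_iff_le_exp (by positivity)]
    have h1 : 5e8 * e * h * k ≤ 2 ^ 29 * e * h * k := by gcongr; norm_num
    refine (Real.log_le_log (by positivity) h1).trans ?_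
    rw [Real.log_mul (by positivity) (by positivity), Real.log_mul (by positivity) (by positivity), Real.log_mul (by positivity) (by positivity), Real.log_pow, ← hη, ← hκ]
    push_cast
    linarith
  have h2 := hc e (by exact_mod_cast e20) hexp
  have h3 : t ≤ 2 ^ 153 * e ^ 8 * h ^ 4 := by
    have h4 : t * h ≤ (2 ^ 153 * e ^ 8 * h ^ 4) * h := by
      refine h2.trans ?_
      have : 0 ≤ (e:ℝ) ^ 8 * h ^ 5 := by positivity
      calc _ = (1.602e11 ^ 4 * 13) * ((e:ℝ) ^ 8 * h ^ 5) := by ring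
        _ ≤ 2 ^ 153 * ((e:ℝ) ^ 8 * h ^ 5) := by gcongr; norm_num
        _ = _ := by ring
    exact le_of_mul_le_mul_right h4 h0
  have h5 := Real.log_le_log t0 h3
  rw [Real.log_mul (by positivity) (by positivity), Real.log_mul (by positivity) (by positivity), Real.log_pow, Real.log_pow, Real.log_pow, ← hη, ← hτ] at h5
  push_cast at h5
  linarith

theorem pw_cast {g : ℕ} (hg : 2 ≤ g) (l : ℕ) : ((g ^ l - 1 : ℕ) : ℝ) = (g:ℝ)^l - 1 := by
  rw [Nat.cast_sub (Nat.one_le_pow _ _ (by omega))]; push_cast; rfl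

theorem four {a b c d δ : ℝ} (ha : 0 ≤ a) (hb : 0 ≤ b) (hc : 0 ≤ c) (hd : 0 ≤ d)
    (ha' : a ≤ δ) (hb' : b ≤ δ) (hc' : c ≤ δ) (hd' : d ≤ δ) (h1 : δ ≤ 1) :
    |(1 - a) * (1 - b) * (1 - c) * (1 - d) - 1| ≤ 4 * δ := by
  have x2 : 0 ≤ (1-a)*(1-b) := mul_nonneg (by linarith) (by linarith)
  have y2 : 1 - 2 * δ ≤ (1-a)*(1-b) := by nlinarith [mul_nonneg ha hb]
  have z2 : (1-a)*(1-b) ≤ 1 := by nlinarith [mul_nonneg ha hb]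
  have x3 : 0 ≤ (1-a)*(1-b)*(1-c) := mul_nonneg x2 (by linarith)
  have y3 : 1 - 3 * δ ≤ (1-a)*(1-b)*(1-c) := by nlinarith
  have z3 : (1-a)*(1-b)*(1-c) ≤ 1 := by nlinarith
  rw [abs_le]
  constructor <;> nlinarith

theorem low {g l : ℕ} (hg : 2 ≤ g) (hl : 1 ≤ l) : (g-1) * g ^ l ≤ g * (g ^ l - 1) := by
  have h1 : g ^ 1 ≤ g ^ l := Nat.pow_le_pow_right (by omega) hl
  rw [Nat.mul_sub, Nat.sub_mul]
  simp at h1 ⊢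
  omega

theorem size {g k d₁ d₂ d₃ d₄ l m n t : ℕ} (hg : 2 ≤ g) (hs : IsSolution g k d₁ d₂ d₃ d₄ l m n t) :
    ((l + m + n + t : ℕ) : ℝ) * Real.log g ≤ 0.383 * k + 4 * Real.log g ∧
    0.36 * k ≤ ((l + m + n + t : ℕ) : ℝ) * Real.log g + 1.387 := by
  obtain ⟨hk, a1, b1, a2, b2, a3, b3, a4, b4, hl, hm, hn, ht, heq⟩ := hs
  have hg0 : 0 < g := by omega
  have hgR : (0:ℝ) < g := by exact_mod_cast hg0
  have hg1 : 0 < (g - 1) ^ 4 := by have : 0 < g - 1 := by omega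
                                   positivity
  have L : g ^ (l + m + n + t) ≤ g ^ 4 * narayana k := by
    refine le_of_mul_le_mul_left ?_ hg1
    calc (g-1)^4 * g ^ (l+m+n+t) = 1 * 1 * 1 * 1 * (((g-1) * g ^ l) * ((g-1) * g ^ m) * ((g-1) * g ^ n) * ((g-1) * g ^ t)) := by ring
      _ ≤ d₁ * d₂ * d₃ * d₄ * ((g * (g ^ l - 1)) * (g * (g ^ m - 1)) * (g * (g ^ n - 1)) * (g * (g ^ t - 1))) := by
        have := low hg hl
        have := low hg (hl.trans hm)
        have := low hg ((hl.trans hm).trans hn)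
        have := low hg (((hl.trans hm).trans hn).trans ht)
        gcongr
      _ = g ^ 4 * (d₁ * d₂ * d₃ * d₄ * (g ^ l - 1) * (g ^ m - 1) * (g ^ n - 1) * (g ^ t - 1)) := by ring
      _ = (g-1)^4 * (g ^ 4 * narayana k) := by rw [← heq]; ring
  have U : narayana k ≤ g ^ (l + m + n + t) := by
    refine le_of_mul_le_mul_left ?_ hg1
    calc (g-1)^4 * narayana k = d₁ * d₂ * d₃ * d₄ * (g ^ l - 1) * (g ^ m - 1) * (g ^ n - 1) * (g ^ t - 1) := by rw [← heq]; ring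
      _ ≤ (g-1) * (g-1) * (g-1) * (g-1) * g ^ l * g ^ m * g ^ n * g ^ t := by
        gcongr <;> exact Nat.sub_le _ _
      _ = (g-1)^4 * g ^ (l + m + n + t) := by ring
  have LR : (g:ℝ) ^ (l + m + n + t) ≤ g ^ 4 * narayana k := by exact_mod_cast L
  have UR : (narayana k : ℝ) ≤ g ^ (l + m + n + t) := by exact_mod_cast U
  have hap := al_pos
  constructor
  · have h1 := LR.trans (mul_le_mul_of_nonneg_left (nar_le k).1 (by positivity))
    have h2 := Real.log_le_log (by positivity) h1
    rw [Real.log_mul (by positivity) (by positivity), Real.log_pow, Real.log_pow, Real.log_pow] at h2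
    have h3 : (k:ℝ) * Real.log al ≤ k * 0.383 := by gcongr; exact log_al_ub
    push_cast at h2 ⊢
    linarith
  · have hb := (abs_le.mp (binet k)).1
    have hga := ga_lb
    have hga' := ga_ub
    have hg1R : (1:ℝ) ≤ g ^ (l+m+n+t) := one_le_pow₀ (by exact_mod_cast hg0)
    have h1 : al ^ k / (3 * al - 2) ≤ 1.56 * g ^ (l+m+n+t) := by linarith
    rw [div_le_iff₀ (by linarith)] at h1
    have h2 : al ^ k ≤ 2 ^ 2 * g ^ (l+m+n+t) := by nlinarith
    have h3 := Real.log_le_log (by positivity) h2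
    rw [Real.log_mul (by positivity) (by positivity), Real.log_pow, Real.log_pow, Real.log_pow] at h3
    have h4 : (k:ℝ) * 0.36 ≤ k * Real.log al := by gcongr; exact log_al_lb
    have := log2_ub
    push_cast at h3 ⊢
    linarith

end ZE

namespace ZE

theorem prodR {g : ℕ} (hg : 2 ≤ g) (a b c d x : ℕ) (ha : x ≤ a) (hb : x ≤ b) (hc : x ≤ c) (hd : x ≤ d) :
    |((g ^ a - 1) * (g ^ b - 1) * (g ^ c - 1) * (g ^ d - 1) : ℝ) / (g:ℝ) ^ (a + b + c + d) - 1| ≤ 4 / (g:ℝ) ^ x ∧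
    |((g ^ b - 1) * (g ^ c - 1) * (g ^ d - 1) : ℝ) / (g:ℝ) ^ (b + c + d) - 1| ≤ 4 / (g:ℝ) ^ x ∧
    |((g ^ c - 1) * (g ^ d - 1) : ℝ) / (g:ℝ) ^ (c + d) - 1| ≤ 4 / (g:ℝ) ^ x ∧
    |((g ^ d - 1) : ℝ) / (g:ℝ) ^ d - 1| ≤ 4 / (g:ℝ) ^ x := by
  have hgR : (1:ℝ) ≤ g := by exact_mod_cast (by omega : 1 ≤ g)
  have hg0 : (0:ℝ) < g := by linarith
  have key : ∀ y, x ≤ y → (1:ℝ) / g ^ y ≤ 1 / g ^ x := fun y hy => by gcongr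
  have k1 : (1:ℝ) / g ^ x ≤ 1 := by
    rw [div_le_one (by positivity)]; exact one_le_pow₀ hgR
  have p : ∀ y : ℕ, (0:ℝ) ≤ 1 / g ^ y := fun y => by positivity
  have q : ∀ y : ℕ, ((g:ℝ) ^ y - 1) / g ^ y = 1 - 1 / g ^ y := fun y => by field_simp
  have e4 : (4:ℝ) / g ^ x = 4 * (1 / g ^ x) := by ring
  rw [e4]
  refine ⟨?_, ?_, ?_, ?_⟩
  · have := four (p a) (p b) (p c) (p d) (key a ha) (key b hb) (key c hc) (key d hd) k1
    rwa [← q, ← q, ← q, ← q, div_mul_div_comm, div_mul_div_comm, div_mul_div_comm, ← pow_add, ← pow_add, ← pow_add] at this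
  · have := four (p b) (p c) (p d) le_rfl (key b hb) (key c hc) (key d hd) (p x) k1
    rwa [← q, ← q, ← q, div_mul_div_comm, div_mul_div_comm, ← pow_add, ← pow_add, sub_zero, mul_one] at this
  · have := four (p c) (p d) le_rfl le_rfl (key c hc) (key d hd) (p x) (p x) k1
    rwa [← q, ← q, div_mul_div_comm, ← pow_add, sub_zero, mul_one, mul_one] at this
  · have := four (p d) le_rfl le_rfl le_rfl (key d hd) (p x) (p x) (p x) k1
    rwa [← q, sub_zero, mul_one, mul_one, mul_one] at this

theorem logH {g D P s : ℕ} (hg : 2 ≤ g) (hD : 0 < D) (hP : 0 < P) (hD' : D ≤ g ^ 4) (hP' : P ≤ g ^ s) :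
    Real.log (31 * ((g-1)^4 : ℕ) * (D * P : ℕ)) ≤ (13 + s) * Real.log g := by
  have h1 : 31 * (g-1)^4 * (D * P) ≤ g ^ (13 + s) := by
    have h31 : 31 ≤ g ^ 5 := le_trans (by norm_num) (Nat.pow_le_pow_left hg 5)
    calc 31 * (g-1)^4 * (D * P) ≤ g ^ 5 * g ^ 4 * (g ^ 4 * g ^ s) := by
          gcongr; omega
      _ = _ := by ring
  have h2 : (31 * ((g-1)^4 : ℕ) * (D * P : ℕ) : ℝ) ≤ (g:ℝ) ^ (13 + s) := by exact_mod_cast h1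
  have h0 : 0 < (g-1)^4 := by have : 0 < g - 1 := by omega
                              positivity
  have h3 := Real.log_le_log (by positivity) h2
  rw [Real.log_pow] at h3
  push_cast at h3 ⊢
  exact h3

set_option maxHeartbeats 1000000 in
theorem chain {g k d₁ d₂ d₃ d₄ l m n t : ℕ} (hg : 2 ≤ g) (hs : IsSolution g k d₁ d₂ d₃ d₄ l m n t)
    (ht20 : 20 ≤ t) (e : ℕ) (he : 20 ≤ e) (hexp : 5e8 * e * Real.log g * k ≤ Real.exp e) :
    t * Real.log g ≤ (1.602e11 * e ^ 2 * Real.log g) ^ 4 * (13 * Real.log g) := by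
  have hsz := (size hg hs).1
  obtain ⟨hk, a1, b1, a2, b2, a3, b3, a4, b4, hl, hm, hn, ht, heq⟩ := hs
  have hlb := logg_lb hg
  have hm1 := hl.trans hm
  have hn1 := hm1.trans hn
  have ht1 := hn1.trans ht
  have ht20R : (20:ℝ) ≤ t := by exact_mod_cast ht20
  have hlR : (1:ℝ) ≤ l := by exact_mod_cast hl
  have hmR : (1:ℝ) ≤ m := by exact_mod_cast hm1
  have hnR : (1:ℝ) ≤ n := by exact_mod_cast hn1
  have heR : (20:ℝ) ≤ e := by exact_mod_cast he
  obtain ⟨D, hD⟩ : ∃ D, D = d₁ * d₂ * d₃ * d₄ := ⟨_, rfl⟩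
  have D0 : 0 < D := by rw [hD]; positivity
  have D1 : D ≤ g ^ 4 := by
    rw [hD]
    calc d₁ * d₂ * d₃ * d₄ ≤ g * g * g * g := by gcongr <;> omega
      _ = _ := by ring
  rw [← hD] at heq
  clear hD a1 a2 a3 a4 b1 b2 b3 b4
  have G : ∀ {y}, 1 ≤ y → g - 1 ≤ g ^ y - 1 := fun hy => by
    have := Nat.pow_le_pow_right (show 0 < g by omega) hy
    rw [pow_one] at this; omega
  have G0 : 0 < g - 1 := by omega
  have Gp : ∀ {y}, 1 ≤ y → 0 < g ^ y - 1 := fun hy => lt_of_lt_of_le G0 (G hy)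
  have Gq : ∀ y, g ^ y - 1 ≤ g ^ y := fun y => Nat.sub_le _ _
  have Gg : g - 1 ≤ g := Nat.sub_le _ _
  have Gm : ∀ {y}, 1 ≤ y → g ≤ g ^ y := fun hy => by
    simpa using Nat.pow_le_pow_right (show 0 < g by omega) hy
  obtain ⟨h, hh⟩ : ∃ h, h = Real.log g := ⟨_, rfl⟩
  have hkT : l + m + n + t ≤ k := by
    rw [← hh] at hsz hlb
    have : ((l + m + n + t : ℕ) : ℝ) ≤ k := by
      by_contra! hc
      have h23 : (23:ℝ) ≤ ((l + m + n + t : ℕ) : ℝ) := by push_cast; linarith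
      nlinarith
    exact_mod_cast this
  have hk4 : (13 + (l + m + n : ℝ)) * Real.log g ≤ k := by
    rw [← hh] at hsz hlb ⊢
    push_cast at hsz
    nlinarith
  obtain ⟨f1, -, -, -⟩ := prodR hg l m n t l le_rfl hm (hm.trans hn) ((hm.trans hn).trans ht)
  obtain ⟨-, f2, -, -⟩ := prodR hg m m n t m le_rfl le_rfl hn (hn.trans ht)
  obtain ⟨-, -, f3, -⟩ := prodR hg n n n t n le_rfl le_rfl le_rfl ht
  obtain ⟨-, -, -, f4⟩ := prodR hg t t t t t le_rfl le_rfl le_rfl le_rfl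
  have lh0 : 0 ≤ l * Real.log g := by positivity
  have mh0 : 0 ≤ m * Real.log g := by positivity
  have nh0 : 0 ≤ n * Real.log g := by positivity
  have s1 : l * Real.log g ≤ 1.601e11 * e ^ 2 * Real.log g * (13 * Real.log g) := by
    refine step (D := D) (P := 1) (R := (g ^ l - 1) * (g ^ m - 1) * (g ^ n - 1) * (g ^ t - 1)) (T := l + m + n + t)
      (k := k) hg D0 one_pos ?_ ?_ ?_ hkT (by omega) he ?_ ?_ (by linarith) hexp
    · rw [heq]; ring
    · push_cast [pw_cast hg]; exact f1
    · calc (g-1)^4 * g ^ l ≤ (g * g * g * g) * g ^ l := by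
            rw [show g * g * g * g = g ^ 4 by ring]; gcongr
        _ ≤ (g * g ^ m * g ^ n * g ^ t) * g ^ l := by
            gcongr
            · exact Gm hm1
            · exact Gm hn1
            · exact Gm ht1
        _ = 1 * (g * g ^ m * g ^ n * g ^ t * g ^ l) := by ring
        _ ≤ D * (g * g ^ m * g ^ n * g ^ t * g ^ l) := by gcongr; exact D0
        _ = _ := by ring
    · simpa using logH (s := 0) hg D0 one_pos D1 (by simp)
    · linarith
  have s2 : m * Real.log g ≤ 1.601e11 * e ^ 2 * Real.log g * ((13 + l) * Real.log g) := by
    refine step (D := D) (P := g ^ l - 1) (R := (g ^ m - 1) * (g ^ n - 1) * (g ^ t - 1)) (T := m + n + t)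
      (k := k) hg D0 (Gp hl) ?_ ?_ ?_ (by omega) (by omega) he ?_ ?_ ?_ hexp
    · rw [heq]; ring
    · push_cast [pw_cast hg]; exact f2
    · calc (g-1)^4 * g ^ m = 1 * (g - 1) * ((g-1) * (g-1) * (g-1)) * g ^ m := by ring
        _ ≤ D * (g ^ l - 1) * (g * g ^ n * g ^ t) * g ^ m := by
            gcongr
            · exact D0
            · exact Gm hl
            · exact Gg.trans (Gm hn1)
            · exact Gg.trans (Gm ht1)
        _ = _ := by ring
    · exact logH hg D0 (Gp hl) D1 (Gq l)
    · linarith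
    · linarith
  have s3 : n * Real.log g ≤ 1.601e11 * e ^ 2 * Real.log g * ((13 + l + m) * Real.log g) := by
    refine step (D := D) (P := (g ^ l - 1) * (g ^ m - 1)) (R := (g ^ n - 1) * (g ^ t - 1)) (T := n + t)
      (k := k) hg D0 (mul_pos (Gp hl) (Gp hm1)) ?_ ?_ ?_ (by omega) (by omega) he ?_ ?_ ?_ hexp
    · rw [heq]; ring
    · push_cast [pw_cast hg]; exact f3
    · calc (g-1)^4 * g ^ n = 1 * (g - 1) * (g-1) * ((g-1) * (g-1)) * g ^ n := by ring
        _ ≤ D * (g ^ l - 1) * (g ^ m - 1) * (g * g ^ t) * g ^ n := by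
            gcongr
            · exact D0
            · exact Gm hl
            · exact Gm hm1
            · exact Gg.trans (Gm ht1)
        _ = _ := by ring
    · have := logH (s := l + m) hg D0 (mul_pos (Gp hl) (Gp hm1)) D1 (by rw [pow_add]; gcongr <;> exact Gq _)
      push_cast at this ⊢
      rwa [← add_assoc] at this
    · linarith
    · linarith
  have s4 : t * Real.log g ≤ 1.601e11 * e ^ 2 * Real.log g * ((13 + l + m + n) * Real.log g) := by
    refine step (D := D) (P := (g ^ l - 1) * (g ^ m - 1) * (g ^ n - 1)) (R := (g ^ t - 1)) (T := t)
      (k := k) hg D0 (mul_pos (mul_pos (Gp hl) (Gp hm1)) (Gp hn1)) ?_ ?_ ?_ (by omega) (by omega) he ?_ ?_ ?_ hexp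
    · rw [heq]; ring
    · push_cast [pw_cast hg]; exact f4
    · calc (g-1)^4 * g ^ t = 1 * (g - 1) * (g-1) * (g-1) * (g-1) * g ^ t := by ring
        _ ≤ D * (g ^ l - 1) * (g ^ m - 1) * (g ^ n - 1) * g * g ^ t := by
            gcongr
            · exact D0
            · exact Gm hl
            · exact Gm hm1
            · exact Gm hn1
        _ = _ := by ring
    · have := logH (s := l + m + n) hg D0 (mul_pos (mul_pos (Gp hl) (Gp hm1)) (Gp hn1)) D1
        (by rw [pow_add, pow_add]; gcongr <;> exact Gq _)
      push_cast at this ⊢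
      rwa [← add_assoc, ← add_assoc] at this
    · linarith
    · linarith
  clear f1 f2 f3 f4 hk4 hkT heq hsz
  rw [← hh] at s1 s2 s3 s4 hlb ⊢
  have h0 : 0 < h := by linarith
  obtain ⟨C, hC⟩ : ∃ C, C = 1.602e11 * (e:ℝ) ^ 2 * h := ⟨_, rfl⟩
  have c1 : 1.601e11 * (e:ℝ) ^ 2 * h + 1 ≤ C := by
    have : (20:ℝ) ^ 2 * 0.6931 ≤ e ^ 2 * h := by gcongr
    rw [hC]; linarith
  rw [← hC]
  have C0 : 0 ≤ C := by rw [hC]; positivity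
  obtain ⟨B, hB⟩ : ∃ B, B = 1.601e11 * (e:ℝ) ^ 2 * h := ⟨_, rfl⟩
  rw [← hB] at s1 s2 s3 s4 c1
  have B0 : 0 ≤ B := by rw [hB]; positivity
  clear hC hB
  have u : ∀ {x y : ℝ}, 0 ≤ y → x ≤ B * y → y + x ≤ C * y := by
    intro x y hy hx
    nlinarith
  have v1 := u (by positivity) s1
  have v2 := u (by positivity) s2
  have v3 := u (by positivity) s3
  have v4 : t * h ≤ C * ((13 + l + m + n) * h) := s4.trans (by gcongr; linarith)
  calc (t:ℝ) * h ≤ C * ((13 + l + m + n) * h) := v4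
    _ = C * ((13 + l + m) * h + n * h) := by ring
    _ ≤ C * (C * ((13 + l + m) * h)) := by gcongr
    _ = C * (C * ((13 + l) * h + m * h)) := by ring
    _ ≤ C * (C * (C * ((13 + l) * h))) := by gcongr
    _ = C * (C * (C * (13 * h + l * h))) := by ring
    _ ≤ C * (C * (C * (C * (13 * h)))) := by gcongr
    _ = _ := by ring

end ZE

namespace ZE

theorem bounds {g k d₁ d₂ d₃ d₄ l m n t : ℕ} (hg : 2 ≤ g) (hs : IsSolution g k d₁ d₂ d₃ d₄ l m n t) :
    (t : ℝ) < 2.11e67 * Real.log g ^ 12 ∧ (k : ℝ) < 2.54e68 * Real.log g ^ 13 := by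
  have hlb := logg_lb hg
  obtain ⟨z1, z2⟩ := size hg hs
  have hc := chain hg hs
  obtain ⟨hk, a1, b1, a2, b2, a3, b3, a4, b4, hl, hm, hn, ht, heq⟩ := hs
  have hlR : (1:ℝ) ≤ l := by exact_mod_cast hl
  have hmR : (l:ℝ) ≤ m := by exact_mod_cast hm
  have hnR : (m:ℝ) ≤ n := by exact_mod_cast hn
  have htR : (n:ℝ) ≤ t := by exact_mod_cast ht
  push_cast at z1 z2
  clear heq
  have h12 : (0.6931:ℝ) ^ 12 ≤ Real.log g ^ 12 := by gcongr
  have h13 : (0.6931:ℝ) ^ 13 ≤ Real.log g ^ 13 := by gcongr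
  have z3 : (t + 3) * Real.log g ≤ (l + m + n + t : ℝ) * Real.log g :=
    mul_le_mul_of_nonneg_right (by linarith) (by linarith)
  have z4 : (l + m + n + t : ℝ) * Real.log g ≤ (4 * t) * Real.log g := by gcongr; linarith
  have T : (t : ℝ) < 2.11e67 * Real.log g ^ 12 := by
    by_contra! hcon
    have ht20 : (20:ℝ) ≤ t := by norm_num only at h12 hcon; linarith
    refine num_contra hlb hcon ?_ (by linarith) (hc (by exact_mod_cast ht20))
    nlinarith
  refine ⟨T, ?_⟩
  have z5 : (4 * t) * Real.log g ≤ (4 * (2.11e67 * Real.log g ^ 12)) * Real.log g := by gcongr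
  have z6 : (4 * (2.11e67 * Real.log g ^ 12)) * Real.log g = 8.44e67 * Real.log g ^ 13 := by ring
  norm_num at h13 z6 z5 ⊢
  linarith

theorem fin_sol (g : ℕ) (hg : 2 ≤ g) :
    {x : ℕ × ℕ × ℕ × ℕ × ℕ × ℕ × ℕ × ℕ × ℕ |
      IsSolution g x.1 x.2.1 x.2.2.1 x.2.2.2.1 x.2.2.2.2.1 x.2.2.2.2.2.1
        x.2.2.2.2.2.2.1 x.2.2.2.2.2.2.2.1 x.2.2.2.2.2.2.2.2}.Finite := by
  obtain ⟨K, hK⟩ := exists_nat_ge (2.54e68 * Real.log g ^ 13)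
  obtain ⟨T, hT⟩ := exists_nat_ge (2.11e67 * Real.log g ^ 12)
  refine (Set.finite_Iic ((K, g, g, g, g, T, T, T, T) : ℕ × ℕ × ℕ × ℕ × ℕ × ℕ × ℕ × ℕ × ℕ)).subset ?_
  rintro ⟨k, d1, d2, d3, d4, l, m, n, t⟩ hx
  have hx' : IsSolution g k d1 d2 d3 d4 l m n t := hx
  obtain ⟨ht, hk⟩ := bounds hg hx'
  have ht' : t ≤ T := by exact_mod_cast (ht.le.trans hT)
  have hk' : k ≤ K := by exact_mod_cast (hk.le.trans hK)
  obtain ⟨hk, a1, b1, a2, b2, a3, b3, a4, b4, hl, hm, hn, ht, heq⟩ := hx'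
  simp only [Set.mem_Iic, Prod.mk_le_mk]
  refine ⟨?_, ?_, ?_, ?_, ?_, ?_, ?_, ?_, ?_⟩ <;> omega

end ZE

theorem narayana_product_four_repdigits_bounds (g : ℕ) (hg : 2 ≤ g) :
    (∀ k d₁ d₂ d₃ d₄ ℓ m n t : ℕ, IsSolution g k d₁ d₂ d₃ d₄ ℓ m n t →
      (t : ℝ) < 2.11e67 * Real.log g ^ 12 ∧ (k : ℝ) < 2.54e68 * Real.log g ^ 13) ∧
    {x : ℕ × ℕ × ℕ × ℕ × ℕ × ℕ × ℕ × ℕ × ℕ |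
      IsSolution g x.1 x.2.1 x.2.2.1 x.2.2.2.1 x.2.2.2.2.1 x.2.2.2.2.2.1
        x.2.2.2.2.2.2.1 x.2.2.2.2.2.2.2.1 x.2.2.2.2.2.2.2.2}.Finite := by
  exact ⟨fun k d₁ d₂ d₃ d₄ ℓ m n t hs => ZE.bounds hg hs, ZE.fin_sol g hg⟩
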